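/- Let K be a global function field of characteristic p containing a primitive q-th root of unity, where q ≠ p is prime. Fix x ∈ K^× and let S be a nonempty finite set of primes of K containing every pole of x. Let a, b ∈ K^× satisfy: (1) a and b are units at all primes of S; (2) ord_𝔭(a−1) > 0 for every 𝔭 ∈ S. Assume in addition that every element inverted below is nonzero, and define L_1 = K((1+(bx^q+b^q)^{-1})^{1/q}), L_3 = L_1((1+x^{-1})^{1/q}), and L_4 = L_3((1+(a+a^{-1})x^{-1})^{1/q}). Then there exists y ∈ L_4(a^{1/q}) with N_{L_4(a^{1/q})/L_4}(y) = b x^q + b^q. -/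

import Mathlib

noncomputable section

/-- A normalized (surjective onto `ℤ`) discrete valuation on a field `K`, i.e. a
"prime" of a global function field. -/
structure FFPrime (K : Type) [Field K] where
  ord : K → WithTop ℤ
  ord_zero : ord 0 = ⊤
  ord_ne_top : ∀ x : K, x ≠ 0 → ord x ≠ ⊤
  ord_one : ord 1 = 0
  ord_mul : ∀ x y : K, ord (x * y) = ord x + ord y
  ord_add : ∀ x y : K, min (ord x) (ord y) ≤ ord (x + y)
  ord_surj : ∀ n : ℤ, ∃ x : K, ord x = (n : WithTop ℤ)

namespace FFPrime

variable {K L : Type} [Field K] [Field L]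

/-- `w` lies over `v` along `φ`, with ramification index `e`. -/
def LiesOverWith (w : FFPrime L) (v : FFPrime K) (φ : K →+* L) (e : ℕ) : Prop :=
  0 < e ∧ ∀ x : K, w.ord (φ x) = ((e : ℤ) : WithTop ℤ) * v.ord x

/-- `w` lies over `v` along `φ`. -/
def LiesOver (w : FFPrime L) (v : FFPrime K) (φ : K →+* L) : Prop :=
  ∃ e : ℕ, w.LiesOverWith v φ e

open Classical in
/-- The ramification index `e(w/v)`. -/
noncomputable def ramIdx (w : FFPrime L) (v : FFPrime K) (φ : K →+* L) : ℕ :=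
  if h : ∃ e : ℕ, w.LiesOverWith v φ e then h.choose else 0

/-- The residue field of `v` has exactly `n` elements. -/
def HasResidueCard (v : FFPrime K) (n : ℕ) : Prop :=
  ∃ s : Finset K, s.card = n ∧ (∀ x ∈ s, 0 ≤ v.ord x) ∧
    (∀ x ∈ s, ∀ y ∈ s, x ≠ y → ¬ 0 < v.ord (x - y)) ∧
    (∀ z : K, 0 ≤ v.ord z → ∃ x ∈ s, 0 < v.ord (z - x))

open Classical in
/-- The residue (relative) degree `f(w/v)`: the unique `f ≥ 1` with
`#κ_w = (#κ_v) ^ f` (residue fields of global function fields are finite). -/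
noncomputable def resDeg (w : FFPrime L) (v : FFPrime K) : ℕ :=
  if h : ∃ f : ℕ, 0 < f ∧ ∃ m n : ℕ, 1 < m ∧ v.HasResidueCard m ∧
      w.HasResidueCard n ∧ n = m ^ f then h.choose else 0

/-- `v` splits completely in the extension given by `φ`: every prime above it has
ramification index and residue degree `1`. -/
def SplitsCompletely (v : FFPrime K) (φ : K →+* L) : Prop :=
  ∀ w : FFPrime L, w.LiesOver v φ → w.ramIdx v φ = 1 ∧ w.resDeg v = 1

/-- `v` is inert in the finite extension `M/K`: there is a unique prime above it, with
ramification index `1` and residue degree `[M : K]`. -/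
def IsInert (v : FFPrime K) (M : Type) [Field M] [Algebra K M] : Prop :=
  (∃! w : FFPrime M, w.LiesOver v (algebraMap K M)) ∧
    ∀ w : FFPrime M, w.LiesOver v (algebraMap K M) →
      w.ramIdx v (algebraMap K M) = 1 ∧ w.resDeg v = Module.finrank K M

/-- `v` ramifies in the extension given by `φ`: some prime above it has ramification
index `> 1`. -/
def Ramifies (v : FFPrime K) (φ : K →+* L) : Prop :=
  ∃ w : FFPrime L, w.LiesOver v φ ∧ 2 ≤ w.ramIdx v φ

/-- `ord_v z ≡ 0 mod q`. -/
def OrdDvd (v : FFPrime K) (q : ℕ) (z : K) : Prop :=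
  ∃ n : ℤ, v.ord z = (((q : ℤ) * n : ℤ) : WithTop ℤ)

end FFPrime

/-- A nontrivial (rank one) valuation on a possibly infinite algebraic extension of a
global function field, with values in `ℚ ∪ {∞}`. -/
structure FFVal (B : Type) [Field B] where
  ord : B → WithTop ℚ
  ord_zero : ord 0 = ⊤
  ord_ne_top : ∀ x : B, x ≠ 0 → ord x ≠ ⊤
  ord_one : ord 1 = 0
  ord_mul : ∀ x y : B, ord (x * y) = ord x + ord y
  ord_add : ∀ x y : B, min (ord x) (ord y) ≤ ord (x + y)
  nontrivial : ∃ x : B, ord x ≠ 0 ∧ ord x ≠ ⊤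

/-- The valuation `V` of the big field restricts, up to a normalization factor `c`, to
the (normalized discrete) prime `v` of `K` along `φ`; i.e. `v` is the prime of `K`
lying below `V`. -/
def FFVal.RestrictsTo {K B : Type} [Field K] [Field B] (V : FFVal B) (v : FFPrime K)
    (φ : K →+* B) : Prop :=
  ∃ c : ℚ, 0 < c ∧
    ∀ x : K, V.ord (φ x) = ((c : ℚ) : WithTop ℚ) * WithTop.map (fun n : ℤ => (n : ℚ)) (v.ord x)

/-- The algebraic extension `B` of the rational function field `F0 = 𝔽_p(t)` is
`q`-bounded: for every valuation of `B`, the `q`-adic valuations of the ramification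
indices and residue degrees along every finite subextension are bounded. -/
def IsQBounded (q : ℕ) (F0 B : Type) [Field F0] [Field B] [Algebra F0 B] : Prop :=
  ∀ V : FFVal B, ∃ C : ℕ,
    ∀ L : IntermediateField F0 B, FiniteDimensional F0 L →
      ∀ v0 : FFPrime F0, ∀ vL : FFPrime L,
        V.RestrictsTo v0 (algebraMap F0 B) →
        V.RestrictsTo vL L.val.toRingHom →
        padicValNat q (vL.ramIdx v0 (algebraMap F0 L)) ≤ C ∧
        padicValNat q (vL.resDeg v0) ≤ C

/-- The prime `v` of `K` has uniformly `q`-bounded ramification in `B`. -/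
def UnifQBoundedRam (q : ℕ) {K : Type} [Field K] (B : Type) [Field B] [Algebra K B]
    (v : FFPrime K) : Prop :=
  ∃ C : ℕ, ∀ F : IntermediateField K B, FiniteDimensional K F →
    ∀ w : FFPrime F, w.LiesOver v (algebraMap K F) →
      padicValNat q (w.ramIdx v (algebraMap K F)) ≤ C

/-- The prime `v` of `K` has uniformly absolutely bounded ramification in `B`. -/
def UnifAbsBoundedRam {K : Type} [Field K] (B : Type) [Field B] [Algebra K B]
    (v : FFPrime K) : Prop :=
  ∃ C : ℕ, ∀ F : IntermediateField K B, FiniteDimensional K F →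
    ∀ w : FFPrime F, w.LiesOver v (algebraMap K F) →
      w.ramIdx v (algebraMap K F) ≤ C

/-- The prime `v` of `K` has uniformly `q`-bounded relative (residue) degree in `B`. -/
def UnifQBoundedRes (q : ℕ) {K : Type} [Field K] (B : Type) [Field B] [Algebra K B]
    (v : FFPrime K) : Prop :=
  ∃ C : ℕ, ∀ F : IntermediateField K B, FiniteDimensional K F →
    ∀ w : FFPrime F, w.LiesOver v (algebraMap K F) →
      padicValNat q (w.resDeg v) ≤ C

/-- The prime `v` of `K` is uniformly `q`-bounded in `B`. -/
def UniformlyQBoundedAt (q : ℕ) {K : Type} [Field K] (B : Type) [Field B] [Algebra K B]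
    (v : FFPrime K) : Prop :=
  UnifQBoundedRam q B v ∧ UnifQBoundedRes q B v

/-- The integral closure in `B` of the valuation ring `O_v = {x ∈ K : ord_v x ≥ 0}`. -/
def valIntegralClosure {K : Type} [Field K] (v : FFPrime K) (B : Type) [Field B]
    [Algebra K B] : Set B :=
  {x : B | ∃ P : Polynomial K, P.Monic ∧ (∀ n : ℕ, 0 ≤ v.ord (P.coeff n)) ∧
    Polynomial.aeval x P = 0}

/-- The integral closure in `B` of the ring `O_{K,S}` of `S`-integers of `K`. -/
def sIntegralClosure {K : Type} [Field K] (S : Set (FFPrime K)) (B : Type) [Field B]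
    [Algebra K B] : Set B :=
  {x : B | ∃ P : Polynomial K, P.Monic ∧
    (∀ n : ℕ, ∀ v : FFPrime K, v ∉ S → 0 ≤ v.ord (P.coeff n)) ∧
    Polynomial.aeval x P = 0}

/-- Elements of `B` that are units at every prime of `B` lying over a prime of `S`. -/
def unitsAtS {K : Type} [Field K] (S : Set (FFPrime K)) (B : Type) [Field B]
    [Algebra K B] : Set B :=
  {x : B | ∀ V : FFVal B, (∃ v ∈ S, V.RestrictsTo v (algebraMap K B)) → V.ord x = 0}

/-- Elements `x` of `B` with `ord (x - 1) > 0` at every prime of `B` lying over a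
prime of `S`. -/
def onesAtS {K : Type} [Field K] (S : Set (FFPrime K)) (B : Type) [Field B]
    [Algebra K B] : Set B :=
  {x : B | ∀ V : FFVal B, (∃ v ∈ S, V.RestrictsTo v (algebraMap K B)) → 0 < V.ord (x - 1)}

/-- A subset of a commutative ring is first-order definable in the language of rings
`{0, 1, +, ·}` with parameters from the ring. -/
def FODefinable {R : Type} [CommRing R] (X : Set R) : Prop :=
  letI : FirstOrder.Ring.CompatibleRing R := FirstOrder.Ring.compatibleRingOfRing R
  Set.Definable₁ (Set.univ : Set R) FirstOrder.Language.ring X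

/-- A subset of a commutative ring is existentially (diophantine) definable: it is cut
out by a block of existential quantifiers followed by a system of polynomial equations,
with parameters (coefficients) from the ring. -/
def ExistDefinable {R : Type} [CommRing R] (X : Set R) : Prop :=
  ∃ (k m : ℕ) (P : Fin m → MvPolynomial (Fin (k + 1)) R),
    ∀ x : R, x ∈ X ↔ ∃ y : Fin k → R, ∀ i : Fin m,
      MvPolynomial.eval (Fin.cons x y) (P i) = 0

/-- Solvability of the norm equation `N(y) = b·x^q + b^q` over (every realization of)
the tower `L₂(a^{1/q})/L₂`, where `L₁ = F((1+(b x^q+b^q)⁻¹)^{1/q})` and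
`L₂ = L₁((1+(a+a⁻¹)b⁻¹)^{1/q})`. -/
def NormTower2Solvable (q : ℕ) (F : Type) [Field F] (a b x : F) : Prop :=
  ∀ (M1 : Type) [Field M1] [Algebra F M1] (α1 : M1),
    α1 ^ q = algebraMap F M1 (1 + (b * x ^ q + b ^ q)⁻¹) →
    IntermediateField.adjoin F {α1} = ⊤ →
    ∀ (M2 : Type) [Field M2] [Algebra M1 M2] (α2 : M2),
      α2 ^ q = algebraMap M1 M2 (algebraMap F M1 (1 + (a + a⁻¹) * b⁻¹)) →
      IntermediateField.adjoin M1 {α2} = ⊤ →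
      ∀ (M3 : Type) [Field M3] [Algebra M2 M3] (α3 : M3),
        α3 ^ q = algebraMap M2 M3 (algebraMap M1 M2 (algebraMap F M1 a)) →
        IntermediateField.adjoin M2 {α3} = ⊤ →
        ∃ y : M3, Algebra.norm M2 y = algebraMap M1 M2 (algebraMap F M1 (b * x ^ q + b ^ q))

/-- Solvability of the norm equation `N(y) = b·x^q + b^q` over (every realization of)
the tower `L₄(a^{1/q})/L₄`, where `L₁ = F((1+(b x^q+b^q)⁻¹)^{1/q})`,
`L₃ = L₁((1+x⁻¹)^{1/q})` and `L₄ = L₃((1+(a+a⁻¹)x⁻¹)^{1/q})`. -/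
def NormTower4Solvable (q : ℕ) (F : Type) [Field F] (a b x : F) : Prop :=
  ∀ (M1 : Type) [Field M1] [Algebra F M1] (α1 : M1),
    α1 ^ q = algebraMap F M1 (1 + (b * x ^ q + b ^ q)⁻¹) →
    IntermediateField.adjoin F {α1} = ⊤ →
    ∀ (M3 : Type) [Field M3] [Algebra M1 M3] (α3 : M3),
      α3 ^ q = algebraMap M1 M3 (algebraMap F M1 (1 + x⁻¹)) →
      IntermediateField.adjoin M1 {α3} = ⊤ →
      ∀ (M4 : Type) [Field M4] [Algebra M3 M4] (α4 : M4),
        α4 ^ q = algebraMap M3 M4 (algebraMap M1 M3 (algebraMap F M1 (1 + (a + a⁻¹) * x⁻¹))) →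
        IntermediateField.adjoin M3 {α4} = ⊤ →
        ∀ (M5 : Type) [Field M5] [Algebra M4 M5] (α5 : M5),
          α5 ^ q = algebraMap M4 M5 (algebraMap M3 M4 (algebraMap M1 M3 (algebraMap F M1 a))) →
          IntermediateField.adjoin M4 {α5} = ⊤ →
          ∃ y : M5, Algebra.norm M4 y =
            algebraMap M3 M4 (algebraMap M1 M3 (algebraMap F M1 (b * x ^ q + b ^ q)))

/-- Unsolvability of the norm equation `N(y) = b·x^q + b^q` over (every realization of)
the tower `L₄(a^{1/q})/L₄` as in `NormTower4Solvable`. -/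
def NormTower4Unsolvable (q : ℕ) (F : Type) [Field F] (a b x : F) : Prop :=
  ∀ (M1 : Type) [Field M1] [Algebra F M1] (α1 : M1),
    α1 ^ q = algebraMap F M1 (1 + (b * x ^ q + b ^ q)⁻¹) →
    IntermediateField.adjoin F {α1} = ⊤ →
    ∀ (M3 : Type) [Field M3] [Algebra M1 M3] (α3 : M3),
      α3 ^ q = algebraMap M1 M3 (algebraMap F M1 (1 + x⁻¹)) →
      IntermediateField.adjoin M1 {α3} = ⊤ →
      ∀ (M4 : Type) [Field M4] [Algebra M3 M4] (α4 : M4),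
        α4 ^ q = algebraMap M3 M4 (algebraMap M1 M3 (algebraMap F M1 (1 + (a + a⁻¹) * x⁻¹))) →
        IntermediateField.adjoin M3 {α4} = ⊤ →
        ∀ (M5 : Type) [Field M5] [Algebra M4 M5] (α5 : M5),
          α5 ^ q = algebraMap M4 M5 (algebraMap M3 M4 (algebraMap M1 M3 (algebraMap F M1 a))) →
          IntermediateField.adjoin M4 {α5} = ⊤ →
          ¬ ∃ y : M5, Algebra.norm M4 y =
            algebraMap M3 M4 (algebraMap M1 M3 (algebraMap F M1 (b * x ^ q + b ^ q)))

set_option autoImplicit false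
set_option linter.all false

namespace FFPrime

variable {F : Type} [Field F]

theorem ext' {v w : FFPrime F} (h : ∀ x, v.ord x = w.ord x) : v = w := by
  cases v; cases w
  congr
  funext x
  exact h x

/-- integer valued order (junk value `0` at `0`) -/
def n (v : FFPrime F) (x : F) : ℤ := (v.ord x).untopD 0

/-- order at least `k` -/
def ge (v : FFPrime F) (k : ℤ) (x : F) : Prop := (k : WithTop ℤ) ≤ v.ord x

variable (v : FFPrime F)

theorem ord_eq {x : F} (hx : x ≠ 0) : v.ord x = (v.n x : WithTop ℤ) := by
  unfold n
  have := v.ord_ne_top x hx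
  cases h : v.ord x with
  | top => exact absurd h this
  | coe a => simp

theorem ge_iff {x : F} (hx : x ≠ 0) {k : ℤ} : v.ge k x ↔ k ≤ v.n x := by
  unfold ge; rw [v.ord_eq hx]; exact WithTop.coe_le_coe

theorem ge_zero (k : ℤ) : v.ge k 0 := by unfold ge; rw [v.ord_zero]; exact le_top

theorem n_mul {x y : F} (hx : x ≠ 0) (hy : y ≠ 0) : v.n (x * y) = v.n x + v.n y := by
  have := v.ord_mul x y
  rw [v.ord_eq hx, v.ord_eq hy, v.ord_eq (mul_ne_zero hx hy)] at this
  exact_mod_cast this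

@[simp] theorem n_one : v.n 1 = 0 := by simp [n, v.ord_one]

theorem n_zero : v.n 0 = 0 := by simp [n, v.ord_zero]

theorem n_pow {x : F} (hx : x ≠ 0) (m : ℕ) : v.n (x ^ m) = m * v.n x := by
  induction m with
  | zero => simp
  | succ m ih => rw [pow_succ, v.n_mul (pow_ne_zero _ hx) hx, ih]; push_cast; ring

theorem n_inv (x : F) : v.n x⁻¹ = - v.n x := by
  by_cases hx : x = 0
  · simp [hx, n_zero]
  have := v.n_mul hx (inv_ne_zero hx)
  rw [mul_inv_cancel₀ hx, n_one] at this
  omega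

theorem n_zpow {x : F} (hx : x ≠ 0) (m : ℤ) : v.n (x ^ m) = m * v.n x := by
  cases m with
  | ofNat m => simpa using v.n_pow hx m
  | negSucc m =>
    rw [zpow_negSucc, v.n_inv, v.n_pow hx, Int.negSucc_eq]; push_cast; ring

theorem n_of_pow_eq_one {x : F} {m : ℕ} (hm : m ≠ 0) (h : x ^ m = 1) : v.n x = 0 := by
  have hx : x ≠ 0 := by rintro rfl; simp [hm] at h
  have := v.n_pow hx m
  rw [h, n_one] at this
  rcases mul_eq_zero.1 this.symm with h | h
  · exact absurd (by exact_mod_cast h) hm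
  · exact h

@[simp] theorem n_neg (x : F) : v.n (-x) = v.n x := by
  by_cases hx : x = 0
  · simp [hx]
  have h1 : v.n (-1 : F) = 0 := v.n_of_pow_eq_one (m := 2) (by norm_num) (by norm_num)
  have := v.n_mul (neg_ne_zero.2 one_ne_zero) hx
  rw [h1] at this
  simpa using this

theorem ge_neg {k : ℤ} {x : F} (h : v.ge k x) : v.ge k (-x) := by
  by_cases hx : x = 0
  · simpa [hx] using v.ge_zero k
  rw [v.ge_iff (neg_ne_zero.2 hx), n_neg]; exact (v.ge_iff hx).1 h

theorem ge_add {k : ℤ} {x y : F} (hx : v.ge k x) (hy : v.ge k y) : v.ge k (x + y) :=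
  le_trans (le_min hx hy) (v.ord_add x y)

theorem ge_sub {k : ℤ} {x y : F} (hx : v.ge k x) (hy : v.ge k y) : v.ge k (x - y) := by
  rw [sub_eq_add_neg]; exact v.ge_add hx (v.ge_neg hy)

theorem ge_mul {k l : ℤ} {x y : F} (hx : v.ge k x) (hy : v.ge l y) : v.ge (k + l) (x * y) := by
  unfold ge; rw [v.ord_mul]; push_cast; exact add_le_add hx hy

theorem ge_mono {k l : ℤ} (h : l ≤ k) {x : F} (hx : v.ge k x) : v.ge l x :=
  le_trans (by exact_mod_cast h) hx

theorem ge_n (x : F) : v.ge (v.n x) x := by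
  by_cases hx : x = 0
  · rw [hx]; exact v.ge_zero _
  · rw [v.ge_iff hx]

theorem ge_sum {ι : Type*} (s : Finset ι) (f : ι → F) {k : ℤ} (h : ∀ i ∈ s, v.ge k (f i)) :
    v.ge k (∑ i ∈ s, f i) := by
  classical
  induction s using Finset.induction_on with
  | empty => simpa using v.ge_zero k
  | insert a s ha ih =>
    rw [Finset.sum_insert ha]
    exact v.ge_add (h a (by simp)) (ih fun i hi => h i (by simp [hi]))

theorem ge_pow {k : ℤ} {x : F} (hx : v.ge k x) (m : ℕ) : v.ge (m * k) (x ^ m) := by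
  induction m with
  | zero => simp [ge, v.ord_one]
  | succ m ih =>
    rw [pow_succ]
    have := v.ge_mul ih hx
    convert this using 1; push_cast; ring

theorem ge_one : v.ge 0 1 := by simp [ge, v.ord_one]

theorem ge_pow_zero {x : F} (hx : v.ge 0 x) (m : ℕ) : v.ge 0 (x ^ m) := by
  simpa using v.ge_pow hx m

/-- `n` of a sum with strictly dominated second term -/
theorem n_add_eq {x y : F} (hx : x ≠ 0) (h : v.ge (v.n x + 1) y) :
    x + y ≠ 0 ∧ v.n (x + y) = v.n x := by
  have h0 : x + y ≠ 0 := by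
    intro h0
    have : y = -x := by linear_combination h0
    rw [this] at h
    have := (v.ge_iff (neg_ne_zero.2 hx)).1 h
    rw [n_neg] at this; omega
  refine ⟨h0, le_antisymm ?_ ?_⟩
  · by_contra hlt
    push Not at hlt
    have h1 : v.ge (v.n x + 1) (x + y) := (v.ge_iff h0).2 hlt
    have h2 := v.ge_sub h1 h
    rw [add_sub_cancel_right] at h2
    have := (v.ge_iff hx).1 h2
    omega
  · exact (v.ge_iff h0).1 (v.ge_add (v.ge_n x) (v.ge_mono (by omega) h))

theorem exists_n (k : ℤ) : ∃ x : F, x ≠ 0 ∧ v.n x = k := by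
  obtain ⟨x, hx⟩ := v.ord_surj k
  refine ⟨x, ?_, by simp [n, hx]⟩
  rintro rfl
  rw [v.ord_zero] at hx
  exact WithTop.top_ne_coe hx

theorem ext_n {v w : FFPrime F} (h : ∀ x, x ≠ 0 → v.n x = w.n x) : v = w := by
  apply ext'
  intro x
  by_cases hx : x = 0
  · rw [hx, v.ord_zero, w.ord_zero]
  · rw [v.ord_eq hx, w.ord_eq hx, h x hx]

/-- constructor from integer valued data -/
def mkN (f : F → ℤ) (hmul : ∀ x y, x ≠ 0 → y ≠ 0 → f (x * y) = f x + f y)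
    (hadd : ∀ x y, x ≠ 0 → y ≠ 0 → x + y ≠ 0 → min (f x) (f y) ≤ f (x + y))
    (hsurj : ∃ x, x ≠ 0 ∧ f x = 1) : FFPrime F := by
  classical
  exact
  { ord := fun x => if x = 0 then ⊤ else (f x : WithTop ℤ)
    ord_zero := by simp
    ord_ne_top := by intro x hx; simp [hx]
    ord_one := by
      have := hmul 1 1 one_ne_zero one_ne_zero
      simp at this ⊢
      exact this
    ord_mul := by
      intro x y
      by_cases hx : x = 0
      · simp [hx]
      by_cases hy : y = 0
      · simp [hy]
      simp only [hx, hy, mul_eq_zero, or_self, if_false, hmul x y hx hy]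
      push_cast; rfl
    ord_add := by
      intro x y
      by_cases hx : x = 0
      · simp [hx]
      by_cases hy : y = 0
      · simp [hy]
      by_cases hxy : x + y = 0
      · simp [hxy]
      simp only [hx, hy, hxy, if_false]
      have := hadd x y hx hy hxy
      exact_mod_cast this
    ord_surj := by
      obtain ⟨x, hx, hx1⟩ := hsurj
      have h1 : f 1 = 0 := by
        have := hmul 1 1 one_ne_zero one_ne_zero
        simp at this; exact this
      have hinv : f x⁻¹ = -1 := by
        have := hmul x x⁻¹ hx (inv_ne_zero hx)
        rw [mul_inv_cancel₀ hx, h1, hx1] at this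
        omega
      have hp : ∀ (y : F) (hy : y ≠ 0) (m : ℕ), f (y ^ m) = m * f y := by
        intro y hy m
        induction m with
        | zero => simp [h1]
        | succ m ih => rw [pow_succ, hmul _ _ (pow_ne_zero _ hy) hy, ih]; push_cast; ring
      intro k
      rcases Int.eq_nat_or_neg k with ⟨m, rfl | rfl⟩
      · refine ⟨x ^ m, ?_⟩
        rw [if_neg (pow_ne_zero _ hx), hp x hx, hx1]; simp
      · refine ⟨x⁻¹ ^ m, ?_⟩
        rw [if_neg (pow_ne_zero _ (inv_ne_zero hx)), hp _ (inv_ne_zero hx), hinv]; simp }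

theorem mkN_n (f : F → ℤ) (h1 h2 h3) {x : F} (hx : x ≠ 0) : (mkN f h1 h2 h3).n x = f x := by
  simp [n, mkN, hx]

theorem min_le_n_add {x y : F} (hx : x ≠ 0) (hy : y ≠ 0) (hxy : x + y ≠ 0) :
    min (v.n x) (v.n y) ≤ v.n (x + y) := by
  rw [← v.ge_iff hxy]
  exact v.ge_add (v.ge_mono (min_le_left _ _) (v.ge_n x)) (v.ge_mono (min_le_right _ _) (v.ge_n y))

open Classical in
/-- associated real absolute value `2 ^ (- ord)` -/
def abv : AbsoluteValue F ℝ where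
  toFun x := if x = 0 then 0 else (2 : ℝ) ^ (- v.n x)
  map_mul' x y := by
    by_cases hx : x = 0
    · simp [hx]
    by_cases hy : y = 0
    · simp [hy]
    simp only [hx, hy, mul_eq_zero, or_self, if_false, v.n_mul hx hy]
    rw [neg_add, zpow_add₀ (by norm_num)]
  nonneg' x := by
    split_ifs
    · exact le_rfl
    · positivity
  eq_zero' x := by
    by_cases hx : x = 0
    · simp [hx]
    · simp only [hx, if_false, iff_false]; positivity
  add_le' x y := by
    by_cases hx : x = 0
    · simp [hx]
    by_cases hy : y = 0
    · simp [hy]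
    by_cases hxy : x + y = 0
    · simp only [hxy, if_true, hx, hy, if_false]; positivity
    simp only [hx, hy, hxy, if_false]
    have := v.min_le_n_add hx hy hxy
    rcases min_le_iff.1 this with h | h
    · have : (2 : ℝ) ^ (-v.n (x + y)) ≤ 2 ^ (- v.n x) :=
        zpow_le_zpow_right₀ (by norm_num) (by omega)
      have h2 : (0 : ℝ) < 2 ^ (- v.n y) := by positivity
      linarith
    · have : (2 : ℝ) ^ (-v.n (x + y)) ≤ 2 ^ (- v.n y) :=
        zpow_le_zpow_right₀ (by norm_num) (by omega)
      have h2 : (0 : ℝ) < 2 ^ (- v.n x) := by positivity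
      linarith

theorem abv_apply {x : F} (hx : x ≠ 0) : v.abv x = (2 : ℝ) ^ (- v.n x) := by
  simp [abv, hx]

theorem ge_iff_abv {x : F} {k : ℤ} : v.ge k x ↔ v.abv x ≤ 2 ^ (-k) := by
  by_cases hx : x = 0
  · simp only [hx, map_zero, v.ge_zero k, true_iff]; positivity
  rw [v.ge_iff hx, v.abv_apply hx, zpow_le_zpow_iff_right₀ (by norm_num)]
  omega

theorem abv_nontrivial : v.abv.IsNontrivial := by
  obtain ⟨x, hx, h⟩ := v.exists_n 1
  refine ⟨x, hx, ?_⟩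
  rw [v.abv_apply hx, h]; norm_num

theorem eq_of_isEquiv {v w : FFPrime F} (h : v.abv.IsEquiv w.abv) : v = w := by
  have hsgn : ∀ x, x ≠ 0 → (0 ≤ v.n x ↔ 0 ≤ w.n x) := by
    intro x hx
    have := h.le_one_iff (x := x)
    rw [← zpow_zero (2 : ℝ), ← neg_zero, ← v.ge_iff_abv, ← w.ge_iff_abv, v.ge_iff hx, w.ge_iff hx] at this
    exact this
  obtain ⟨π, hπ, hπ1⟩ := v.exists_n 1
  have hu : ∀ x, x ≠ 0 → v.n x = 0 → w.n x = 0 := by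
    intro x hx h0
    have h1 := (hsgn x hx).1 h0.ge
    have h2 := (hsgn x⁻¹ (inv_ne_zero hx)).1 (by rw [v.n_inv, h0]; simp)
    rw [w.n_inv] at h2; omega
  have hlin : ∀ x, x ≠ 0 → w.n x = v.n x * w.n π := by
    intro x hx
    have := hu (x * π ^ (- v.n x)) (mul_ne_zero hx (zpow_ne_zero _ hπ)) (by
      rw [v.n_mul hx (zpow_ne_zero _ hπ), v.n_zpow hπ, hπ1]; ring)
    rw [w.n_mul hx (zpow_ne_zero _ hπ), w.n_zpow hπ] at this
    linarith
  have hpos : 0 ≤ w.n π := (hsgn π hπ).1 (by omega)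
  obtain ⟨y, hy, hy1⟩ := w.exists_n 1
  have h1 := hlin y hy
  rw [hy1] at h1
  have : w.n π = 1 := by
    have hd : w.n π ∣ 1 := ⟨v.n y, by linarith⟩
    exact Int.eq_one_of_dvd_one hpos hd
  exact ext_n fun x hx => by rw [hlin x hx, this, mul_one]

/-- weak approximation -/
theorem approx (B : Finset (FFPrime F)) (z : FFPrime F → F) (k : ℤ) :
    ∃ y : F, ∀ w ∈ B, w.ge k (y - z w) := by
  have hd := AbsoluteValue.denseRange_algebraMap_pi (F := F) (ι := B)
    (v := fun w => w.1.abv) (fun w => w.1.abv_nontrivial)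
    (fun i j hij h => hij (Subtype.ext (eq_of_isEquiv h)))
  obtain ⟨y, hy⟩ := (Metric.denseRange_iff.1 hd)
    (fun w => (WithAbs.equiv (w.1.abv)).symm (z w.1)) ((2 : ℝ) ^ (-k)) (by positivity)
  refine ⟨y, fun w hw => ?_⟩
  have := (dist_pi_lt_iff (by positivity)).1 hy ⟨w, hw⟩
  rw [w.ge_iff_abv]
  rw [dist_comm, dist_eq_norm] at this
  exact this.le

end FFPrime

set_option autoImplicit false
set_option linter.all false

open Polynomial

/-- function field of one variable over `𝔽_p` -/
class FFld (p : ℕ) [Fact p.Prime] (F : Type) [Field F] [Algebra (ZMod p) F] : Prop where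
  ess : Algebra.EssFiniteType (ZMod p) F
  tr : Algebra.trdeg (ZMod p) F = 1

namespace FFld

variable (p : ℕ) [hp : Fact p.Prime] {F : Type} [Field F] [Algebra (ZMod p) F]

theorem exists_tr [FFld p F] : ∃ t : F, Transcendental (ZMod p) t := by
  have h := FFld.tr (p := p) (F := F)
  have : Algebra.Transcendental (ZMod p) F := by
    rw [← trdeg_ne_zero_iff, h]; exact one_ne_zero
  exact this.transcendental

theorem fin [FFld p F] {y : F} (hy : Transcendental (ZMod p) y) :
    FiniteDimensional (IntermediateField.adjoin (ZMod p) {y}) F := by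
  have h1 : AlgebraicIndependent (ZMod p) (fun _ : Unit => y) :=
    algebraicIndependent_unique_type_iff.2 hy
  have h2 := h1.isTranscendenceBasis_of_trdeg_le_of_finite
    (by rw [FFld.tr (p := p) (F := F)]; simp)
  have h3 := h2.isAlgebraic_field
  rw [Set.range_const] at h3
  have := FFld.ess (p := p) (F := F)
  have : Algebra.EssFiniteType (IntermediateField.adjoin (ZMod p) {y}) F := .of_comp (ZMod p) _ _
  exact Algebra.finite_of_essFiniteType_of_isAlgebraic

open IntermediateField.algebraAdjoinAdjoin in
theorem rel [FFld p F] {y : F} (hy : Transcendental (ZMod p) y) :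
    ∃ m : ℕ, ∀ (ι : Type) [Fintype ι] (z : ι → F), m < Fintype.card ι →
      ∃ g : ι → (ZMod p)[X], g ≠ 0 ∧ ∑ i, aeval y (g i) * z i = 0 := by
  have := fin p hy
  refine ⟨Module.finrank (IntermediateField.adjoin (ZMod p) {y}) F, ?_⟩
  intro ι _ z hk
  have hdep : ¬ LinearIndependent (IntermediateField.adjoin (ZMod p) {y}) z := fun h => by
    have := h.fintype_card_le_finrank
    omega
  rw [← LinearIndependent.iff_fractionRing (R := Algebra.adjoin (ZMod p) {y}),
    Fintype.not_linearIndependent_iff] at hdep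
  obtain ⟨g, hg, i, hi⟩ := hdep
  have : ∀ i, ∃ f : (ZMod p)[X], aeval y f = (g i : F) := by
    intro i
    have h : (g i : F) ∈ (aeval (R := ZMod p) y).range :=
      (Algebra.adjoin_singleton_eq_range_aeval (ZMod p) y) ▸ (g i).2
    exact h
  choose f hf using this
  refine ⟨f, ?_, ?_⟩
  · rintro rfl
    apply hi
    have := hf i
    simp at this
    exact Subtype.ext this.symm
  · simp only [hf]; exact hg

theorem rel_one [FFld p F] {y : F} (hy : Transcendental (ZMod p) y) :
    ∃ m : ℕ, ∀ z : F, ∃ g : (ZMod p)[X][X], g ≠ 0 ∧ g.natDegree ≤ m ∧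
      ∑ i ∈ Finset.range (m+1), aeval y (g.coeff i) * z ^ i = 0 := by
  classical
  obtain ⟨m, hm⟩ := rel p hy
  refine ⟨m, fun z => ?_⟩
  obtain ⟨g, hg, h⟩ := hm (Fin (m+1)) (fun i => z ^ (i : ℕ)) (by simp)
  have hc : ∀ j : ℕ, (∑ i : Fin (m+1), (monomial (i : ℕ)) (g i) : (ZMod p)[X][X]).coeff j =
      if hj : j < m + 1 then g ⟨j, hj⟩ else 0 := by
    intro j
    rw [finset_sum_coeff]
    simp only [coeff_monomial]
    split_ifs with hj
    · rw [Finset.sum_eq_single ⟨j, hj⟩]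
      · simp
      · intro b _ hb
        rw [if_neg]; intro h; exact hb (Fin.ext h)
      · simp
    · apply Finset.sum_eq_zero
      intro b _
      rw [if_neg]; have := b.2; omega
  refine ⟨∑ i : Fin (m+1), monomial (i : ℕ) (g i), ?_, ?_, ?_⟩
  · intro h0
    apply hg
    funext i
    have := hc i
    rw [h0, dif_pos i.2] at this
    simpa using this.symm
  · rw [natDegree_le_iff_coeff_eq_zero]
    intro N hN
    rw [hc, dif_neg (by omega)]
  · rw [Finset.sum_range]
    rw [← h]
    apply Finset.sum_congr rfl
    intro i _
    rw [hc, dif_pos i.2]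

theorem transc_ne_zero {y : F} (hy : Transcendental (ZMod p) y) : y ≠ 0 := by
  rintro rfl; exact hy (isAlgebraic_zero)

theorem transc_aeval {y : F} (hy : Transcendental (ZMod p) y) {g : (ZMod p)[X]} (hg : g ≠ 0) :
    aeval y g ≠ 0 := by
  intro h; exact hy ⟨g, hg, h⟩

theorem transc_inv {y : F} (hy : Transcendental (ZMod p) y) : Transcendental (ZMod p) y⁻¹ := by
  intro h; apply hy; have := h.inv; rwa [inv_inv] at this

end FFld

namespace FFPrime
open FFld

variable (p : ℕ) [hp : Fact p.Prime] {F : Type} [Field F] [Algebra (ZMod p) F]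

/-- existence of a zero of a transcendental element -/
theorem exists_zero [FFld p F] {y : F} (hy : Transcendental (ZMod p) y) :
    ∃ w : FFPrime F, 0 < w.n y := by
  classical
  -- valuation subring
  let A0 : Subring F := (Algebra.adjoin (ZMod p) {y}).toSubring
  have hyA : y ∈ A0 := Algebra.subset_adjoin rfl
  let I : Ideal A0 := Ideal.span {⟨y, hyA⟩}
  have hI : I ≠ ⊤ := by
    intro h
    rw [Ideal.eq_top_iff_one, Ideal.mem_span_singleton] at h
    obtain ⟨c, hc⟩ := h
    have hc' : (1 : F) = y * c := congrArg Subtype.val hc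
    have := c.2
    change (c : F) ∈ Algebra.adjoin (ZMod p) {y} at this
    rw [Algebra.adjoin_singleton_eq_range_aeval] at this
    obtain ⟨f, hf⟩ := this
    apply hy
    refine ⟨X * f - 1, ?_, ?_⟩
    · intro h
      have := congrArg (fun g => coeff g 0) h
      simp at this
    · simp at hf ⊢
      rw [hf, ← hc']; simp
  obtain ⟨V, hV, hVI⟩ := Ideal.image_subset_nonunits_valuationSubring I hI
  have hyV : y ∈ V.nonunits := hVI ⟨⟨y, hyA⟩, Ideal.subset_span rfl, rfl⟩
  have hy0 := transc_ne_zero p hy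
  let v := V.valuation
  have hvy : v y < 1 := V.mem_nonunits_iff.1 hyV |> fun h => by exact h
  have hmem : ∀ f : (ZMod p)[X], v (aeval y f) ≤ 1 := by
    intro f
    rw [V.valuation_le_one_iff]
    exact hV (by
      change aeval y f ∈ Algebra.adjoin (ZMod p) {y}
      exact Polynomial.aeval_mem_adjoin_singleton _ _)
  have hconst : ∀ c : ZMod p, c ≠ 0 → v (algebraMap (ZMod p) F c) = 1 := by
    intro c hc
    have h1 : v (algebraMap (ZMod p) F c) ^ (p - 1) = 1 := by
      rw [← map_pow, ← map_pow, ZMod.pow_card_sub_one_eq_one hc]; simp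
    have : p - 1 ≠ 0 := by have := hp.out.two_le; omega
    exact (pow_eq_one_iff.1 h1).resolve_right this
  have hpoly : ∀ f : (ZMod p)[X], f ≠ 0 → ∃ s : ℕ, v (aeval y f) = v y ^ s := by
    intro f hf
    obtain ⟨g, hg, hg2⟩ := exists_eq_pow_rootMultiplicity_mul_and_not_dvd f hf 0
    refine ⟨rootMultiplicity 0 f, ?_⟩
    conv_lhs => rw [hg]
    have hg0 : g.coeff 0 ≠ 0 := by
      intro h; apply hg2; simpa [X_dvd_iff] using h
    have : v (aeval y g) = 1 := by
      conv_lhs => rw [← divX_mul_X_add g]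
      rw [map_add, add_comm, aeval_C]
      rw [Valuation.map_add_eq_of_lt_left]
      · exact hconst _ hg0
      · rw [hconst _ hg0, map_mul, aeval_X, map_mul]
        exact lt_of_le_of_lt (mul_le_of_le_one_left' (hmem _)) hvy
    rw [map_mul, map_mul, this]
    simp
  obtain ⟨m, hm⟩ := rel_one p hy
  have hvy0 : v y ≠ 0 := (Valuation.ne_zero_iff _).2 hy0
  have hz : ∀ z : F, z ≠ 0 → ∃ s : ℤ, v z ^ (m.factorial) = v y ^ s := by
    intro z hz0
    obtain ⟨g, hg, hgm, h⟩ := hm z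
    have hvz0 : v z ≠ 0 := (Valuation.ne_zero_iff _).2 hz0
    -- two terms with equal valuation
    have hex : ∃ i j, i < j ∧ j ≤ m ∧ g.coeff i ≠ 0 ∧ g.coeff j ≠ 0 ∧
        v (aeval y (g.coeff i) * z ^ i) = v (aeval y (g.coeff j) * z ^ j) := by
      by_contra hcon
      push Not at hcon
      have hne : ∀ i ∈ g.support, ∀ j ∈ g.support, i ≠ j →
          v (aeval y (g.coeff i) * z ^ i) ≠ v (aeval y (g.coeff j) * z ^ j) := by
        intro i hi j hj hij
        rw [mem_support_iff] at hi hj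
        have hi' := le_natDegree_of_ne_zero hi
        have hj' := le_natDegree_of_ne_zero hj
        rcases lt_or_gt_of_ne hij with h | h
        · exact hcon i j h (by omega) hi hj
        · exact (hcon j i h (by omega) hj hi).symm
      have hs : (∑ i ∈ g.support, aeval y (g.coeff i) * z ^ i) = 0 := by
        rw [← h]
        apply Finset.sum_subset
        · intro i hi
          have hi' := le_natDegree_of_mem_supp _ hi
          simp; omega
        · intro i _ hi
          simp [notMem_support_iff.1 hi]
      have hnemp : g.support.Nonempty := by
        rwa [Finset.nonempty_iff_ne_empty, Ne, support_eq_empty]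
      obtain ⟨i, hi, hmax⟩ := Finset.exists_max_image g.support
        (fun i => v (aeval y (g.coeff i) * z ^ i)) hnemp
      have hlt : ∀ j ∈ g.support.erase i, v (aeval y (g.coeff j) * z ^ j) <
          v (aeval y (g.coeff i) * z ^ i) := by
        intro j hj
        rw [Finset.mem_erase] at hj
        exact lt_of_le_of_ne (hmax j hj.2) (hne j hj.2 i hi hj.1)
      have hi0 : v (aeval y (g.coeff i) * z ^ i) ≠ 0 := by
        rw [Valuation.ne_zero_iff]
        exact mul_ne_zero (transc_aeval p hy (mem_support_iff.1 hi)) (pow_ne_zero _ hz0)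
      have := Valuation.map_sum_lt v hi0 hlt
      have h3 : aeval y (g.coeff i) * z ^ i = - ∑ j ∈ g.support.erase i, aeval y (g.coeff j) * z ^ j := by
        rw [← Finset.add_sum_erase _ _ hi] at hs
        linear_combination hs
      rw [h3, Valuation.map_neg] at this
      exact lt_irrefl _ this
    obtain ⟨i, j, hij, hjm, hi, hj, he⟩ := hex
    obtain ⟨s1, h1⟩ := hpoly _ hi
    obtain ⟨s2, h2⟩ := hpoly _ hj
    rw [map_mul, map_mul, h1, h2, map_pow, map_pow] at he
    obtain ⟨d, rfl⟩ := Nat.exists_eq_add_of_lt hij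
    have h4 : v z ^ (d + 1) = v y ^ ((s1 : ℤ) - s2) := by
      rw [zpow_sub₀ hvy0, zpow_natCast, zpow_natCast, eq_div_iff (pow_ne_zero _ hvy0)]
      have : v z ^ i * (v z ^ (d+1) * v y ^ s2) = v z ^ i * (v y ^ s1) := by
        rw [mul_comm (v z ^ i) (v y ^ s1), he]
        rw [show i + d + 1 = i + (d + 1) by ring, pow_add _ i (d + 1)]
        rw [mul_left_comm, mul_comm (v y ^ s2), mul_assoc, mul_left_comm]
      exact mul_left_cancel₀ (pow_ne_zero _ hvz0) this
    obtain ⟨k, hk⟩ : (d + 1) ∣ m.factorial := Nat.dvd_factorial (by omega) (by omega)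
    refine ⟨((s1 : ℤ) - s2) * k, ?_⟩
    rw [hk, pow_mul, h4, zpow_mul, zpow_natCast]
  have hinj : ∀ s s' : ℤ, v y ^ s ≤ v y ^ s' ↔ s' ≤ s := by
    intro s s'
    exact zpow_le_zpow_iff_right_of_lt_one₀ (zero_lt_iff.2 hvy0) hvy
  have hinj' : ∀ s s' : ℤ, v y ^ s = v y ^ s' → s = s' := by
    intro s s' h
    exact le_antisymm ((hinj _ _).1 h.ge) ((hinj _ _).1 h.le)
  choose! f hf using hz
  have hNpos : 0 < m.factorial := Nat.factorial_pos m
  have fmul : ∀ x z, x ≠ 0 → z ≠ 0 → f (x * z) = f x + f z := by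
    intro x z hx hz
    apply hinj'
    rw [← hf _ (mul_ne_zero hx hz), map_mul, mul_pow, hf x hx, hf z hz, zpow_add₀ hvy0]
  have fle : ∀ x z, x ≠ 0 → z ≠ 0 → (f x ≤ f z ↔ v z ≤ v x) := by
    intro x z hx hz
    rw [← hinj, ← hf x hx, ← hf z hz]
    exact pow_le_pow_iff_left₀ (zero_le') (zero_le') hNpos.ne'
  have fadd : ∀ x z, x ≠ 0 → z ≠ 0 → x + z ≠ 0 → min (f x) (f z) ≤ f (x + z) := by
    intro x z hx hz hxz
    have := v.map_add x z
    rcases le_max_iff.1 this with h | h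
    · exact min_le_of_left_le ((fle _ _ hx hxz).2 h)
    · exact min_le_of_right_le ((fle _ _ hz hxz).2 h)
  have fy : 0 < f y := by
    have := hf y hy0
    have h2 : f y = m.factorial := by
      apply hinj'; rw [← this, zpow_natCast]
    rw [h2]; exact_mod_cast hNpos
  -- normalise
  have f1 : f 1 = 0 := by
    have := fmul 1 1 one_ne_zero one_ne_zero
    simp at this; exact this
  have finv : ∀ x, x ≠ 0 → f x⁻¹ = - f x := by
    intro x hx
    have := fmul x x⁻¹ hx (inv_ne_zero hx)
    rw [mul_inv_cancel₀ hx, f1] at this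
    omega
  let H : AddSubgroup ℤ :=
    { carrier := {k | ∃ x, x ≠ 0 ∧ f x = k}
      add_mem' := by
        rintro _ _ ⟨x, hx, rfl⟩ ⟨z, hz, rfl⟩
        exact ⟨x * z, mul_ne_zero hx hz, fmul x z hx hz⟩
      zero_mem' := ⟨1, one_ne_zero, f1⟩
      neg_mem' := by
        rintro _ ⟨x, hx, rfl⟩
        exact ⟨x⁻¹, inv_ne_zero hx, finv x hx⟩ }
  obtain ⟨d0, hd0⟩ := Int.subgroup_cyclic H
  have hdd : ∃ d : ℤ, 0 < d ∧ (∀ x, x ≠ 0 → d ∣ f x) ∧ ∃ x, x ≠ 0 ∧ f x = d := by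
    have hd1 : ∀ x, x ≠ 0 → d0 ∣ f x := by
      intro x hx
      have : f x ∈ H := ⟨x, hx, rfl⟩
      rw [hd0, AddSubgroup.mem_closure_singleton] at this
      obtain ⟨n, hn⟩ := this
      exact ⟨n, by rw [← hn]; simp [mul_comm]⟩
    have hd2 : d0 ∈ H := by rw [hd0]; exact AddSubgroup.mem_closure_singleton_self d0
    have hd3 : d0 ≠ 0 := by
      rintro rfl
      have := hd1 y hy0
      rw [zero_dvd_iff] at this; omega
    obtain ⟨x, hx, hx2⟩ := hd2
    rcases lt_or_gt_of_ne hd3 with h | h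
    · exact ⟨-d0, by omega, fun x hx => (neg_dvd).2 (hd1 x hx), x⁻¹, inv_ne_zero hx, by rw [finv x hx, hx2]⟩
    · exact ⟨d0, h, hd1, x, hx, hx2⟩
  obtain ⟨d, hdpos, hdvd, hdx⟩ := hdd
  refine ⟨mkN (fun x => f x / d) ?_ ?_ ?_, ?_⟩
  · intro x z hx hz
    simp only [fmul x z hx hz]
    exact Int.add_ediv_of_dvd_left (hdvd x hx)
  · intro x z hx hz hxz
    have := fadd x z hx hz hxz
    rcases min_le_iff.1 this with h | h
    · exact min_le_of_left_le (Int.ediv_le_ediv hdpos h)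
    · exact min_le_of_right_le (Int.ediv_le_ediv hdpos h)
  · obtain ⟨x, hx, hx2⟩ := hdx
    exact ⟨x, hx, by rw [hx2]; exact Int.ediv_self hdpos.ne'⟩
  · rw [mkN_n _ _ _ _ hy0]
    exact Int.ediv_pos_of_pos_of_dvd fy hdpos.le (hdvd y hy0)

end FFPrime

set_option autoImplicit false
set_option linter.all false

open Polynomial

namespace FFPrime
open FFld

variable (p : ℕ) [hp : Fact p.Prime] {F : Type} [Field F] [Algebra (ZMod p) F]
variable (w : FFPrime F)

theorem n_const {c : ZMod p} (hc : c ≠ 0) : w.n (algebraMap (ZMod p) F c) = 0 := by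
  have : p - 1 ≠ 0 := by have := hp.out.two_le; omega
  apply w.n_of_pow_eq_one this
  rw [← map_pow, ZMod.pow_card_sub_one_eq_one hc]; simp

theorem ge_const (c : ZMod p) : w.ge 0 (algebraMap (ZMod p) F c) := by
  by_cases hc : c = 0
  · rw [hc, map_zero]; exact w.ge_zero 0
  · have := w.ge_n (algebraMap (ZMod p) F c)
    rwa [w.n_const p hc] at this

theorem ge_smul {k : ℤ} {z : F} (c : ZMod p) (h : w.ge k z) : w.ge k (c • z) := by
  rw [Algebra.smul_def]
  simpa using w.ge_mul (w.ge_const p c) h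

/-- elements of order at least `k` -/
def sub (k : ℤ) : Submodule (ZMod p) F where
  carrier := {z | w.ge k z}
  add_mem' h1 h2 := w.ge_add h1 h2
  zero_mem' := w.ge_zero k
  smul_mem' c _ h := w.ge_smul p c h

theorem mem_sub {k : ℤ} {z : F} : z ∈ w.sub p k ↔ w.ge k z := Iff.rfl

theorem ge_aeval {y : F} (hy : w.ge 0 y) (g : (ZMod p)[X]) : w.ge 0 (aeval y g) := by
  rw [aeval_eq_sum_range]
  apply w.ge_sum
  intro i _
  exact w.ge_smul p _ (w.ge_pow_zero hy i)

theorem ge_aeval_sub {y : F} (hy : 0 < w.n y) (g : (ZMod p)[X]) :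
    w.ge (w.n y) (aeval y g - algebraMap (ZMod p) F (g.coeff 0)) := by
  have : aeval y g - algebraMap (ZMod p) F (g.coeff 0) = aeval y (divX g) * y := by
    conv_lhs => rw [← divX_mul_X_add g]
    simp
  rw [this]
  simpa using w.ge_mul (w.ge_aeval p (w.ge_mono hy.le (w.ge_n y)) _) (w.ge_n y)

theorem transc_of_n {y : F} (h : w.n y ≠ 0) : Transcendental (ZMod p) y := by
  intro halg
  have hy0 : y ≠ 0 := by rintro rfl; exact h w.n_zero
  wlog hpos : 0 < w.n y generalizing y
  · refine this (y := y⁻¹) ?_ halg.inv (inv_ne_zero hy0) ?_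
    · rw [n_inv]; omega
    · rw [n_inv]; omega
  obtain ⟨g, hg, hg0⟩ := halg
  obtain ⟨f, hf, hf2⟩ := exists_eq_pow_rootMultiplicity_mul_and_not_dvd g hg 0
  have hc : f.coeff 0 ≠ 0 := by
    intro h; apply hf2; simpa [X_dvd_iff] using h
  rw [hf, map_mul] at hg0
  have h2 : aeval y f = 0 := by
    rcases mul_eq_zero.1 hg0 with h | h
    · simp at h; exact absurd h.1 hy0
    · exact h
  have h3 := w.ge_aeval_sub p hpos f
  rw [h2, zero_sub] at h3
  have h4 := (w.ge_iff (by simpa using hc)).1 h3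
  rw [n_neg, w.n_const p hc] at h4
  omega

/-- residues independent -/
def ResInd {k : ℕ} (r : Fin k → F) : Prop :=
  (∀ i, w.ge 0 (r i)) ∧ ∀ c : Fin k → ZMod p, w.ge 1 (∑ i, c i • r i) → c = 0

theorem keyA (B : Finset (FFPrime F)) {y : F} (hy : ∀ w ∈ B, 0 < w.n y)
    (hy0 : y ≠ 0)
    (d : FFPrime F → ℕ) (r : ∀ w, Fin (d w) → F) (hr : ∀ w ∈ B, ResInd p w (r w)) :
    ∃ z : (Σ w : B, Fin (w.1.n y).toNat × Fin (d w.1)) → F,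
      ∀ g : (Σ w : B, Fin (w.1.n y).toNat × Fin (d w.1)) → (ZMod p)[X],
        ∑ i, aeval y (g i) * z i = 0 → g = 0 := by
  classical
  have hπ : ∀ w : FFPrime F, ∃ x : F, x ≠ 0 ∧ w.n x = 1 := fun w => w.exists_n 1
  choose π hπ0 hπ1 using hπ
  -- uniform bound
  obtain ⟨N, hN⟩ : ∃ N : ℤ, 0 ≤ N ∧ ∀ w ∈ B, w.n y ≤ N := by
    refine ⟨∑ w ∈ B, w.n y, Finset.sum_nonneg fun w hw => (hy w hw).le, fun w hw => ?_⟩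
    exact Finset.single_le_sum (f := fun w : FFPrime F => w.n y) (fun w hw => (hy w hw).le) hw
  have hz : ∀ i : (Σ w : B, Fin (w.1.n y).toNat × Fin (d w.1)), ∃ z : F,
      ∀ w ∈ B, w.ge N (z - if w = i.1.1 then π i.1.1 ^ (i.2.1 : ℕ) * r i.1.1 i.2.2 else 0) := by
    intro i
    exact approx B (fun w => if w = i.1.1 then π i.1.1 ^ (i.2.1 : ℕ) * r i.1.1 i.2.2 else 0) N
  choose z hz using hz
  refine ⟨z, ?_⟩
  have hzint : ∀ i, ∀ w ∈ B, w.ge 0 (z i) := by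
    intro i w hw
    have h1 := w.ge_mono hN.1 (hz i w hw)
    have h2 : w.ge 0 (if w = i.1.1 then π i.1.1 ^ (i.2.1 : ℕ) * r i.1.1 i.2.2 else 0) := by
      split_ifs with h
      · rw [h]
        have h3 := (hr i.1.1 i.1.2).1 i.2.2
        have h4 : i.1.1.ge 0 (π i.1.1) := i.1.1.ge_mono (by rw [hπ1]; norm_num) (i.1.1.ge_n _)
        simpa using i.1.1.ge_mul (i.1.1.ge_pow_zero h4 i.2.1) h3
      · exact w.ge_zero 0
    have := w.ge_add h1 h2
    simpa using this
  -- constant terms vanish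
  have hconst : ∀ c : (Σ w : B, Fin (w.1.n y).toNat × Fin (d w.1)) → ZMod p,
      (∀ w ∈ B, w.ge (w.n y) (∑ i, c i • z i)) → c = 0 := by
    intro c hc
    by_contra hne
    obtain ⟨⟨w, i0, j0⟩, hi0⟩ := Function.ne_iff.1 hne
    -- minimal i
    have hex : ∃ i : ℕ, ∃ h : i < (w.1.n y).toNat, ∃ j, c ⟨w, ⟨i, h⟩, j⟩ ≠ 0 :=
      ⟨i0.1, i0.2, j0, hi0⟩
    obtain ⟨hi, j, hj⟩ := Nat.find_spec hex
    have hmin := fun m hm => Nat.find_min hex (m := m) hm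
    set i := Nat.find hex
    apply hj
    have hwB := w.2
    have hyw := hy w.1 hwB
    have hiy : (i : ℤ) + 1 ≤ w.1.n y := by omega
    -- main sum
    have h1 : w.1.ge (i + 1) (∑ l, c l • (if w.1 = l.1.1 then π l.1.1 ^ (l.2.1 : ℕ) * r l.1.1 l.2.2 else 0)) := by
      have h2 := w.1.ge_mono hiy (hc w.1 hwB)
      have h3 : w.1.ge (i+1) (∑ l, c l • (z l - if w.1 = l.1.1 then π l.1.1 ^ (l.2.1 : ℕ) * r l.1.1 l.2.2 else 0)) := by
        apply w.1.ge_sum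
        intro l _
        exact w.1.ge_smul p _ (w.1.ge_mono (le_trans hiy (hN.2 w.1 hwB)) (hz l w.1 hwB))
      have := w.1.ge_sub h2 h3
      rw [← Finset.sum_sub_distrib] at this
      convert this using 2
      rw [← smul_sub]; congr 1; ring
    rw [Fintype.sum_sigma, Finset.sum_eq_single w] at h1
    · simp only [if_true] at h1
      rw [Fintype.sum_prod_type] at h1
      have hrest : w.1.ge (i+1) (∑ x ∈ Finset.univ.erase (⟨i, hi⟩ : Fin (w.1.n y).toNat), ∑ j', c ⟨w, x, j'⟩ • (π w.1 ^ (x : ℕ) * r w.1 j')) := by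
        apply w.1.ge_sum
        intro x hx
        apply w.1.ge_sum
        intro j' _
        rcases lt_trichotomy (x : ℕ) i with h | h | h
        · have := hmin x.1 h
          push Not at this
          rw [this x.2 j', zero_smul]; exact w.1.ge_zero _
        · exact absurd (Fin.ext h) (Finset.ne_of_mem_erase hx)
        · apply w.1.ge_smul p
          have h5 := w.1.ge_pow (w.1.ge_n (π w.1)) x
          have := w.1.ge_mul h5 ((hr w.1 hwB).1 j')
          refine w.1.ge_mono ?_ this
          rw [hπ1]; omega
      rw [← Finset.add_sum_erase _ _ (Finset.mem_univ (⟨i, hi⟩ : Fin (w.1.n y).toNat))] at h1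
      have h6 := w.1.ge_sub h1 hrest
      rw [add_sub_cancel_right] at h6
      have h7 : (∑ j', c ⟨w, ⟨i, hi⟩, j'⟩ • (π w.1 ^ i * r w.1 j')) = π w.1 ^ i * ∑ j', c ⟨w, ⟨i, hi⟩, j'⟩ • r w.1 j' := by
        rw [Finset.mul_sum]
        simp only [mul_smul_comm]
      rw [h7] at h6
      have h8 := w.1.ge_mul (w.1.ge_n ((π w.1 ^ i)⁻¹)) h6
      rw [inv_mul_cancel_left₀ (pow_ne_zero _ (hπ0 w.1)), n_inv, n_pow _ (hπ0 _), hπ1] at h8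
      have h9 := (hr w.1 hwB).2 _ (w.1.ge_mono (by omega) h8)
      exact congrFun h9 j
    · intro b _ hb
      have : ¬ (w.1 = b.1) := fun h => hb (Subtype.ext h.symm)
      simp [this]
    · simp
  -- induction on degree
  have hmain : ∀ n : ℕ, ∀ g : (Σ w : B, Fin (w.1.n y).toNat × Fin (d w.1)) → (ZMod p)[X],
      (∀ i, (g i).natDegree ≤ n) → ∑ i, aeval y (g i) * z i = 0 → g = 0 := by
    intro n
    induction n with
    | zero =>
      intro g hg h
      have hgc : ∀ i, g i = C ((g i).coeff 0) := fun i => eq_C_of_natDegree_le_zero (hg i)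
      have h2 := hconst (fun i => (g i).coeff 0) (by
        intro w hw
        have : ∑ i, (g i).coeff 0 • z i = 0 := by
          rw [← h]
          apply Finset.sum_congr rfl
          intro i _
          conv_rhs => rw [hgc i]
          rw [aeval_C, Algebra.smul_def]
        rw [this]; exact w.ge_zero _)
      funext i
      rw [hgc i, congrFun h2 i]; simp
    | succ n ih =>
      intro g hg h
      have h2 := hconst (fun i => (g i).coeff 0) (by
        intro w hw
        have : ∑ i, (g i).coeff 0 • z i = - ∑ i, (aeval y (g i) - algebraMap (ZMod p) F ((g i).coeff 0)) * z i := by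
          simp only [sub_mul, Finset.sum_sub_distrib, h, Algebra.smul_def]; ring
        rw [this]
        apply w.ge_neg
        apply w.ge_sum
        intro i _
        simpa using w.ge_mul (w.ge_aeval_sub p (hy w hw) (g i)) (hzint i w hw))
      have h3 : ∀ i, g i = divX (g i) * X := by
        intro i
        conv_lhs => rw [← divX_mul_X_add (g i)]
        rw [show (g i).coeff 0 = 0 from congrFun h2 i]; simp
      have h4 := ih (fun i => divX (g i)) (by
        intro i
        rw [natDegree_divX_eq_natDegree_tsub_one]
        have := hg i
        omega) (by
        have : y * ∑ i, aeval y (divX (g i)) * z i = 0 := by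
          rw [← h, Finset.mul_sum]
          apply Finset.sum_congr rfl
          intro i _
          conv_rhs => rw [h3 i]
          rw [map_mul, aeval_X]; ring
        exact (mul_eq_zero.1 this).resolve_left hy0)
      funext i
      rw [h3 i, show divX (g i) = 0 from congrFun h4 i]; simp
  intro g hg
  refine hmain (∑ i, (g i).natDegree) g (fun i => ?_) hg
  exact Finset.single_le_sum (f := fun i => (g i).natDegree) (fun _ _ => Nat.zero_le _) (Finset.mem_univ i)

/-- bound for degrees of zeros -/
theorem key_bound [FFld p F] {y : F} (hyt : Transcendental (ZMod p) y) :
    ∃ m : ℕ, ∀ (B : Finset (FFPrime F)), (∀ w ∈ B, 0 < w.n y) →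
    ∀ (d : FFPrime F → ℕ) (r : ∀ w, Fin (d w) → F), (∀ w ∈ B, ResInd p w (r w)) →
    ∑ w ∈ B, (w.n y).toNat * d w ≤ m := by
  obtain ⟨m, hm⟩ := rel p hyt
  refine ⟨m, fun B hy d r hr => ?_⟩
  obtain ⟨z, hz⟩ := keyA p B hy (transc_ne_zero p hyt) d r hr
  by_contra hlt
  push Not at hlt
  obtain ⟨g, hg, hg2⟩ := hm _ z (by
    rw [Fintype.card_sigma]
    simp only [Fintype.card_prod, Fintype.card_fin]
    rw [Finset.sum_coe_sort B (fun w => (w.n y).toNat * d w)]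
    exact hlt)
  exact hg (hz g hg2)

/-- residue field (as a vector space) -/
abbrev kap : Type := (w.sub p 0) ⧸ ((w.sub p 1).submoduleOf (w.sub p 0))

theorem resInd_iff {k : ℕ} (r : Fin k → w.sub p 0) :
    ResInd p w (fun i => (r i : F)) ↔
      LinearIndependent (ZMod p) (fun i => (Submodule.Quotient.mk (r i) : w.kap p)) := by
  rw [Fintype.linearIndependent_iff]
  unfold ResInd
  constructor
  · rintro ⟨_, h⟩ c hc
    have := h c (by
      have : (Submodule.Quotient.mk (∑ i, c i • r i) : w.kap p) = 0 := by
        rw [← hc]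
        simp [← Submodule.mkQ_apply]
      rw [Submodule.Quotient.mk_eq_zero, Submodule.submoduleOf, Submodule.mem_comap] at this
      simpa [mem_sub] using this)
    intro i; exact congrFun this i
  · intro h
    refine ⟨fun i => (r i).2, fun c hc => funext (h c ?_)⟩
    have : (Submodule.Quotient.mk (∑ i, c i • r i) : w.kap p) = 0 := by
      rw [Submodule.Quotient.mk_eq_zero, Submodule.submoduleOf, Submodule.mem_comap]
      simpa [mem_sub] using hc
    rw [← this]
    simp [← Submodule.mkQ_apply]

instance kap_finite [FFld p F] : Module.Finite (ZMod p) (w.kap p) := by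
  obtain ⟨y, hy0, hy1⟩ := w.exists_n 1
  obtain ⟨m, hm⟩ := key_bound p (w.transc_of_n p (y := y) (by omega))
  rw [← Module.rank_lt_aleph0_iff]
  refine lt_of_le_of_lt (rank_le (n := m) ?_) (Cardinal.natCast_lt_aleph0 (n := m))
  intro s hs
  have h1 : LinearIndependent (ZMod p) (fun i : Fin s.card => (s.equivFin.symm i : w.kap p)) :=
    hs.comp _ s.equivFin.symm.injective
  have h2 : ∀ i : Fin s.card, ∃ r : w.sub p 0, (Submodule.Quotient.mk r : w.kap p) = (s.equivFin.symm i : w.kap p) :=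
    fun i => Submodule.Quotient.mk_surjective _ _
  choose r hr using h2
  simp only [← hr] at h1
  rw [← resInd_iff] at h1
  have := hm {w} (by simp [hy1]) (fun _ => s.card) (fun _ i => (r i : F)) (by simpa using h1)
  simpa [hy1] using this

/-- degree of a place -/
def deg : ℕ := Module.finrank (ZMod p) (w.kap p)

theorem exists_resInd [FFld p F] : ∃ r : Fin (w.deg p) → F, ResInd p w r := by
  let b := Module.finBasis (ZMod p) (w.kap p)
  have h2 : ∀ i, ∃ r : w.sub p 0, (Submodule.Quotient.mk r : w.kap p) = b i :=
    fun i => Submodule.Quotient.mk_surjective _ _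
  choose r hr using h2
  unfold deg
  refine ⟨fun i => r i, ?_⟩
  rw [resInd_iff]
  simp only [hr]
  exact b.linearIndependent

theorem le_deg_of_resInd [FFld p F] {k : ℕ} (r : Fin k → F) (hr : ResInd p w r) : k ≤ w.deg p := by
  have := (w.resInd_iff p (fun i => ⟨r i, hr.1 i⟩)).1 hr
  simpa [deg] using this.fintype_card_le_finrank

theorem deg_pos [FFld p F] : 0 < w.deg p := by
  apply w.le_deg_of_resInd p (fun _ : Fin 1 => (1 : F))
  refine ⟨fun _ => w.ge_one, fun c hc => ?_⟩
  by_contra hne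
  have hc0 : c 0 ≠ 0 := fun h => hne (funext fun i => by rw [Subsingleton.elim i 0, h]; rfl)
  simp only [Finset.univ_unique, Finset.sum_singleton, Algebra.smul_def, mul_one] at hc
  have := (w.ge_iff (by simpa using hc0)).1 hc
  rw [Fin.default_eq_zero, w.n_const p hc0] at this
  omega

theorem sum_zeros_le [FFld p F] {y : F} (hyt : Transcendental (ZMod p) y) :
    ∃ m : ℕ, ∀ (B : Finset (FFPrime F)), (∀ w ∈ B, 0 < w.n y) →
    ∑ w ∈ B, (w.n y).toNat * w.deg p ≤ m := by
  obtain ⟨m, hm⟩ := key_bound p hyt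
  refine ⟨m, fun B hB => ?_⟩
  choose r hr using fun w : FFPrime F => w.exists_resInd p
  exact hm B hB _ r (fun w _ => hr w)

theorem zeros_finite [FFld p F] (y : F) : {w : FFPrime F | 0 < w.n y}.Finite := by
  by_contra hinf
  obtain ⟨w, hw⟩ := Set.Infinite.nonempty hinf
  obtain ⟨m, hm⟩ := sum_zeros_le p (w.transc_of_n p (y := y) (by simp at hw; omega))
  obtain ⟨B, hB, hc⟩ := Set.Infinite.exists_subset_card_eq hinf (m+1)
  have := hm B (fun w hw => hB hw)
  have h2 : B.card ≤ ∑ w ∈ B, (w.n y).toNat * w.deg p := by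
    rw [Finset.card_eq_sum_ones]
    apply Finset.sum_le_sum
    intro w hw
    have h1 := hB hw
    simp at h1
    exact Nat.mul_pos (by omega) (w.deg_pos p)
  omega

theorem supp_finite [FFld p F] (y : F) : {w : FFPrime F | w.n y ≠ 0}.Finite := by
  refine ((zeros_finite p y).union (zeros_finite p y⁻¹)).subset ?_
  intro w hw
  simp only [Set.mem_setOf_eq, Set.mem_union, n_inv] at hw ⊢
  omega

end FFPrime

set_option autoImplicit false
set_option linter.all false

open Polynomial

/-- divisors -/
abbrev Dv (F : Type) [Field F] := FFPrime F →₀ ℤ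

namespace Dv
open FFld FFPrime

variable (p : ℕ) [hp : Fact p.Prime] {F : Type} [Field F] [Algebra (ZMod p) F]

/-- degree of a divisor -/
def dg : Dv F →+ ℤ := Finsupp.liftAddHom (fun w => AddMonoidHom.mulRight (w.deg p : ℤ))

theorem dg_single (w : FFPrime F) (k : ℤ) : dg p (Finsupp.single w k) = k * w.deg p := by
  simp [dg]

theorem dg_apply (D : Dv F) : dg p D = ∑ w ∈ D.support, D w * w.deg p := by
  simp [dg, Finsupp.sum]

theorem dg_nonneg {D : Dv F} (h : 0 ≤ D) : 0 ≤ dg p D := by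
  rw [dg_apply]
  exact Finset.sum_nonneg fun w _ => mul_nonneg (h w) (by positivity)

theorem dg_mono {D E : Dv F} (h : D ≤ E) : dg p D ≤ dg p E := by
  have := dg_nonneg p (sub_nonneg.2 h)
  rw [map_sub] at this; omega

variable [hF : FFld p F]

/-- principal divisor -/
def dv (y : F) : Dv F := Finsupp.ofSupportFinite (fun w => w.n y) (supp_finite p y)

@[simp] theorem dv_apply (y : F) (w : FFPrime F) : dv p y w = w.n y := rfl

theorem dv_mul {x y : F} (hx : x ≠ 0) (hy : y ≠ 0) : dv p (x * y) = dv p x + dv p y := by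
  ext w; simp [w.n_mul hx hy]

theorem dv_inv (x : F) : dv p x⁻¹ = - dv p x := by
  ext w; simp [w.n_inv]

theorem dv_one : dv p (1 : F) = 0 := by
  ext w; simp

theorem dv_pow {x : F} (hx : x ≠ 0) (k : ℕ) : dv p (x ^ k) = k • dv p x := by
  ext w; simp [w.n_pow hx]


/-- Riemann-Roch space -/
def LL (D : Dv F) : Submodule (ZMod p) F where
  carrier := {z | ∀ w : FFPrime F, w.ge (- D w) z}
  add_mem' h1 h2 := fun w => w.ge_add (h1 w) (h2 w)
  zero_mem' := fun w => w.ge_zero _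
  smul_mem' c _ h := fun w => w.ge_smul p c (h w)

theorem mem_LL {D : Dv F} {z : F} : z ∈ LL p D ↔ ∀ w : FFPrime F, w.ge (- D w) z := Iff.rfl

theorem mem_LL' {D : Dv F} {z : F} (hz : z ≠ 0) : z ∈ LL p D ↔ 0 ≤ dv p z + D := by
  rw [mem_LL]
  constructor
  · intro h w
    have := (w.ge_iff hz).1 (h w)
    simp only [Finsupp.coe_zero, Pi.zero_apply, Finsupp.coe_add, Pi.add_apply, dv_apply]
    omega
  · intro h w
    have := h w
    simp only [Finsupp.coe_zero, Pi.zero_apply, Finsupp.coe_add, Pi.add_apply, dv_apply] at this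
    rw [w.ge_iff hz]; omega

theorem LL_mono {D E : Dv F} (h : D ≤ E) : LL p D ≤ LL p E := by
  intro z hz w
  exact w.ge_mono (by have := h w; omega) (hz w)

theorem exists_place (p : ℕ) [Fact p.Prime] (F : Type) [Field F] [Algebra (ZMod p) F] [FFld p F] :
    Nonempty (FFPrime F) := by
  obtain ⟨t, ht⟩ := exists_tr p (F := F)
  obtain ⟨w, _⟩ := exists_zero p ht
  exact ⟨w⟩

instance LL_zero_fin : Module.Finite (ZMod p) (LL p (0 : Dv F)) := by
  obtain ⟨w⟩ := exists_place p F
  have hle : LL p (0 : Dv F) ≤ w.sub p 0 := by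
    intro z hz
    have := hz w
    rw [mem_sub]
    simpa using this
  refine Module.Finite.of_injective
    (((w.sub p 1).submoduleOf (w.sub p 0)).mkQ ∘ₗ Submodule.inclusion hle) ?_
  rw [← LinearMap.ker_eq_bot, LinearMap.ker_eq_bot']
  intro z hz
  have hz := (Submodule.Quotient.mk_eq_zero _).1 hz
  have hz1 : w.ge 1 (z : F) := hz
  by_contra hne
  have hne' : (z : F) ≠ 0 := fun h => hne (Subtype.ext h)
  have hn := (w.ge_iff hne').1 hz1
  have ht := w.transc_of_n p (y := (z : F)) (by omega)
  obtain ⟨v, hv⟩ := exists_zero p (transc_inv p ht)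
  rw [n_inv] at hv
  have h1 := z.2 v
  rw [v.ge_iff hne'] at h1
  simp at h1
  omega

theorem LL_step (D : Dv F) (w : FFPrime F) (hfin : Module.Finite (ZMod p) (LL p D)) :
    Module.Finite (ZMod p) (LL p (D + Finsupp.single w 1)) ∧
    Module.finrank (ZMod p) (LL p (D + Finsupp.single w 1)) ≤ Module.finrank (ZMod p) (LL p D) + w.deg p := by
  classical
  obtain ⟨π, hπ0, hπ⟩ := w.exists_n (D w + 1)
  have hmap : ∀ z ∈ LL p (D + Finsupp.single w 1), π * z ∈ w.sub p 0 := by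
    intro z hz
    have h1 := hz w
    simp only [Finsupp.coe_add, Pi.add_apply, Finsupp.single_eq_same] at h1
    have := w.ge_mul (w.ge_n π) h1
    rw [hπ] at this
    rw [mem_sub]
    simpa using this
  let φ0 : LL p (D + Finsupp.single w 1) →ₗ[ZMod p] w.sub p 0 :=
    ((LinearMap.mulLeft (ZMod p) π).restrict hmap)
  let φ := ((w.sub p 1).submoduleOf (w.sub p 0)).mkQ ∘ₗ φ0
  have hker : ∀ z : LL p (D + Finsupp.single w 1), φ z = 0 ↔ (z : F) ∈ LL p D := by
    intro z
    rw [show φ z = Submodule.Quotient.mk (φ0 z) from rfl, Submodule.Quotient.mk_eq_zero]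
    change w.ge 1 (π * z) ↔ _
    constructor
    · intro h v
      by_cases hv : v = w
      · rw [hv]
        have := w.ge_mul (w.ge_n π⁻¹) h
        rw [inv_mul_cancel_left₀ hπ0, n_inv, hπ] at this
        exact w.ge_mono (by omega) this
      · have := z.2 v
        simpa [Finsupp.single_apply, Ne.symm hv, hv, eq_comm] using this
    · intro h
      have := w.ge_mul (w.ge_n π) (h w)
      rw [hπ] at this
      exact w.ge_mono (by omega) this
  have hkfin : Module.Finite (ZMod p) (LinearMap.ker φ) := by
    refine Module.Finite.of_injective
      (((Submodule.subtype _) ∘ₗ (Submodule.subtype (LinearMap.ker φ))).codRestrict (LL p D) ?_) ?_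
    · intro z; exact (hker z.1).1 z.2
    · intro a b hab
      have := congrArg Subtype.val hab
      exact Subtype.ext (Subtype.ext this)
  have hkle : Module.finrank (ZMod p) (LinearMap.ker φ) ≤ Module.finrank (ZMod p) (LL p D) := by
    refine LinearMap.finrank_le_finrank_of_injective (f :=
      (((Submodule.subtype _) ∘ₗ (Submodule.subtype (LinearMap.ker φ))).codRestrict (LL p D) ?_)) ?_
    · intro z; exact (hker z.1).1 z.2
    · intro a b hab
      have := congrArg Subtype.val hab
      exact Subtype.ext (Subtype.ext this)
  have hfin2 : Module.Finite (ZMod p) (LL p (D + Finsupp.single w 1)) := by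
    have : Module.Finite (ZMod p) (LL p (D + Finsupp.single w 1) ⧸ LinearMap.ker φ) :=
      Module.Finite.of_injective ((LinearMap.ker φ).liftQ φ le_rfl) (by
        rw [← LinearMap.ker_eq_bot]; exact Submodule.ker_liftQ_eq_bot _ _ _ le_rfl)
    exact Module.Finite.of_submodule_quotient (LinearMap.ker φ)
  refine ⟨hfin2, ?_⟩
  have h1 := LinearMap.finrank_range_add_finrank_ker φ
  have h2 : Module.finrank (ZMod p) (LinearMap.range φ) ≤ w.deg p := Submodule.finrank_le _
  omega

/-- effective part as integer divisor -/
def ofNat (A : FFPrime F →₀ ℕ) : Dv F := A.mapRange (fun n : ℕ => (n : ℤ)) (by simp)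


theorem LL_add (A : FFPrime F →₀ ℕ) : ∀ (D : Dv F), Module.Finite (ZMod p) (LL p D) →
    Module.Finite (ZMod p) (LL p (D + ofNat A)) ∧
    (Module.finrank (ZMod p) (LL p (D + ofNat A)) : ℤ) ≤ Module.finrank (ZMod p) (LL p D) + dg p (ofNat A) := by
  induction A using Finsupp.induction_linear with
  | zero =>
    intro D h
    have : (ofNat (0 : FFPrime F →₀ ℕ)) = 0 := by ext; simp [ofNat]
    rw [this, add_zero, map_zero]; exact ⟨h, by simp⟩
  | add A B hA hB =>
    intro D h
    have : ofNat (A + B) = ofNat A + ofNat B := by ext; simp [ofNat]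
    rw [this, ← add_assoc, map_add]
    obtain ⟨h1, h2⟩ := hA D h
    obtain ⟨h3, h4⟩ := hB _ h1
    exact ⟨h3, by omega⟩
  | single w k =>
    induction k with
    | zero =>
      intro D h
      have : (ofNat (Finsupp.single w 0 : FFPrime F →₀ ℕ)) = 0 := by ext; simp [ofNat]
      rw [this, add_zero, map_zero]; exact ⟨h, by simp⟩
    | succ k ih =>
      intro D h
      have : ofNat (Finsupp.single w (k+1) : FFPrime F →₀ ℕ) =
          ofNat (Finsupp.single w k) + Finsupp.single w 1 := by
        simp only [ofNat, Finsupp.mapRange_single, ← Finsupp.single_add]; push_cast; rfl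
      rw [this, ← add_assoc, map_add]
      obtain ⟨h1, h2⟩ := ih D h
      obtain ⟨h3, h4⟩ := LL_step p _ w h1
      refine ⟨h3, ?_⟩
      rw [dg_single]; push_cast; omega

theorem exists_ofNat {D : Dv F} (h : 0 ≤ D) : ∃ A, D = ofNat A := by
  refine ⟨D.mapRange Int.toNat (by simp), ?_⟩
  ext w
  have := h w
  simp [ofNat] at this ⊢
  exact this

instance LL_fin (D : Dv F) : Module.Finite (ZMod p) (LL p D) := by
  obtain ⟨A, hA⟩ := exists_ofNat (D := D ⊔ 0) le_sup_right
  have h := (LL_add p A 0 inferInstance).1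
  rw [← hA, zero_add] at h
  exact Module.Finite.of_injective (Submodule.inclusion (LL_mono p (le_sup_left : D ≤ D ⊔ 0)))
    (Submodule.inclusion_injective _)

/-- dimension of the Riemann-Roch space -/
def ell (D : Dv F) : ℕ := Module.finrank (ZMod p) (LL p D)

theorem ell_le {D E : Dv F} (h : D ≤ E) : (ell p E : ℤ) - dg p E ≤ ell p D - dg p D := by
  obtain ⟨A, hA⟩ := exists_ofNat (sub_nonneg.2 h)
  have h2 := (LL_add p A D inferInstance).2
  rw [← hA, add_sub_cancel, map_sub] at h2
  unfold ell
  linarith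

theorem ell_mono {D E : Dv F} (h : D ≤ E) : ell p D ≤ ell p E :=
  Submodule.finrank_mono (LL_mono p h)

theorem ell_dv (D : Dv F) {y : F} (hy : y ≠ 0) : ell p (D + dv p y) = ell p D := by
  unfold ell
  symm
  -- multiplication by `y⁻¹` maps `LL D` onto `LL (D + dv y)`
  have key : ∀ z : F, z ∈ LL p D ↔ y⁻¹ * z ∈ LL p (D + dv p y) := by
    intro z
    by_cases hz : z = 0
    · simp [hz]
    rw [mem_LL' p hz, mem_LL' p (mul_ne_zero (inv_ne_zero hy) hz), dv_mul p (inv_ne_zero hy) hz, dv_inv]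
    rw [show -dv p y + dv p z + (D + dv p y) = dv p z + D by abel]
  refine LinearEquiv.finrank_eq (LinearEquiv.ofBijective
    ((LinearMap.mulLeft (ZMod p) y⁻¹).restrict (p := LL p D) (q := LL p (D + dv p y))
      (fun z hz => (key z).1 hz)) ⟨?_, ?_⟩)
  · intro a b hab
    have := congrArg Subtype.val hab
    exact Subtype.ext (mul_left_cancel₀ (inv_ne_zero hy) this)
  · intro b
    refine ⟨⟨y * b, ?_⟩, ?_⟩
    · rw [key, inv_mul_cancel_left₀ hy]; exact b.2
    · apply Subtype.ext
      exact inv_mul_cancel_left₀ hy _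

theorem exists_of_ell_pos {D : Dv F} (h : 0 < ell p D) : ∃ y : F, y ≠ 0 ∧ 0 ≤ dv p y + D := by
  unfold ell at h
  rw [Module.finrank_pos_iff_exists_ne_zero] at h
  obtain ⟨z, hz⟩ := h
  have hz' : (z : F) ≠ 0 := fun h => hz (Subtype.ext h)
  exact ⟨z, hz', (mem_LL' p hz').1 z.2⟩

/-- zero divisor -/
def Zd (y : F) : Dv F := dv p y ⊔ 0
/-- pole divisor -/
def Pd (y : F) : Dv F := (- dv p y) ⊔ 0

theorem dv_eq (y : F) : dv p y = Zd p y - Pd p y := by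
  ext w
  simp only [Zd, Pd, Finsupp.sup_apply, Finsupp.coe_sub, Pi.sub_apply, Finsupp.coe_neg, Pi.neg_apply,
    Finsupp.coe_zero, Pi.zero_apply]
  omega

theorem Pd_nonneg (y : F) : 0 ≤ Pd p y := le_sup_right

theorem ge_Pd (y : F) (w : FFPrime F) : w.ge (- Pd p y w) y := by
  refine w.ge_mono ?_ (w.ge_n y)
  simp only [Pd, Finsupp.sup_apply, Finsupp.coe_neg, Pi.neg_apply, Finsupp.coe_zero, Pi.zero_apply, dv_apply]
  omega

theorem dg_Zd (y : F) : dg p (Zd p y) = ((∑ w ∈ (zeros_finite p y).toFinset, (w.n y).toNat * w.deg p : ℕ) : ℤ) := by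
  rw [dg_apply]
  push_cast
  apply Finset.sum_congr_of_eq_on_inter <;> intro w
  · intro h1 h2
    simp only [Zd, Set.Finite.mem_toFinset, Set.mem_setOf_eq, not_lt, Finsupp.mem_support_iff,
      Finsupp.sup_apply, dv_apply, Finsupp.coe_zero, Pi.zero_apply] at h1 h2 ⊢
    rw [sup_eq_right.2 h2]; simp
  · intro h1 h2
    simp only [Zd, Set.Finite.mem_toFinset, Set.mem_setOf_eq, not_lt, Finsupp.mem_support_iff,
      Finsupp.sup_apply, dv_apply, Finsupp.coe_zero, Pi.zero_apply] at h1 h2 ⊢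
    exfalso; apply h2; rw [sup_eq_left.2 h1.le]; omega
  · intro h1 h2
    simp only [Zd, Set.Finite.mem_toFinset, Set.mem_setOf_eq, not_lt, Finsupp.mem_support_iff,
      Finsupp.sup_apply, dv_apply, Finsupp.coe_zero, Pi.zero_apply] at h1 h2 ⊢
    rw [Int.toNat_eq_max]

theorem ge_aeval_Pd (y : F) (w : FFPrime F) (g : (ZMod p)[X]) {n : ℕ} (hg : g.natDegree ≤ n) :
    w.ge (- (n * Pd p y w)) (aeval y g) := by
  rw [aeval_eq_sum_range]
  apply w.ge_sum
  intro i hi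
  apply w.ge_smul p
  refine w.ge_mono ?_ (w.ge_pow (ge_Pd p y w) i)
  have h0 := Pd_nonneg p y w
  simp only [Finsupp.coe_zero, Pi.zero_apply] at h0
  have : (i : ℤ) ≤ n := by simp at hi; omega
  nlinarith

theorem main_growth {y : F} (hy : Transcendental (ZMod p) y) :
    ∃ E : Dv F, 0 ≤ E ∧ ∀ n : ℕ, n * dg p (Zd p y) ≤ ell p (E + n • Pd p y) := by
  classical
  choose r hr using fun w : FFPrime F => w.exists_resInd p
  set B := (zeros_finite p y).toFinset with hB
  let I := (Σ w : B, Fin (w.1.n y).toNat × Fin (w.1.deg p))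
  obtain ⟨z, hz⟩ := keyA p B (y := y) (by intro w hw; simpa [hB] using hw) (transc_ne_zero p hy)
    (fun w => w.deg p) r (fun w _ => hr w)
  change I → F at z
  refine ⟨∑ i, Pd p (z i), Finset.sum_nonneg fun i _ => Pd_nonneg p _, ?_⟩
  intro n
  have hmem : ∀ g : I → degreeLT (ZMod p) n, ∑ i, aeval y ((g i : (ZMod p)[X])) * z i ∈ LL p ((∑ i, Pd p (z i)) + n • Pd p y) := by
    intro g
    refine Submodule.sum_mem _ fun i _ => ?_
    intro w
    have hd : ((g i : (ZMod p)[X])).natDegree ≤ n := by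
      have := (mem_degreeLT.1 (g i).2)
      exact natDegree_le_of_degree_le this.le
    refine w.ge_mono ?_ (w.ge_mul (ge_aeval_Pd p y w _ hd) (ge_Pd p (z i) w))
    have : Pd p (z i) w ≤ (∑ i, Pd p (z i)) w := by
      rw [Finsupp.coe_finset_sum, Finset.sum_apply]
      exact Finset.single_le_sum (f := fun i => Pd p (z i) w) (fun i _ => Pd_nonneg p (z i) w) (Finset.mem_univ i)
    have h2 : (n • Pd p y) w = n * Pd p y w := by simp
    rw [Finsupp.add_apply, h2]
    omega
  let φ0 : (I → degreeLT (ZMod p) n) →ₗ[ZMod p] F :=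
    { toFun := fun g => ∑ i, aeval y ((g i : (ZMod p)[X])) * z i
      map_add' := by
        intro g h
        simp [add_mul, Finset.sum_add_distrib]
      map_smul' := by
        intro c g
        simp [Finset.smul_sum] }
  let φ := φ0.codRestrict _ hmem
  have hinj : Function.Injective φ := by
    rw [← LinearMap.ker_eq_bot, LinearMap.ker_eq_bot']
    intro g hg
    have h1 : ∑ i, aeval y ((g i : (ZMod p)[X])) * z i = 0 := congrArg Subtype.val hg
    have h2 := hz (fun i => (g i : (ZMod p)[X])) h1
    funext i
    exact Subtype.ext (congrFun h2 i)
  have h1 := LinearMap.finrank_le_finrank_of_injective hinj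
  have hdl : Module.finrank (ZMod p) (degreeLT (ZMod p) n) = n := by
    rw [LinearEquiv.finrank_eq (degreeLTEquiv (ZMod p) n)]; simp
  have : Module.Finite (ZMod p) (degreeLT (ZMod p) n) :=
    Module.Finite.equiv (degreeLTEquiv (ZMod p) n).symm
  rw [Module.finrank_pi_fintype] at h1
  simp only [hdl, Finset.sum_const, Finset.card_univ, smul_eq_mul] at h1
  have hI : (Fintype.card I : ℤ) = dg p (Zd p y) := by
    rw [dg_Zd, Fintype.card_sigma]
    simp only [Fintype.card_prod, Fintype.card_fin]
    rw [Finset.sum_coe_sort B (fun w => (w.n y).toNat * w.deg p)]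
  rw [← hI]
  unfold ell
  have : ((Fintype.card I * n : ℕ) : ℤ) ≤ (Module.finrank (ZMod p) (LL p ((∑ i, Pd p (z i)) + n • Pd p y)) : ℕ) := by
    exact_mod_cast h1
  push_cast at this
  linarith

theorem dg_dv_le (y : F) : dg p (dv p y) ≤ 0 := by
  by_cases hy : Transcendental (ZMod p) y
  · obtain ⟨E, hE, h⟩ := main_growth p hy
    rw [dv_eq, map_sub]
    by_contra hlt
    push Not at hlt
    -- growth contradiction
    have h2 : ∀ n : ℕ, (n : ℤ) * (dg p (Zd p y) - dg p (Pd p y)) ≤ ell p (0 : Dv F) + dg p E := by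
      intro n
      have h3 := ell_le p (D := 0) (E := E + n • Pd p y)
        (add_nonneg hE (nsmul_nonneg (Pd_nonneg p y) n))
      have h4 := h n
      rw [map_add, map_nsmul, map_zero, nsmul_eq_mul] at h3
      linarith
    have h5 := h2 ((ell p (0 : Dv F) + dg p E).toNat + 1)
    have h6 := Int.self_le_toNat ((ell p (0 : Dv F) : ℤ) + dg p E)
    push_cast at h5
    nlinarith
  · have : dv p y = 0 := by
      ext w
      by_contra h
      exact hy (w.transc_of_n p h)
    rw [this, map_zero]

theorem dg_dv (y : F) : dg p (dv p y) = 0 := by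
  have h1 := dg_dv_le p y
  have h2 := dg_dv_le p y⁻¹
  rw [dv_inv, map_neg] at h2
  omega

end Dv

set_option autoImplicit false
set_option linter.all false

open Polynomial

namespace Dv
open FFld FFPrime

variable (p : ℕ) [hp : Fact p.Prime] {F : Type} [Field F] [Algebra (ZMod p) F] [hF : FFld p F]

theorem exists_kill (w : FFPrime F) {t : F} (ht : w.ge 0 t) :
    ∃ g : (ZMod p)[X], g ≠ 0 ∧ g.degree < (w.deg p + 1 : ℕ) ∧ w.ge 1 (aeval t g) := by
  by_contra hcon
  push Not at hcon
  have hr : ResInd p w (fun i : Fin (w.deg p + 1) => t ^ (i : ℕ)) := by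
    refine ⟨fun i => w.ge_pow_zero ht _, fun c hc => ?_⟩
    have h1 : aeval t ((degreeLTEquiv (ZMod p) (w.deg p + 1)).symm c : (ZMod p)[X]) = ∑ i, c i • t ^ (i : ℕ) := by
      simp [degreeLTEquiv, Algebra.smul_def]
    by_contra hc0
    refine hcon _ ?_ (mem_degreeLT.1 ((degreeLTEquiv (ZMod p) (w.deg p + 1)).symm c).2) (by rw [h1]; exact hc)
    intro h
    apply hc0
    have h2 : (degreeLTEquiv (ZMod p) (w.deg p + 1)).symm c = 0 := Subtype.ext h
    simpa using h2
  have := w.le_deg_of_resInd p _ hr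
  omega

theorem places_finite (d : ℕ) : {w : FFPrime F | w.deg p ≤ d}.Finite := by
  obtain ⟨t, ht⟩ := exists_tr p (F := F)
  have : Finite (degreeLT (ZMod p) (d + 1)) := by
    have : Module.Finite (ZMod p) (degreeLT (ZMod p) (d+1)) :=
      Module.Finite.equiv (degreeLTEquiv (ZMod p) (d+1)).symm
    exact Module.finite_of_finite (ZMod p)
  refine Set.Finite.subset ((zeros_finite p t⁻¹).union
    (Set.finite_iUnion fun g : degreeLT (ZMod p) (d + 1) => zeros_finite p (aeval t (g : (ZMod p)[X])))) ?_
  intro w hw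
  simp only [Set.mem_setOf_eq] at hw
  by_cases h0 : w.ge 0 t
  · right
    obtain ⟨g, hg0, hg, hk⟩ := exists_kill p w h0
    refine Set.mem_iUnion.2 ⟨⟨g, mem_degreeLT.2 (lt_of_lt_of_le hg (by exact_mod_cast by omega))⟩, ?_⟩
    have := (w.ge_iff (transc_aeval p ht hg0)).1 hk
    simp only [Set.mem_setOf_eq]
    omega
  · left
    rw [w.ge_iff (transc_ne_zero p ht)] at h0
    simp only [Set.mem_setOf_eq, n_inv]
    omega

theorem exists_lower : ∃ e0 : ℤ, ∀ D : Dv F, e0 ≤ ell p D - dg p D := by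
  classical
  obtain ⟨t, ht⟩ := exists_tr p (F := F)
  obtain ⟨E, hE, hg⟩ := main_growth p ht
  refine ⟨- dg p E, fun D => ?_⟩
  have hzp : dg p (Zd p t) = dg p (Pd p t) := by
    have := dg_dv p t
    rw [dv_eq, map_sub] at this
    omega
  have hex : ∀ w : FFPrime F, ∃ g : (ZMod p)[X], g ≠ 0 ∧ (w.ge 0 t → w.ge 1 (aeval t g)) := by
    intro w
    by_cases h0 : w.ge 0 t
    · obtain ⟨g, hg0, _, hk⟩ := exists_kill p w h0
      exact ⟨g, hg0, fun _ => hk⟩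
    · exact ⟨1, one_ne_zero, fun h => absurd h h0⟩
  choose g hg0 hgk using hex
  set y : F := ∏ v ∈ D.support, aeval t (g v) ^ (D v).natAbs with hy
  have hy0 : y ≠ 0 := Finset.prod_ne_zero_iff.2 fun v _ => pow_ne_zero _ (transc_aeval p ht (hg0 v))
  have hny : ∀ w : FFPrime F, w.n y = ∑ v ∈ D.support, (D v).natAbs * w.n (aeval t (g v)) := by
    intro w
    rw [hy]
    induction D.support using Finset.induction_on with
    | empty => simp [w.n_one]
    | insert a s ha ih =>
      rw [Finset.prod_insert ha, Finset.sum_insert ha, w.n_mul, w.n_pow, ih]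
      · exact transc_aeval p ht (hg0 a)
      · exact pow_ne_zero _ (transc_aeval p ht (hg0 a))
      · exact Finset.prod_ne_zero_iff.2 fun v _ => pow_ne_zero _ (transc_aeval p ht (hg0 v))
  have hDy : ∀ w : FFPrime F, w.ge 0 t → D w ≤ w.n y := by
    intro w hw
    have hnn : ∀ v, 0 ≤ w.n (aeval t (g v)) := fun v =>
      (w.ge_iff (transc_aeval p ht (hg0 v))).1 (w.ge_aeval p hw _)
    by_cases hwD : w ∈ D.support
    · rw [hny]
      have h1 : ((D w).natAbs : ℤ) * w.n (aeval t (g w)) ≤ ∑ v ∈ D.support, (D v).natAbs * w.n (aeval t (g v)) :=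
        Finset.single_le_sum (f := fun v => ((D v).natAbs : ℤ) * w.n (aeval t (g v)))
          (fun v _ => mul_nonneg (by positivity) (hnn v)) hwD
      have h2 := (w.ge_iff (transc_aeval p ht (hg0 w))).1 (hgk w hw)
      have h3 : D w ≤ ((D w).natAbs : ℤ) := by omega
      nlinarith
    · rw [Finsupp.notMem_support_iff.1 hwD, hny]
      exact Finset.sum_nonneg fun v _ => mul_nonneg (by positivity) (hnn v)
  set D1 := D - dv p y with hD1
  set k : ℕ := ∑ w ∈ D1.support, (D1 w).natAbs with hk
  have hle : D1 ≤ E + k • Pd p t := by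
    intro w
    have hEw := hE w
    have hPw := Pd_nonneg p t w
    have h2 : (k • Pd p t) w = k * Pd p t w := by simp
    rw [Finsupp.add_apply, h2]
    simp only [Finsupp.coe_zero, Pi.zero_apply] at hEw hPw
    by_cases h0 : w.ge 0 t
    · have := hDy w h0
      have h3 : D1 w ≤ 0 := by rw [hD1, Finsupp.sub_apply, dv_apply]; omega
      nlinarith
    · rw [w.ge_iff (transc_ne_zero p ht)] at h0
      have hP1 : 1 ≤ Pd p t w := by
        simp only [Pd, Finsupp.sup_apply, Finsupp.coe_neg, Pi.neg_apply, Finsupp.coe_zero, Pi.zero_apply, dv_apply]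
        omega
      have h3 : (D1 w).natAbs ≤ k := by
        by_cases hw : w ∈ D1.support
        · exact Finset.single_le_sum (f := fun w => (D1 w).natAbs) (fun _ _ => Nat.zero_le _) hw
        · rw [Finsupp.notMem_support_iff.1 hw]; simp
      have h4 : D1 w ≤ k := by omega
      nlinarith
  have h1 := ell_le p hle
  have h2 := hg k
  rw [map_add, map_nsmul, nsmul_eq_mul, ← hzp] at h1
  have h3 : ell p D1 = ell p D := by
    rw [hD1, sub_eq_add_neg, ← dv_inv, ell_dv p D (inv_ne_zero hy0)]
  have h4 : dg p D1 = dg p D := by rw [hD1, map_sub, dg_dv, sub_zero]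
  rw [h3, h4] at h1
  linarith

/-- Riemann's theorem -/
theorem riemann : ∃ e : ℤ, ∃ n0 : ℕ, ∀ D : Dv F, n0 ≤ dg p D → (ell p D : ℤ) = dg p D + e := by
  obtain ⟨e0, he0⟩ := exists_lower p (F := F)
  obtain ⟨e, ⟨D0, hD0⟩, hmin⟩ := Int.exists_least_of_bdd (P := fun z => ∃ D : Dv F, (ell p D : ℤ) - dg p D = z)
    ⟨e0, by rintro z ⟨D, rfl⟩; exact he0 D⟩ ⟨_, 0, rfl⟩
  refine ⟨e, (dg p D0 - e + 1).toNat, fun D hD => ?_⟩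
  have hD' : dg p D0 - e + 1 ≤ dg p D := (Int.self_le_toNat _).trans hD
  have h1 := hmin _ ⟨D - D0, rfl⟩
  rw [map_sub] at h1
  obtain ⟨y, hy, hyD⟩ := exists_of_ell_pos p (D := D - D0) (by omega)
  have h2 := ell_le p (D := D0) (E := D + dv p y) (by
    rw [← sub_nonneg]; convert hyD using 1; abel)
  rw [ell_dv p D hy, map_add, dg_dv] at h2
  have h3 := hmin _ ⟨D, rfl⟩
  omega

/-- effective divisors: degree -/
def ndeg : (FFPrime F →₀ ℕ) →+ ℕ := Finsupp.liftAddHom (fun w => AddMonoidHom.mulRight (w.deg p))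

theorem ndeg_single (w : FFPrime F) (k : ℕ) : ndeg p (Finsupp.single w k) = k * w.deg p := by
  simp [ndeg]

theorem ndeg_apply (A : FFPrime F →₀ ℕ) : ndeg p A = ∑ w ∈ A.support, A w * w.deg p := by
  simp [ndeg, Finsupp.sum]

theorem ofNat_apply (A : FFPrime F →₀ ℕ) (w : FFPrime F) : ofNat A w = A w := by simp [ofNat]

theorem ofNat_add (A B : FFPrime F →₀ ℕ) : ofNat (A + B) = ofNat A + ofNat B := by
  ext w; simp [ofNat_apply]

theorem ofNat_zero : ofNat (0 : FFPrime F →₀ ℕ) = 0 := by ext w; simp [ofNat_apply]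

theorem ofNat_single (w : FFPrime F) (k : ℕ) : ofNat (Finsupp.single w k) = Finsupp.single w (k : ℤ) := by
  simp [ofNat]

theorem ofNat_inj {A B : FFPrime F →₀ ℕ} (h : ofNat A = ofNat B) : A = B := by
  ext w
  have := DFunLike.congr_fun h w
  simpa [ofNat_apply] using this

theorem ofNat_nonneg (A : FFPrime F →₀ ℕ) : 0 ≤ ofNat A := by intro w; simp [ofNat_apply]

theorem dg_ofNat (A : FFPrime F →₀ ℕ) : dg p (ofNat A) = ndeg p A := by
  induction A using Finsupp.induction_linear with
  | zero => simp [ofNat_zero]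
  | add A B hA hB => rw [ofNat_add, map_add, map_add, hA, hB]; push_cast; rfl
  | single w k => rw [ofNat_single, dg_single, ndeg_single]; push_cast; rfl

theorem eff_finite (n : ℕ) : {A : FFPrime F →₀ ℕ | ndeg p A ≤ n}.Finite := by
  classical
  refine Set.Finite.subset (Finset.finite_toSet (Finset.finsupp (places_finite p (F := F) n).toFinset (fun _ => Finset.range (n+1)))) ?_
  intro A hA
  simp only [Set.mem_setOf_eq] at hA
  have h1 : ∀ w ∈ A.support, A w * w.deg p ≤ n := by
    intro w hw
    refine le_trans ?_ hA
    rw [ndeg_apply]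
    exact Finset.single_le_sum (f := fun w => A w * w.deg p) (fun _ _ => Nat.zero_le _) hw
  simp only [Finset.mem_coe, Finset.mem_finsupp_iff]
  constructor
  · intro w hw
    have h2 := h1 w hw
    have h3 : 1 ≤ A w := Nat.one_le_iff_ne_zero.2 (Finsupp.mem_support_iff.1 hw)
    simp only [Set.Finite.coe_toFinset, Set.Finite.mem_toFinset, Set.mem_setOf_eq]
    nlinarith
  · intro w hw
    have h4 := w.deg_pos p
    have h5 : A w * w.deg p ≤ n := by
      by_cases hw : w ∈ A.support
      · exact h1 w hw
      · rw [Finsupp.notMem_support_iff.1 hw]; simp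
    rw [Finset.mem_range]
    nlinarith

/-- principal divisors -/
def Prin : AddSubgroup (Dv F) where
  carrier := {D | ∃ y : F, y ≠ 0 ∧ dv p y = D}
  zero_mem' := ⟨1, one_ne_zero, dv_one p⟩
  add_mem' := by
    rintro _ _ ⟨y, hy, rfl⟩ ⟨z, hz, rfl⟩
    exact ⟨y * z, mul_ne_zero hy hz, dv_mul p hy hz⟩
  neg_mem' := by
    rintro _ ⟨y, hy, rfl⟩
    exact ⟨y⁻¹, inv_ne_zero hy, dv_inv p y⟩

theorem mem_Prin {D : Dv F} : D ∈ Prin p ↔ ∃ y : F, y ≠ 0 ∧ dv p y = D := Iff.rfl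

theorem dg_Prin {D : Dv F} (h : D ∈ Prin p) : dg p D = 0 := by
  obtain ⟨y, _, rfl⟩ := h
  exact dg_dv p y

/-- number of nonzero constants -/
def wc (F : Type) [Field F] [Algebra (ZMod p) F] [FFld p F] : ℕ := Nat.card {z : LL p (0 : Dv F) // z ≠ 0}

instance LL_finite (D : Dv F) : Finite (LL p D) := Module.finite_of_finite (ZMod p)

theorem one_mem_LL : (1 : F) ∈ LL p (0 : Dv F) := by
  rw [mem_LL' p one_ne_zero, dv_one, add_zero]

theorem mem_LL_zero {z : F} (hz : z ≠ 0) : z ∈ LL p (0 : Dv F) ↔ dv p z = 0 := by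
  rw [mem_LL' p hz, add_zero]
  refine ⟨fun h => ?_, fun h => h ▸ le_rfl⟩
  -- nonnegative of degree zero
  by_contra hne
  obtain ⟨w, hw⟩ := DFunLike.ne_iff.1 hne
  have h1 := dg_dv p z
  rw [dg_apply] at h1
  have h2 := (Finset.sum_eq_zero_iff_of_nonneg (fun v _ => mul_nonneg (h v) (by positivity))).1 h1 w
    (Finsupp.mem_support_iff.2 hw)
  have := w.deg_pos p
  rcases mul_eq_zero.1 h2 with h3 | h3
  · exact hw h3
  · omega

theorem wc_pos : 0 < wc p F := by
  have : Nonempty {z : LL p (0 : Dv F) // z ≠ 0} := ⟨⟨⟨1, one_mem_LL p⟩, fun h => one_ne_zero (congrArg Subtype.val h)⟩⟩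
  exact Nat.card_pos

theorem card_class (D : Dv F) :
    Nat.card {A : FFPrime F →₀ ℕ // ofNat A - D ∈ Prin p} * wc p F + 1 = p ^ ell p D := by
  classical
  have h1 : Nat.card (LL p D) = p ^ ell p D := by
    rw [Module.natCard_eq_pow_finrank (K := ZMod p), Nat.card_zmod]; rfl
  have h2 : Nat.card {z : LL p D // z ≠ 0} + 1 = Nat.card (LL p D) := by
    have := Fintype.ofFinite (LL p D)
    rw [Nat.card_eq_fintype_card, Nat.card_eq_fintype_card, Fintype.card_subtype_compl (fun z : LL p D => z = 0),
      Fintype.card_subtype_eq]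
    have : 0 < Fintype.card (LL p D) := Fintype.card_pos
    omega
  rw [← h1, ← h2, wc, ← Nat.card_prod]
  congr 1
  have hch : ∀ A : {A : FFPrime F →₀ ℕ // ofNat A - D ∈ Prin p}, ∃ y : F, y ≠ 0 ∧ dv p y = ofNat A.1 - D :=
    fun A => A.2
  choose y hy hyA using hch
  have hne : ∀ u : {z : LL p (0 : Dv F) // z ≠ 0}, (u.1 : F) ≠ 0 := fun u h => u.2 (Subtype.ext h)
  have hdu : ∀ u : {z : LL p (0 : Dv F) // z ≠ 0}, dv p (u.1 : F) = 0 := fun u =>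
    (mem_LL_zero p (hne u)).1 u.1.2
  have hmem : ∀ (A : {A : FFPrime F →₀ ℕ // ofNat A - D ∈ Prin p}) (u : {z : LL p (0 : Dv F) // z ≠ 0}),
      y A * (u.1 : F) ∈ LL p D := by
    intro A u
    rw [mem_LL' p (mul_ne_zero (hy A) (hne u)), dv_mul p (hy A) (hne u), hdu, hyA]
    simpa using ofNat_nonneg A.1
  refine Nat.card_congr (Equiv.ofBijective (fun x => (⟨⟨y x.1 * (x.2.1 : F), hmem x.1 x.2⟩, fun h =>
    mul_ne_zero (hy x.1) (hne x.2) (congrArg Subtype.val h)⟩ : {z : LL p D // z ≠ 0})) ⟨?_, ?_⟩)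
  · rintro ⟨A, u⟩ ⟨B, v⟩ h
    have h' : y A * (u.1 : F) = y B * (v.1 : F) := congrArg (fun z => (z.1 : F)) h
    have hAB : A = B := by
      have h3 := congrArg (dv p) h'
      rw [dv_mul p (hy A) (hne u), dv_mul p (hy B) (hne v), hdu, hdu, hyA, hyA, add_zero, add_zero] at h3
      exact Subtype.ext (ofNat_inj (sub_left_injective h3))
    subst hAB
    have := mul_left_cancel₀ (hy A) h'
    have h5 : u = v := Subtype.ext (Subtype.ext this)
    rw [h5]
  · rintro ⟨⟨z, hz⟩, hz0⟩
    have hz0' : z ≠ 0 := fun h => hz0 (Subtype.ext h)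
    obtain ⟨A, hA⟩ := exists_ofNat ((mem_LL' p hz0').1 hz)
    have hAP : ofNat A - D ∈ Prin p := ⟨z, hz0', by rw [← hA]; abel⟩
    have hu0 : (y ⟨A, hAP⟩)⁻¹ * z ≠ 0 := mul_ne_zero (inv_ne_zero (hy _)) hz0'
    have hu : (y ⟨A, hAP⟩)⁻¹ * z ∈ LL p (0 : Dv F) := by
      rw [mem_LL_zero p hu0, dv_mul p (inv_ne_zero (hy _)) hz0', dv_inv, hyA]
      simp only [← hA]; abel
    refine ⟨⟨⟨A, hAP⟩, ⟨⟨_, hu⟩, fun h => hu0 (congrArg Subtype.val h)⟩⟩, ?_⟩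
    apply Subtype.ext; apply Subtype.ext
    exact mul_inv_cancel_left₀ (hy _) z

/-- degree on the class group -/
def qdg : (Dv F ⧸ (Prin p : AddSubgroup (Dv F))) →+ ℤ :=
  QuotientAddGroup.lift (Prin p) (dg p) (fun D h => dg_Prin p h)

theorem qdg_mk (D : Dv F) : qdg p (QuotientAddGroup.mk D) = dg p D := rfl

theorem pic_finite (n : ℤ) : {c : Dv F ⧸ (Prin p : AddSubgroup (Dv F)) | qdg p c = n}.Finite := by
  obtain ⟨e, n0, he⟩ := riemann p (F := F)
  obtain ⟨w⟩ := exists_place p F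
  have hw := w.deg_pos p
  -- shift to large degree
  obtain ⟨k, hk⟩ : ∃ k : ℕ, (n0 : ℤ) + 1 - e ≤ n + k * w.deg p ∧ (n0 : ℤ) ≤ n + k * w.deg p := by
    refine ⟨((n0 : ℤ) + 1 + |e| + |n|).toNat, ?_⟩
    have h1 := Int.self_le_toNat ((n0 : ℤ) + 1 + |e| + |n|)
    have h2 : (1 : ℤ) ≤ w.deg p := by omega
    have h3 := neg_abs_le e
    have h4 := neg_abs_le n
    have h5 : ((((n0 : ℤ) + 1 + |e| + |n|).toNat : ℕ) : ℤ) * 1 ≤ (((n0 : ℤ) + 1 + |e| + |n|).toNat : ℕ) * w.deg p :=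
      mul_le_mul_of_nonneg_left h2 (by positivity)
    have h6 := abs_nonneg e
    constructor <;> linarith
  set m := n + k * w.deg p
  let f : (FFPrime F →₀ ℕ) → Dv F ⧸ (Prin p : AddSubgroup (Dv F)) := fun A =>
    QuotientAddGroup.mk (ofNat A - Finsupp.single w (k : ℤ))
  refine Set.Finite.subset ((eff_finite p (F := F) m.toNat).image f) ?_
  intro c hc
  obtain ⟨D, rfl⟩ := QuotientAddGroup.mk_surjective c
  simp only [Set.mem_setOf_eq, qdg_mk] at hc
  have hd : dg p (D + Finsupp.single w (k : ℤ)) = m := by rw [map_add, dg_single, hc]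
  have h1 := he (D + Finsupp.single w (k : ℤ)) (by rw [hd]; exact hk.2)
  obtain ⟨y, hy, hyD⟩ := exists_of_ell_pos p (D := D + Finsupp.single w (k : ℤ)) (by rw [hd] at h1; omega)
  obtain ⟨A, hA⟩ := exists_ofNat hyD
  refine ⟨A, ?_, ?_⟩
  · have := dg_ofNat p A
    rw [← hA, map_add, dg_dv, hd] at this
    simp only [Set.mem_setOf_eq]
    omega
  · simp only [f]
    rw [QuotientAddGroup.eq, ← hA]
    refine ⟨y⁻¹, inv_ne_zero hy, ?_⟩
    rw [dv_inv]; abel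

end Dv

set_option autoImplicit false
set_option linter.all false

open Polynomial

namespace FFPrime

/-- composition with an automorphism -/
def act {L M : Type} [Field L] [Field M] [Algebra L M] (τ : M ≃ₐ[L] M) (w : FFPrime M) : FFPrime M where
  ord y := w.ord (τ y)
  ord_zero := by rw [map_zero, w.ord_zero]
  ord_ne_top x hx := w.ord_ne_top _ (by simpa using hx)
  ord_one := by rw [map_one, w.ord_one]
  ord_mul x y := by rw [map_mul, w.ord_mul]
  ord_add x y := by rw [map_add]; exact w.ord_add _ _
  ord_surj n := by
    obtain ⟨x, hx⟩ := w.ord_surj n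
    exact ⟨τ.symm x, by simpa using hx⟩

section
variable {L M : Type} [Field L] [Field M] [Algebra L M]

theorem act_n (τ : M ≃ₐ[L] M) (w : FFPrime M) (y : M) : (act τ w).n y = w.n (τ y) := rfl
theorem act_ge (τ : M ≃ₐ[L] M) (w : FFPrime M) (k : ℤ) (y : M) : (act τ w).ge k y ↔ w.ge k (τ y) := Iff.rfl
theorem act_one (w : FFPrime M) : act (1 : M ≃ₐ[L] M) w = w := rfl
theorem act_mul (τ τ' : M ≃ₐ[L] M) (w : FFPrime M) : act (τ * τ') w = act τ' (act τ w) := rfl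

theorem act_iter (τ : M ≃ₐ[L] M) (w : FFPrime M) (s : ℕ) : (act τ)^[s] w = act (τ ^ s) w := by
  induction s with
  | zero => rfl
  | succ s ih => rw [Function.iterate_succ_apply', ih, ← act_mul, pow_succ]

theorem exists_restrict [Algebra.IsAlgebraic L M] (w : FFPrime M) :
    ∃ (v : FFPrime L) (e : ℕ), 0 < e ∧ ∀ z : L, z ≠ 0 → w.n (algebraMap L M z) = e * v.n z := by
  classical
  have hinj : ∀ z : L, z ≠ 0 → algebraMap L M z ≠ 0 := fun z hz => by simpa using hz
  have hnt : ∃ z : L, z ≠ 0 ∧ w.n (algebraMap L M z) ≠ 0 := by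
    by_contra hcon
    push Not at hcon
    obtain ⟨y, hy0, hy⟩ := w.exists_n (-1)
    have hint : IsIntegral L y := (Algebra.IsAlgebraic.isAlgebraic y).isIntegral
    have hm := minpoly.monic hint
    have hroot := minpoly.aeval L y
    set P := minpoly L y
    have hdeg : 0 < P.natDegree := minpoly.natDegree_pos hint
    rw [hm.as_sum] at hroot
    simp only [map_add, map_sum, map_mul, map_pow, aeval_X, aeval_C] at hroot
    have h1 : y ^ P.natDegree = - ∑ i ∈ Finset.range P.natDegree, algebraMap L M (P.coeff i) * y ^ i :=
      eq_neg_of_add_eq_zero_left hroot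
    have h2 : w.ge (-(P.natDegree - 1 : ℤ)) (y ^ P.natDegree) := by
      rw [h1]
      apply w.ge_neg
      apply w.ge_sum
      intro i hi
      by_cases hc : P.coeff i = 0
      · rw [hc, map_zero, zero_mul]; exact w.ge_zero _
      rw [w.ge_iff (mul_ne_zero (hinj _ hc) (pow_ne_zero _ hy0)), w.n_mul (hinj _ hc) (pow_ne_zero _ hy0),
        hcon _ hc, w.n_pow hy0, hy]
      have := Finset.mem_range.1 hi
      omega
    rw [w.ge_iff (pow_ne_zero _ hy0), w.n_pow hy0, hy] at h2
    omega
  have hpos : ∃ k : ℕ, 0 < k ∧ ∃ z : L, z ≠ 0 ∧ w.n (algebraMap L M z) = k := by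
    obtain ⟨z, hz, hn⟩ := hnt
    rcases lt_or_gt_of_ne hn with h | h
    · exact ⟨(- w.n (algebraMap L M z)).toNat, by omega, z⁻¹, inv_ne_zero hz, by rw [map_inv₀, n_inv]; omega⟩
    · exact ⟨(w.n (algebraMap L M z)).toNat, by omega, z, hz, by omega⟩
  set e := Nat.find hpos
  obtain ⟨he, z0, hz0, hn0⟩ := Nat.find_spec hpos
  change 0 < e at he
  change w.n (algebraMap L M z0) = e at hn0
  have hdvd : ∀ z : L, z ≠ 0 → (e : ℤ) ∣ w.n (algebraMap L M z) := by
    intro z hz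
    by_contra hd
    have hr0 : 0 ≤ w.n (algebraMap L M z) % e := Int.emod_nonneg _ (by omega)
    have hr1 : w.n (algebraMap L M z) % e < e := Int.emod_lt_of_pos _ (by omega)
    have hr2 : w.n (algebraMap L M z) % e ≠ 0 := fun h => hd (Int.dvd_of_emod_eq_zero h)
    have hlt : (w.n (algebraMap L M z) % e).toNat < e := by omega
    refine Nat.find_min hpos hlt ⟨by omega, z * z0 ^ (-(w.n (algebraMap L M z) / e)),
      mul_ne_zero hz (zpow_ne_zero _ hz0), ?_⟩
    rw [map_mul, map_zpow₀, w.n_mul (hinj _ hz) (zpow_ne_zero _ (hinj _ hz0)), w.n_zpow (hinj _ hz0), hn0,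
      Int.toNat_of_nonneg hr0, Int.emod_def]
    ring
  have he' : (e : ℤ) ≠ 0 := by omega
  refine ⟨mkN (fun z => w.n (algebraMap L M z) / e) ?_ ?_ ?_, e, he, ?_⟩
  · intro x y hx hy
    obtain ⟨k, hk⟩ := hdvd x hx
    obtain ⟨l, hl⟩ := hdvd y hy
    simp only [map_mul, w.n_mul (hinj _ hx) (hinj _ hy), hk, hl, ← mul_add, Int.mul_ediv_cancel_left _ he']
  · intro x y hx hy hxy
    have h := w.min_le_n_add (hinj x hx) (hinj y hy) (by rw [← map_add]; exact hinj _ hxy)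
    rw [← map_add] at h
    have hm : Monotone (fun k : ℤ => k / e) := fun a b hab => Int.ediv_le_ediv (by omega) hab
    have := hm h
    simp only [hm.map_min] at this
    exact this
  · exact ⟨z0, hz0, by rw [hn0]; exact Int.ediv_self he'⟩
  · intro z hz
    rw [mkN_n _ _ _ _ hz, Int.mul_ediv_cancel' (hdvd z hz)]
end

end FFPrime

/-- Kummer data for a cyclic extension of prime degree, unramified everywhere -/
structure Kum (q : ℕ) (L M : Type) [Field L] [Field M] [Algebra L M] where
  hq : q.Prime
  hq0 : (q : M) ≠ 0
  σ : M ≃ₐ[L] M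
  hσ : σ ^ q = 1
  fix : ∀ y, σ y = y → ∃ z : L, algebraMap L M z = y
  ζ : L
  hζ : IsPrimitiveRoot ζ q
  α : M
  α0 : α ≠ 0
  hα : σ α = algebraMap L M ζ * α
  a : L
  ha : α ^ q = algebraMap L M a
  hunr : ∀ v : FFPrime L, (q : ℤ) ∣ v.n a

namespace Kum
open FFPrime
variable {q : ℕ} {L M : Type} [Field L] [Field M] [Algebra L M] (κ : Kum q L M)

/-- eigenprojection (times `q`) -/
def pr (i : ℕ) : M →ₗ[L] M :=
  ∑ s ∈ Finset.range q, (κ.ζ⁻¹ ^ (i * s)) • ((κ.σ ^ s : M ≃ₐ[L] M).toLinearMap)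

theorem pr_apply (i : ℕ) (y : M) :
    κ.pr i y = ∑ s ∈ Finset.range q, (κ.ζ⁻¹ ^ (i * s)) • (κ.σ ^ s) y := by
  simp [pr]

theorem ζ0 : κ.ζ ≠ 0 := κ.hζ.ne_zero κ.hq.ne_zero

theorem σ_pow_q (y : M) : (κ.σ ^ q) y = y := by rw [κ.hσ]; rfl

theorem σ_succ (s : ℕ) (y : M) : (κ.σ ^ (s+1)) y = κ.σ ((κ.σ ^ s) y) := by rw [pow_succ']; rfl

theorem ζinv_q : κ.ζ⁻¹ ^ q = 1 := by rw [inv_pow, κ.hζ.pow_eq_one, inv_one]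

theorem σ_pr (i : ℕ) (y : M) : κ.σ (κ.pr i y) = κ.ζ ^ i • κ.pr i y := by
  rw [pr_apply, map_sum, Finset.smul_sum]
  have h1 : ∀ s, κ.σ ((κ.ζ⁻¹ ^ (i * s)) • (κ.σ ^ s) y) = κ.ζ ^ i • ((κ.ζ⁻¹ ^ (i * (s+1))) • (κ.σ ^ (s+1)) y) := by
    intro s
    rw [map_smul, σ_succ, smul_smul]
    congr 1
    have := κ.ζ0
    rw [mul_add, pow_add, mul_one, mul_left_comm, ← mul_pow, mul_inv_cancel₀ this, one_pow, mul_one]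
  simp_rw [h1]
  rw [← Finset.smul_sum, ← Finset.smul_sum]
  congr 1
  rw [← add_right_cancel_iff (a := (κ.ζ⁻¹ ^ (i * 0)) • (κ.σ ^ 0) y),
    ← Finset.sum_range_succ' (fun s => (κ.ζ⁻¹ ^ (i * s)) • (κ.σ ^ s) y), Finset.sum_range_succ]
  congr 1
  rw [mul_comm i q, pow_mul, κ.ζinv_q, one_pow, σ_pow_q]
  simp

theorem geom {s : ℕ} (h : ¬ q ∣ s) : ∑ i ∈ Finset.range q, κ.ζ⁻¹ ^ (i * s) = 0 := by
  have h1 : κ.ζ⁻¹ ^ s ≠ 1 := fun h' => h ((κ.hζ.inv.pow_eq_one_iff_dvd s).1 h')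
  have h2 := geom_sum_mul (κ.ζ⁻¹ ^ s) q
  rw [← pow_mul, mul_comm s q, pow_mul, κ.ζinv_q, one_pow, sub_self] at h2
  rcases mul_eq_zero.1 h2 with h3 | h3
  · rw [← h3]
    exact Finset.sum_congr rfl fun i _ => by rw [← pow_mul, mul_comm]
  · exact absurd (sub_eq_zero.1 h3) h1

theorem sum_pr (y : M) : ∑ i ∈ Finset.range q, κ.pr i y = (q : M) * y := by
  simp_rw [pr_apply]
  rw [Finset.sum_comm]
  rw [Finset.sum_eq_single 0]
  · simp
  · intro s hs hs0
    rw [← Finset.sum_smul, κ.geom, zero_smul]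
    intro hd
    have := Nat.le_of_dvd (by omega) hd
    have := Finset.mem_range.1 hs
    omega
  · intro h
    exact absurd (Finset.mem_range.2 κ.hq.pos) h

theorem σ_α (s : ℕ) : (κ.σ ^ s) κ.α = κ.ζ ^ s • κ.α := by
  induction s with
  | zero => simp
  | succ s ih => rw [σ_succ, ih, map_smul, κ.hα, ← Algebra.smul_def, smul_smul, pow_succ]

theorem σ_αpow (s i : ℕ) : (κ.σ ^ s) (κ.α ^ i) = κ.ζ ^ (i * s) • κ.α ^ i := by
  rw [map_pow, σ_α, _root_.smul_pow, ← pow_mul, mul_comm]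

theorem pr_α {i j : ℕ} (hi : i < q) (hj : j < q) : κ.pr i (κ.α ^ j) = if i = j then (q : M) * κ.α ^ j else 0 := by
  rw [pr_apply]
  simp_rw [σ_αpow, smul_smul]
  rw [← Finset.sum_smul]
  split_ifs with h
  · subst h
    have : ∀ s, κ.ζ⁻¹ ^ (i * s) * κ.ζ ^ (i * s) = 1 := fun s => by
      rw [← mul_pow, inv_mul_cancel₀ κ.ζ0, one_pow]
    simp_rw [this]
    simp [Algebra.smul_def]
  · -- the ratio is a nontrivial root of unity
    have key : ∃ m : ℕ, ¬ q ∣ m ∧ ∀ s, κ.ζ⁻¹ ^ (i * s) * κ.ζ ^ (j * s) = κ.ζ⁻¹ ^ (s * m) := by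
      refine ⟨i + (q - j), ?_, ?_⟩
      · rintro ⟨c, hc⟩
        rcases Nat.lt_or_ge c 1 with h1 | h1
        · interval_cases c; omega
        rcases Nat.lt_or_ge c 2 with h2 | h2
        · interval_cases c; omega
        · have := Nat.mul_le_mul_left q h2; omega
      · intro s
        have h3 : κ.ζ ^ (j * s) = κ.ζ⁻¹ ^ ((q - j) * s) := by
          have h4 : κ.ζ⁻¹ ^ (j * s) * κ.ζ⁻¹ ^ ((q - j) * s) = 1 := by
            rw [← pow_add, ← add_mul, Nat.add_sub_cancel' hj.le, pow_mul, κ.ζinv_q, one_pow]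
          rw [inv_pow, inv_mul_eq_one₀ (pow_ne_zero _ κ.ζ0)] at h4
          exact h4
        rw [h3, ← pow_add]; ring_nf
    obtain ⟨m, hm, hs⟩ := key
    simp_rw [hs]
    rw [κ.geom hm, zero_smul]

theorem exists_pr (i : ℕ) (y : M) : ∃ z : L, κ.pr i y = z • κ.α ^ i := by
  have h : κ.σ (κ.pr i y / κ.α ^ i) = κ.pr i y / κ.α ^ i := by
    have h1 := κ.σ_αpow 1 i
    rw [pow_one, mul_one] at h1
    rw [map_div₀, σ_pr, h1, Algebra.smul_def, Algebra.smul_def, mul_div_mul_left]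
    exact (_root_.map_ne_zero _).2 (pow_ne_zero _ κ.ζ0)
  obtain ⟨z, hz⟩ := κ.fix _ h
  refine ⟨z, ?_⟩
  rw [Algebra.smul_def, hz, div_mul_cancel₀ _ (pow_ne_zero _ κ.α0)]

theorem ge_pr {p : ℕ} [Fact p.Prime] (w : FFPrime M) {k : ℤ} {y : M} (h : ∀ s, w.ge k ((κ.σ ^ s) y)) (i : ℕ) :
    w.ge k (κ.pr i y) := by
  rw [pr_apply]
  refine w.ge_sum _ _ fun s _ => ?_
  rw [Algebra.smul_def]
  have hz : w.n (algebraMap L M (κ.ζ⁻¹ ^ (i * s))) = 0 := by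
    apply w.n_of_pow_eq_one κ.hq.ne_zero
    rw [← map_pow, ← pow_mul, mul_comm, pow_mul, κ.ζinv_q, one_pow, map_one]
  have := w.ge_mul (w.ge_n (algebraMap L M (κ.ζ⁻¹ ^ (i * s)))) (h s)
  rw [hz, zero_add] at this
  exact this

/-- norm -/
def nm (y : M) : M := ∏ s ∈ Finset.range q, (κ.σ ^ s) y

theorem nm_mul (x y : M) : κ.nm (x * y) = κ.nm x * κ.nm y := by
  simp [nm, Finset.prod_mul_distrib]

theorem nm_ne {y : M} (hy : y ≠ 0) : κ.nm y ≠ 0 :=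
  Finset.prod_ne_zero_iff.2 fun s _ => (_root_.map_ne_zero _).2 hy

theorem nm_fix (y : M) : κ.σ (κ.nm y) = κ.nm y := by
  by_cases hy : y = 0
  · subst hy
    have : κ.nm 0 = 0 := by
      unfold nm
      exact Finset.prod_eq_zero (Finset.mem_range.2 κ.hq.pos) (by simp)
    rw [this, map_zero]
  have h0 : (κ.σ ^ 0) y ≠ 0 := by simpa using hy
  apply mul_right_cancel₀ h0
  unfold nm
  rw [map_prod]
  simp_rw [← σ_succ]
  rw [← Finset.prod_range_succ' (fun s => (κ.σ ^ s) y), Finset.prod_range_succ, σ_pow_q]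
  simp

theorem exists_nmL (y : M) : ∃ z : L, algebraMap L M z = κ.nm y := κ.fix _ (κ.nm_fix y)

/-- norm with values in `L` -/
def nmL (y : M) : L := (κ.exists_nmL y).choose
theorem nmL_spec (y : M) : algebraMap L M (κ.nmL y) = κ.nm y := (κ.exists_nmL y).choose_spec

theorem n_nm (w : FFPrime M) {y : M} (hy : y ≠ 0) : w.n (κ.nm y) = ∑ s ∈ Finset.range q, w.n ((κ.σ ^ s) y) := by
  unfold nm
  have : ∀ B : Finset ℕ, w.n (∏ s ∈ B, (κ.σ ^ s) y) = ∑ s ∈ B, w.n ((κ.σ ^ s) y) := by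
    intro B
    induction B using Finset.induction_on with
    | empty => simp [w.n_one]
    | insert a s ha ih =>
      rw [Finset.prod_insert ha, Finset.sum_insert ha, w.n_mul, ih]
      · exact (_root_.map_ne_zero _).2 hy
      · exact Finset.prod_ne_zero_iff.2 fun s _ => (_root_.map_ne_zero _).2 hy
  exact this _

theorem periodic_pt (w : FFPrime M) : Function.IsPeriodicPt (act κ.σ) q w := by
  unfold Function.IsPeriodicPt Function.IsFixedPt
  rw [act_iter, κ.hσ, act_one]

theorem act_injOn {w : FFPrime M} (h : act κ.σ w ≠ w) {s t : ℕ} (hs : s < q) (ht : t < q)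
    (hst : act (κ.σ ^ s) w = act (κ.σ ^ t) w) : s = t := by
  have h1 := (κ.periodic_pt w).minimalPeriod_dvd
  rcases (Nat.dvd_prime κ.hq).1 h1 with h2 | h2
  · exact absurd (Function.minimalPeriod_eq_one_iff_isFixedPt.1 h2) h
  · rw [← act_iter, ← act_iter] at hst
    exact Function.iterate_injOn_Iio_minimalPeriod (by simpa [h2] using hs) (by simpa [h2] using ht) hst

theorem act_pow_fixed {w : FFPrime M} (h : act κ.σ w = w) (s : ℕ) : act (κ.σ ^ s) w = w := by
  rw [← act_iter]; exact Function.iterate_fixed h s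

theorem exists_unit_alpha [Algebra.IsAlgebraic L M] (w : FFPrime M) :
    ∃ b : L, b ≠ 0 ∧ w.n (b • κ.α) = 0 := by
  obtain ⟨v, e, he, hv⟩ := exists_restrict (L := L) w
  obtain ⟨k, hk⟩ := κ.hunr v
  obtain ⟨b, hb, hbn⟩ := v.exists_n (-k)
  refine ⟨b, hb, ?_⟩
  have hb' : algebraMap L M b ≠ 0 := by simpa using hb
  have ha0 : κ.a ≠ 0 := by
    intro h
    have := κ.ha
    rw [h, map_zero] at this
    exact pow_ne_zero _ κ.α0 this
  have h1 : (q : ℤ) * w.n (b • κ.α) = 0 := by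
    rw [Algebra.smul_def, ← w.n_pow (mul_ne_zero hb' κ.α0), mul_pow, κ.ha, ← map_pow, ← map_mul,
      hv _ (mul_ne_zero (pow_ne_zero _ hb) ha0), v.n_mul (pow_ne_zero _ hb) ha0, v.n_pow hb, hk, hbn]
    ring
  rcases mul_eq_zero.1 h1 with h2 | h2
  · exact absurd h2 (by exact_mod_cast κ.hq.ne_zero)
  · exact h2

theorem n_q (κ : Kum q L M) (p : ℕ) [Fact p.Prime] [Algebra (ZMod p) M] (w : FFPrime M) : w.n (q : M) = 0 := by
  have h1 : (q : M) = algebraMap (ZMod p) M (q : ZMod p) := by simp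
  rw [h1]
  apply w.n_const p
  intro h
  apply κ.hq0
  rw [h1, h, map_zero]

theorem exists_L_n_one (κ : Kum q L M) (p : ℕ) [Fact p.Prime] [Algebra (ZMod p) M] [Algebra.IsAlgebraic L M] (w : FFPrime M) :
    ∃ z : L, z ≠ 0 ∧ w.n (algebraMap L M z) = 1 := by
  classical
  by_cases hfix : act κ.σ w = w
  · obtain ⟨b, hb, hbα⟩ := κ.exists_unit_alpha w
    have hb' : algebraMap L M b ≠ 0 := by simpa using hb
    obtain ⟨y, hy0, hy⟩ := w.exists_n 1
    have h1 : ∀ i, w.ge 1 (κ.pr i y) := by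
      intro i
      refine κ.ge_pr (p := p) w (fun s => ?_) i
      rw [← act_ge, κ.act_pow_fixed hfix, w.ge_iff hy0, hy]
    have h2 : ∃ i, ¬ w.ge 2 (κ.pr i y) := by
      by_contra hcon
      push Not at hcon
      have h3 := w.ge_sum (Finset.range q) (fun i => κ.pr i y) (fun i _ => hcon i)
      rw [κ.sum_pr, w.ge_iff (mul_ne_zero κ.hq0 hy0), w.n_mul κ.hq0 hy0, κ.n_q p, hy] at h3
      omega
    obtain ⟨i, hi⟩ := h2
    obtain ⟨z, hz⟩ := κ.exists_pr i y
    have hpr0 : κ.pr i y ≠ 0 := by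
      intro h; rw [h] at hi; exact hi (w.ge_zero _)
    have hz0 : z ≠ 0 := by rintro rfl; rw [zero_smul] at hz; exact hpr0 hz
    have hn : w.n (κ.pr i y) = 1 := by
      have h4 := (w.ge_iff hpr0).1 (h1 i)
      rw [w.ge_iff hpr0] at hi
      omega
    refine ⟨z * b⁻¹ ^ i, mul_ne_zero hz0 (pow_ne_zero _ (inv_ne_zero hb)), ?_⟩
    have hz' : algebraMap L M z ≠ 0 := by simpa using hz0
    have h5 : κ.pr i y = algebraMap L M (z * b⁻¹ ^ i) * (b • κ.α) ^ i := by
      rw [hz, map_mul, map_pow, map_inv₀, Algebra.smul_def, Algebra.smul_def, mul_pow, mul_assoc, ← mul_assoc (_ ^ i) (_ ^ i),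
        ← mul_pow, inv_mul_cancel₀ hb', one_pow, one_mul]
    have hbα0 : b • κ.α ≠ 0 := by rw [Algebra.smul_def]; exact mul_ne_zero hb' κ.α0
    rw [h5, w.n_mul (by simpa using ⟨hz0, fun h => absurd h hb⟩) (pow_ne_zero _ hbα0), w.n_pow hbα0, hbα, mul_zero, add_zero] at hn
    exact hn
  · obtain ⟨y0, hy00, hy0⟩ := w.exists_n 1
    set B : Finset (FFPrime M) := (Finset.range q).image (fun s => act (κ.σ ^ s) w)
    obtain ⟨y, hy⟩ := approx B (fun v => if v = w then y0 else 1) 2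
    have hB : ∀ s, s < q → act (κ.σ ^ s) w ∈ B := fun s hs => Finset.mem_image_of_mem _ (Finset.mem_range.2 hs)
    have hw := hy w (by have := hB 0 κ.hq.pos; rwa [pow_zero, act_one] at this)
    rw [if_pos rfl] at hw
    have h1 := w.n_add_eq (x := y0) hy00 (y := y - y0) (by rw [hy0]; exact hw)
    rw [add_sub_cancel] at h1
    refine ⟨κ.nmL y, ?_, ?_⟩
    · intro h
      have := κ.nmL_spec y
      rw [h, map_zero] at this
      exact κ.nm_ne h1.1 this.symm
    · rw [κ.nmL_spec, κ.n_nm w h1.1, Finset.sum_eq_single 0]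
      · simp [h1.2, hy0]
      · intro s hs hs0
        have hne : act (κ.σ ^ s) w ≠ w := by
          intro h
          exact hs0 (κ.act_injOn hfix (Finset.mem_range.1 hs) κ.hq.pos (by rw [h, pow_zero, act_one]))
        have h2 := hy _ (hB s (Finset.mem_range.1 hs))
        rw [if_neg hne] at h2
        have h3 := (act (κ.σ ^ s) w).n_add_eq (x := 1) one_ne_zero (y := y - 1) (by
          rw [n_one]; exact ge_mono _ (by norm_num) h2)
        rw [add_sub_cancel, n_one] at h3
        exact h3.2
      · intro h; exact absurd (Finset.mem_range.2 κ.hq.pos) h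

end Kum

set_option autoImplicit false
set_option linter.all false

namespace Kum
open FFPrime Dv
variable {q : ℕ} {L M : Type} [Field L] [Field M] [Algebra L M] (κ : Kum q L M)
variable (p : ℕ) [Fact p.Prime] [Algebra (ZMod p) L] [Algebra (ZMod p) M] [IsScalarTower (ZMod p) L M]
variable [Algebra.IsAlgebraic L M]

theorem map0 {z : L} (hz : z ≠ 0) : algebraMap L M z ≠ 0 := by simpa using hz

/-- restriction of a place -/
def res (w : FFPrime M) : FFPrime L :=
  mkN (fun z => w.n (algebraMap L M z))
    (fun x y hx hy => by rw [map_mul, w.n_mul (map0 hx) (map0 hy)])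
    (fun x y hx hy hxy => by
      have := w.min_le_n_add (map0 (M := M) hx) (map0 (M := M) hy) (by rw [← map_add]; exact map0 hxy)
      rwa [← map_add] at this)
    (κ.exists_L_n_one p w)

theorem res_n (w : FFPrime M) (z : L) : (κ.res p w).n z = w.n (algebraMap L M z) := by
  by_cases hz : z = 0
  · rw [hz, map_zero, n_zero, n_zero]
  · exact mkN_n _ _ _ _ hz

theorem res_ge (w : FFPrime M) (k : ℤ) (z : L) : (κ.res p w).ge k z ↔ w.ge k (algebraMap L M z) := by
  by_cases hz : z = 0
  · rw [hz, map_zero]; exact ⟨fun _ => w.ge_zero _, fun _ => ge_zero _ _⟩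
  · rw [ge_iff _ hz, ge_iff _ (map0 hz), res_n]

theorem res_act (τ : M ≃ₐ[L] M) (w : FFPrime M) : κ.res p (act τ w) = κ.res p w := by
  apply ext_n
  intro x _
  rw [res_n, res_n, act_n, AlgEquiv.commutes]

theorem act_pow_add (w : FFPrime M) (s t : ℕ) : act (κ.σ ^ (s + t)) w = act (κ.σ ^ t) (act (κ.σ ^ s) w) := by
  rw [pow_add, act_mul]

theorem act_pow_mod (w : FFPrime M) (s : ℕ) : act (κ.σ ^ (s % q)) w = act (κ.σ ^ s) w := by
  conv_rhs => rw [← Nat.mod_add_div s q, pow_add, pow_mul, κ.hσ, one_pow, mul_one]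

theorem trans {w w' : FFPrime M} (h : κ.res p w = κ.res p w') : ∃ s, s < q ∧ w' = act (κ.σ ^ s) w := by
  classical
  by_contra hcon
  push Not at hcon
  set B : Finset (FFPrime M) := (Finset.range q).image (fun s => act (κ.σ ^ s) w)
  set B' : Finset (FFPrime M) := (Finset.range q).image (fun s => act (κ.σ ^ s) w')
  have hB : ∀ s, act (κ.σ ^ s) w ∈ B := fun s => by
    rw [← act_pow_mod]
    exact Finset.mem_image_of_mem _ (Finset.mem_range.2 (Nat.mod_lt _ κ.hq.pos))
  have hB' : ∀ s, act (κ.σ ^ s) w' ∈ B' := fun s => by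
    rw [← act_pow_mod]
    exact Finset.mem_image_of_mem _ (Finset.mem_range.2 (Nat.mod_lt _ κ.hq.pos))
  have hdis : ∀ v, v ∈ B' → v ∉ B := by
    intro v hv hv'
    obtain ⟨s, hs, rfl⟩ := Finset.mem_image.1 hv
    obtain ⟨t, ht, h1⟩ := Finset.mem_image.1 hv'
    have h2 : w' = act (κ.σ ^ ((t + (q - s)) % q)) w := by
      rw [act_pow_mod, act_pow_add, h1, ← act_pow_add, Nat.add_sub_cancel' (Finset.mem_range.1 hs).le, κ.hσ, act_one]
    exact hcon _ (Nat.mod_lt _ κ.hq.pos) h2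
  obtain ⟨y, hy⟩ := approx (B ∪ B') (fun v => if v ∈ B then 1 else 0) 1
  have hy1 : ∀ s, y ≠ 0 ∧ w.n ((κ.σ ^ s) y) = 0 := by
    intro s
    have h1 := hy _ (Finset.mem_union_left _ (hB s))
    rw [if_pos (hB s)] at h1
    have h2 := (act (κ.σ ^ s) w).n_add_eq (x := 1) one_ne_zero (y := y - 1) (by rw [n_one]; exact h1)
    rw [add_sub_cancel, n_one] at h2
    exact h2
  have hy0 := (hy1 0).1
  have hy2 : ∀ s, 1 ≤ w'.n ((κ.σ ^ s) y) := by
    intro s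
    have h1 := hy _ (Finset.mem_union_right _ (hB' s))
    rw [if_neg (hdis _ (hB' s)), sub_zero] at h1
    exact (ge_iff _ hy0).1 h1
  have e1 : (κ.res p w).n (κ.nmL y) = 0 := by
    rw [res_n, nmL_spec, κ.n_nm w hy0]
    exact Finset.sum_eq_zero fun s _ => (hy1 s).2
  have e2 : (κ.res p w').n (κ.nmL y) ≠ 0 := by
    rw [res_n, nmL_spec, κ.n_nm w' hy0]
    apply ne_of_gt
    exact Finset.sum_pos (fun s _ => by have := hy2 s; omega) ⟨0, Finset.mem_range.2 κ.hq.pos⟩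
  rw [h] at e1
  exact e2 e1

variable [FFld p L] [FFld p M]

theorem fibre_finite (P : FFPrime L) : {w : FFPrime M | κ.res p w = P}.Finite := by
  obtain ⟨y, hy0, hy⟩ := P.exists_n 1
  refine (zeros_finite p (algebraMap L M y)).subset ?_
  rintro w rfl
  rw [res_n] at hy
  rw [Set.mem_setOf_eq]
  omega

/-- conorm -/
def j : Dv L →+ Dv M where
  toFun D := Finsupp.ofSupportFinite (fun w => D (κ.res p w)) (by
    refine (Set.Finite.biUnion D.support.finite_toSet (fun P _ => κ.fibre_finite p P)).subset ?_
    intro w hw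
    simp only [Set.mem_iUnion]
    exact ⟨κ.res p w, by simpa using hw, rfl⟩)
  map_zero' := by ext w; rfl
  map_add' D E := by ext w; rfl

theorem j_apply (D : Dv L) (w : FFPrime M) : κ.j p D w = D (κ.res p w) := rfl

theorem j_mono {D E : Dv L} (h : D ≤ E) : κ.j p D ≤ κ.j p E := fun w => h _

theorem j_dv (z : L) : κ.j p (dv p z) = dv p (algebraMap L M z) := by
  ext w
  rw [j_apply, dv_apply, dv_apply, res_n]

theorem a0 : κ.a ≠ 0 := by
  intro h
  have := κ.ha
  rw [h, map_zero] at this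
  exact pow_ne_zero _ κ.α0 this

theorem n_a (w : FFPrime M) : w.n (algebraMap L M κ.a) = q * w.n κ.α := by
  rw [← κ.ha, w.n_pow κ.α0]

/-- auxiliary divisor -/
def Ea : Dv L := (dv p κ.a).mapRange (fun k => |k|) (by simp)

theorem Ea_spec (w : FFPrime M) {i : ℕ} (hi : i < q) : |w.n (κ.α ^ i)| ≤ κ.Ea p (κ.res p w) := by
  unfold Ea
  rw [Finsupp.mapRange_apply, dv_apply, res_n, n_a, w.n_pow κ.α0, abs_mul, abs_mul]
  exact mul_le_mul_of_nonneg_right (by simpa using hi.le) (abs_nonneg _)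

theorem ell1 (D : Dv L) : q * ell p D ≤ ell p (κ.j p (D + κ.Ea p)) := by
  let f : (Fin q → LL p D) →ₗ[ZMod p] LL p (κ.j p (D + κ.Ea p)) :=
    LinearMap.codRestrict _ (∑ i : Fin q, ((LinearMap.mulRight (ZMod p) (κ.α ^ (i : ℕ))) ∘ₗ
      (IsScalarTower.toAlgHom (ZMod p) L M).toLinearMap ∘ₗ (LL p D).subtype ∘ₗ LinearMap.proj i)) (by
        intro y
        rw [LinearMap.sum_apply]
        refine Submodule.sum_mem _ fun i _ => ?_
        intro w
        have h1 := (κ.res_ge p w _ _).1 ((y i).2 (κ.res p w))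
        have h2 := w.ge_mul h1 (w.ge_n (κ.α ^ (i : ℕ)))
        refine w.ge_mono ?_ h2
        have := abs_le.1 (κ.Ea_spec p w i.2)
        rw [j_apply, Finsupp.add_apply]
        omega)
  have hf : ∀ y, (f y : M) = ∑ i : Fin q, algebraMap L M (y i) * κ.α ^ (i : ℕ) := by
    intro y
    simp [f, LinearMap.codRestrict_apply, LinearMap.sum_apply]
  have hinj : Function.Injective f := by
    rw [← LinearMap.ker_eq_bot, LinearMap.ker_eq_bot']
    intro y hy
    have h0 := congrArg Subtype.val hy
    rw [hf] at h0
    ext i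
    have h1 := congrArg (κ.pr i) h0
    rw [map_sum] at h1
    simp_rw [← Algebra.smul_def, map_smul] at h1
    rw [Finset.sum_eq_single i] at h1
    · rw [κ.pr_α i.2 i.2, if_pos rfl, Algebra.smul_def] at h1
      simp only [Submodule.coe_zero, map_zero] at h1
      rcases mul_eq_zero.1 h1 with h2 | h2
      · simpa using h2
      · exact absurd h2 (mul_ne_zero κ.hq0 (pow_ne_zero _ κ.α0))
    · intro k _ hk
      rw [κ.pr_α i.2 k.2, if_neg (fun h => hk (Fin.ext h.symm)), smul_zero]
    · intro h; exact absurd (Finset.mem_univ _) h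
  have := LinearMap.finrank_le_finrank_of_injective hinj
  rw [Module.finrank_pi_fintype] at this
  simpa [ell] using this

theorem ell2 (D : Dv L) (hsurj : ∀ P, ∃ w, κ.res p w = P) : ell p (κ.j p D) ≤ q * ell p (D + κ.Ea p) := by
  choose cf hcf using fun (i : ℕ) (y : M) => κ.exists_pr i y
  have hcf' : ∀ i y, algebraMap L M (cf i y) = κ.pr i y * (κ.α ^ i)⁻¹ := fun i y => by
    rw [hcf, Algebra.smul_def, mul_assoc, mul_inv_cancel₀ (pow_ne_zero _ κ.α0), mul_one]
  have hm : Function.Injective (algebraMap L M) := (algebraMap L M).injective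
  have hpr : ∀ (i : ℕ) (c : ZMod p) (y : M), κ.pr i (c • y) = c • κ.pr i y := by
    intro i c y
    rw [← algebraMap_smul L c y, map_smul, algebraMap_smul]
  let f : LL p (κ.j p D) →ₗ[ZMod p] (Fin q → LL p (D + κ.Ea p)) :=
    { toFun := fun y i => ⟨cf i y, by
        intro P
        obtain ⟨w, rfl⟩ := hsurj P
        rw [res_ge, hcf']
        have h1 : w.ge (- D (κ.res p w)) (κ.pr i (y : M)) := by
          refine κ.ge_pr (p := p) w (fun s => ?_) i
          have := y.2 (act (κ.σ ^ s) w)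
          rwa [j_apply, res_act] at this
        have h2 := w.ge_mul h1 (w.ge_n (κ.α ^ (i : ℕ))⁻¹)
        refine w.ge_mono ?_ h2
        have := abs_le.1 (κ.Ea_spec p w i.2)
        rw [n_inv, Finsupp.add_apply]
        omega⟩
      map_add' := by
        intro y z
        ext i
        apply hm
        simp [hcf', add_mul]
      map_smul' := by
        intro c y
        ext i
        apply hm
        simp only [Submodule.coe_smul, RingHom.id_apply, Pi.smul_apply]
        rw [hcf', hpr, Algebra.smul_def c (cf i y), map_mul, hcf', ← IsScalarTower.algebraMap_apply, Algebra.smul_def, mul_assoc] }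
  have hinj : Function.Injective f := by
    rw [← LinearMap.ker_eq_bot, LinearMap.ker_eq_bot']
    intro y hy
    have h0 : ∀ i ∈ Finset.range q, κ.pr i (y : M) = 0 := by
      intro i hi
      have := congrArg Subtype.val (congrFun hy ⟨i, Finset.mem_range.1 hi⟩)
      rw [hcf]
      change cf i y = 0 at this
      rw [this, zero_smul]
    have h1 := κ.sum_pr (y : M)
    rw [Finset.sum_eq_zero h0] at h1
    rcases mul_eq_zero.1 h1.symm with h2 | h2
    · exact absurd h2 κ.hq0
    · exact Subtype.ext h2
  have := LinearMap.finrank_le_finrank_of_injective hinj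
  rw [Module.finrank_pi_fintype] at this
  simpa [ell] using this

theorem res_surj (P : FFPrime L) : ∃ w, κ.res p w = P := by
  by_contra hcon
  push Not at hcon
  have hP : κ.j p (Finsupp.single P 1) = 0 := by
    ext w
    rw [j_apply, Finsupp.single_eq_of_ne (fun h => hcon w h)]
    rfl
  obtain ⟨e, n0, he⟩ := riemann p (F := L)
  have hd := P.deg_pos p
  set C := ell p (κ.j p (κ.Ea p))
  have key : ∀ n : ℕ, n0 ≤ n → (q : ℤ) * (n * P.deg p + e) ≤ C := by
    intro n hn
    have h1 := κ.ell1 p (n • Finsupp.single P 1)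
    rw [map_add, map_nsmul, hP, smul_zero, zero_add] at h1
    have h2 : dg p (n • Finsupp.single P (1:ℤ)) = n * P.deg p := by
      rw [map_nsmul, dg_single]; simp
    have h3 := he (n • Finsupp.single P 1) (by rw [h2]; nlinarith)
    rw [h2] at h3
    rw [← h3]
    exact_mod_cast h1
  have h4 := key (n0 + C + e.natAbs + 1) (by omega)
  have hq := κ.hq.pos
  push_cast at h4
  have h5 : -(e.natAbs : ℤ) ≤ e := by omega
  have h6 : ((n0 : ℤ) + C + e.natAbs + 1) ≤ (n0 + C + e.natAbs + 1) * P.deg p :=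
    le_mul_of_one_le_right (by positivity) (by exact_mod_cast hd)
  have h7 : (C : ℤ) + 1 ≤ (n0 + C + e.natAbs + 1) * P.deg p + e := by
    have : (0:ℤ) ≤ n0 := by positivity
    omega
  have h8 : (C : ℤ) + 1 ≤ q * ((n0 + C + e.natAbs + 1) * P.deg p + e) := by
    refine h7.trans (le_mul_of_one_le_left (le_trans (by positivity) h7) (by exact_mod_cast hq))
  have h9 : (|e| : ℤ) = e.natAbs := by simp
  simp only [h9] at h4
  omega

theorem lin_le {f g c d : ℤ} {n0 : ℕ} (h : ∀ n : ℕ, n0 ≤ n → n * f + c ≤ n * g + d) : f ≤ g := by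
  by_contra hlt
  push Not at hlt
  have h1 := h (n0 + (d - c).natAbs + 1) (by omega)
  push_cast at h1
  have : (n0 + ((d-c).natAbs : ℤ) + 1) * (f - g) ≤ d - c := by
    have h9 : (|d - c| : ℤ) = (d-c).natAbs := by simp
    rw [← h9]; linarith
  have h2 : (n0 + ((d-c).natAbs : ℤ) + 1) ≤ (n0 + ((d-c).natAbs : ℤ) + 1) * (f - g) :=
    le_mul_of_one_le_right (by positivity) (by omega)
  omega

theorem dg_j_single (P : FFPrime L) : dg p (κ.j p (Finsupp.single P 1)) = q * P.deg p := by
  obtain ⟨e, n0, he⟩ := riemann p (F := L)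
  obtain ⟨e', n0', he'⟩ := riemann p (F := M)
  have hd := P.deg_pos p
  have hnn : 0 ≤ κ.j p (Finsupp.single P 1) := by
    intro w
    rw [j_apply]
    exact (Finsupp.single_nonneg.2 (zero_le_one : (0:ℤ) ≤ 1)) _
  have hf : 0 < dg p (κ.j p (Finsupp.single P 1)) := by
    obtain ⟨w, hw⟩ := κ.res_surj p P
    have h1 : Finsupp.single w (1:ℤ) ≤ κ.j p (Finsupp.single P 1) := by
      intro v
      by_cases hv : v = w
      · subst hv; rw [j_apply, hw]; simp
      · rw [Finsupp.single_eq_of_ne hv]; exact hnn v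
    have h2 := dg_mono p h1
    rw [dg_single] at h2
    have := w.deg_pos p
    omega
  set f := dg p (κ.j p (Finsupp.single P 1))
  have h2 : ∀ n : ℕ, dg p (n • Finsupp.single P (1:ℤ)) = n * P.deg p := fun n => by
    rw [map_nsmul, dg_single]; simp
  have h2' : ∀ n : ℕ, dg p (κ.j p (n • Finsupp.single P (1:ℤ))) = n * f := fun n => by
    rw [map_nsmul, map_nsmul]; simp [f]
  have hE : 0 ≤ κ.Ea p := by
    intro P
    unfold Ea
    rw [Finsupp.mapRange_apply]
    exact abs_nonneg _
  have hE' : 0 ≤ dg p (κ.j p (κ.Ea p)) := dg_nonneg p (by have := κ.j_mono p hE; rwa [map_zero] at this)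
  have hbig : ∀ n : ℕ, n0 + n0' ≤ n → (n0 : ℤ) ≤ n * P.deg p ∧ (n0' : ℤ) ≤ n * f := by
    intro n hn
    constructor
    · have : (n : ℤ) ≤ n * P.deg p := le_mul_of_one_le_right (by positivity) (by exact_mod_cast hd)
      omega
    · have : (n : ℤ) ≤ n * f := le_mul_of_one_le_right (by positivity) hf
      omega
  apply le_antisymm
  · apply lin_le (n0 := n0 + n0') (c := e') (d := q * (dg p (κ.Ea p) + e))
    intro n hn
    obtain ⟨b1, b2⟩ := hbig n hn
    have h3 := κ.ell2 p (n • Finsupp.single P 1) (κ.res_surj p)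
    have h4 := he' (κ.j p (n • Finsupp.single P 1)) (by rw [h2']; exact b2)
    have h5 := he (n • Finsupp.single P 1 + κ.Ea p) (by rw [map_add, h2]; have := dg_nonneg p hE; omega)
    rw [map_add, h2] at h5
    rw [h2'] at h4
    zify at h3
    rw [h4, h5] at h3
    linarith
  · apply lin_le (n0 := n0 + n0') (c := q * e) (d := dg p (κ.j p (κ.Ea p)) + e')
    intro n hn
    obtain ⟨b1, b2⟩ := hbig n hn
    have h3 := κ.ell1 p (n • Finsupp.single P 1)
    have h4 := he' (κ.j p (n • Finsupp.single P 1 + κ.Ea p)) (by rw [map_add, map_add, h2']; omega)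
    have h5 := he (n • Finsupp.single P 1) (by rw [h2]; exact b1)
    rw [h2] at h5
    rw [map_add, map_add, h2'] at h4
    zify at h3
    rw [map_add, h4, h5] at h3
    linarith

theorem dg_j (D : Dv L) : dg p (κ.j p D) = q * dg p D := by
  have h : (dg p).comp (κ.j p) = (AddMonoidHom.mulLeft (q : ℤ)).comp (dg p) := by
    apply Finsupp.addHom_ext
    intro P k
    have h1 : Finsupp.single P k = k • Finsupp.single P (1 : ℤ) := by simp
    rw [AddMonoidHom.comp_apply, AddMonoidHom.comp_apply, h1, map_zsmul, map_zsmul, map_zsmul, map_zsmul,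
      dg_j_single, dg_single]
    simp
  exact DFunLike.congr_fun h D

theorem deg_act_le (τ : M ≃ₐ[L] M) (w : FFPrime M) : (act τ w).deg p ≤ w.deg p := by
  obtain ⟨r, hr⟩ := (act τ w).exists_resInd p
  refine w.le_deg_of_resInd p (fun i => τ (r i)) ⟨fun i => hr.1 i, fun c hc => hr.2 c ?_⟩
  rw [act_ge, map_sum]
  have : ∀ i, τ (c i • r i) = c i • τ (r i) := fun i => by
    rw [← algebraMap_smul L (c i) (r i), map_smul, algebraMap_smul]
  simp_rw [this]
  exact hc

theorem deg_act (τ : M ≃ₐ[L] M) (w : FFPrime M) : (act τ w).deg p = w.deg p := by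
  apply le_antisymm (deg_act_le p τ w)
  have := deg_act_le p τ⁻¹ (act τ w)
  rwa [← act_mul, mul_inv_cancel, act_one] at this

end Kum

set_option autoImplicit false
set_option linter.all false

namespace Kum
open FFPrime Dv
variable {q : ℕ} {L M : Type} [Field L] [Field M] [Algebra L M] (κ : Kum q L M)
variable (p : ℕ) [Fact p.Prime] [Algebra (ZMod p) L] [Algebra (ZMod p) M] [IsScalarTower (ZMod p) L M]
variable [Algebra.IsAlgebraic L M]
variable [FFld p L] [FFld p M]

/-- permutation of places -/
def actE (τ : M ≃ₐ[L] M) : FFPrime M ≃ FFPrime M where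
  toFun := act τ⁻¹
  invFun := act τ
  left_inv w := by rw [← act_mul, inv_mul_cancel, act_one]
  right_inv w := by rw [← act_mul, mul_inv_cancel, act_one]

/-- action on divisors -/
def sh (τ : M ≃ₐ[L] M) : Dv M →+ Dv M := (Finsupp.domCongr (actE τ)).toAddMonoidHom

theorem sh_apply (τ : M ≃ₐ[L] M) (D : Dv M) (w : FFPrime M) : sh τ D w = D (act τ w) := rfl

theorem sh_single (τ : M ≃ₐ[L] M) (w : FFPrime M) (k : ℤ) :
    sh τ (Finsupp.single w k) = Finsupp.single (act τ⁻¹ w) k := by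
  simp [sh, Finsupp.domCongr_apply, Finsupp.equivMapDomain_single]
  rfl

theorem sh_dv (τ : M ≃ₐ[L] M) (y : M) : sh τ (dv p y) = dv p (τ y) := by
  ext w; rw [sh_apply, dv_apply, dv_apply, act_n]

theorem dg_sh (τ : M ≃ₐ[L] M) (D : Dv M) : dg p (sh τ D) = dg p D := by
  have h : (dg p).comp (sh τ) = dg p := by
    apply Finsupp.addHom_ext
    intro w k
    rw [AddMonoidHom.comp_apply, sh_single, dg_single, dg_single, deg_act]
  exact DFunLike.congr_fun h D

/-- section of the restriction map -/
def sec (P : FFPrime L) : FFPrime M := (κ.res_surj p P).choose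
theorem res_sec (P : FFPrime L) : κ.res p (κ.sec p P) = P := (κ.res_surj p P).choose_spec

/-- norm of divisors -/
def N : Dv M →+ Dv L where
  toFun D := Finsupp.ofSupportFinite (fun P => ∑ s ∈ Finset.range q, D (act (κ.σ ^ s) (κ.sec p P))) (by
    refine (D.support.finite_toSet.image (κ.res p)).subset ?_
    intro P hP
    obtain ⟨s, _, hs⟩ := Finset.exists_ne_zero_of_sum_ne_zero hP
    exact ⟨act (κ.σ ^ s) (κ.sec p P), by simpa using hs, by rw [res_act, res_sec]⟩)
  map_zero' := by
    ext P
    change ∑ s ∈ Finset.range q, (0 : ℤ) = 0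
    simp
  map_add' D E := by
    ext P
    change ∑ s ∈ Finset.range q, (D _ + E _) = ∑ s ∈ Finset.range q, D _ + ∑ s ∈ Finset.range q, E _
    rw [Finset.sum_add_distrib]

theorem orb_shift (D : Dv M) (w : FFPrime M) (t : ℕ) :
    ∑ s ∈ Finset.range q, D (act (κ.σ ^ s) (act (κ.σ ^ t) w)) = ∑ s ∈ Finset.range q, D (act (κ.σ ^ s) w) := by
  induction t with
  | zero => rfl
  | succ t ih =>
    rw [← ih]
    have h1 : ∀ s, act (κ.σ ^ s) (act (κ.σ ^ (t+1)) w) = act (κ.σ ^ (s+1)) (act (κ.σ ^ t) w) := by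
      intro s
      rw [← act_mul, ← act_mul, ← pow_add, ← pow_add]
      congr 2; omega
    simp_rw [h1]
    rw [← add_right_cancel_iff (a := D (act (κ.σ ^ 0) (act (κ.σ ^ t) w))),
      ← Finset.sum_range_succ' (fun s => D (act (κ.σ ^ s) (act (κ.σ ^ t) w))), Finset.sum_range_succ, κ.hσ, pow_zero]

theorem exists_t (w : FFPrime M) : ∃ t, t < q ∧ w = act (κ.σ ^ t) (κ.sec p (κ.res p w)) :=
  κ.trans p (κ.res_sec p _)

theorem N_sec (D : Dv M) (P : FFPrime L) :
    κ.N p D P = ∑ s ∈ Finset.range q, D (act (κ.σ ^ s) (κ.sec p P)) := rfl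

theorem N_res (D : Dv M) (w : FFPrime M) :
    κ.N p D (κ.res p w) = ∑ s ∈ Finset.range q, D (act (κ.σ ^ s) w) := by
  obtain ⟨t, _, ht⟩ := κ.exists_t p w
  conv_rhs => rw [ht]
  rw [orb_shift, N_sec]

theorem jN (D : Dv M) : κ.j p (κ.N p D) = ∑ s ∈ Finset.range q, sh (κ.σ ^ s) D := by
  ext w
  rw [j_apply, N_res, Finsupp.finset_sum_apply]
  rfl

theorem N_j (D : Dv L) : κ.N p (κ.j p D) = q • D := by
  ext P
  rw [N_sec]
  simp_rw [j_apply, res_act, res_sec]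
  simp

theorem N_dv {y : M} (hy : y ≠ 0) : κ.N p (dv p y) = dv p (κ.nmL y) := by
  ext P
  obtain ⟨w, rfl⟩ := κ.res_surj p P
  rw [N_res, dv_apply, res_n, nmL_spec, κ.n_nm w hy]
  rfl

theorem N_sh (D : Dv M) : κ.N p (sh κ.σ D) = κ.N p D := by
  ext P
  rw [N_sec, N_sec, ← κ.orb_shift D _ 1]
  refine Finset.sum_congr rfl fun s _ => ?_
  rw [sh_apply, ← act_mul, ← act_mul, pow_one, ← pow_succ, ← pow_succ']

theorem dg_N (D : Dv M) : dg p (κ.N p D) = dg p D := by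
  have h := κ.dg_j p (κ.N p D)
  rw [jN, map_sum] at h
  simp_rw [dg_sh] at h
  rw [Finset.sum_const, Finset.card_range, nsmul_eq_mul] at h
  have hq : (q : ℤ) ≠ 0 := by exact_mod_cast κ.hq.ne_zero
  exact (mul_left_cancel₀ hq h).symm

theorem nmL_ne {y : M} (hy : y ≠ 0) : κ.nmL y ≠ 0 := by
  intro h
  have := κ.nmL_spec y
  rw [h, map_zero] at this
  exact κ.nm_ne hy this.symm

theorem exists_j {D : Dv M} (h : sh κ.σ D = D) : ∃ D', κ.j p D' = D := by
  have h1 : ∀ (s : ℕ) w, D (act (κ.σ ^ s) w) = D w := by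
    intro s
    induction s with
    | zero => intro w; rfl
    | succ s ih =>
      intro w
      rw [pow_succ', act_mul, ih]
      exact DFunLike.congr_fun h w
  refine ⟨Finsupp.ofSupportFinite (fun P => D (κ.sec p P)) ?_, ?_⟩
  · refine (D.support.finite_toSet.image (κ.res p)).subset ?_
    intro P hP
    exact ⟨κ.sec p P, by simpa using hP, κ.res_sec p P⟩
  · ext w
    rw [j_apply]
    change D (κ.sec p (κ.res p w)) = D w
    obtain ⟨t, _, ht⟩ := κ.exists_t p w
    conv_rhs => rw [ht, h1]

theorem sh_j (D : Dv L) : sh κ.σ (κ.j p D) = κ.j p D := by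
  ext w; rw [sh_apply, j_apply, j_apply, res_act]

theorem exists_sub_sh {D : Dv M} (h : κ.N p D = 0) : ∃ E : Dv M, D = E - sh κ.σ E := by
  classical
  choose t ht htw using κ.exists_t p
  let G : FFPrime M → ℕ → ℤ := fun x t => ∑ s ∈ Finset.range t, D (act (κ.σ ^ s) x)
  have hG0 : ∀ x, G x q = 0 := fun x => by
    change ∑ s ∈ Finset.range q, D (act (κ.σ ^ s) x) = 0
    rw [← κ.N_res p, h]; rfl
  have hGq : ∀ x k, G x (q + k) = G x k := by
    intro x k
    change ∑ s ∈ Finset.range (q + k), D (act (κ.σ ^ s) x) = _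
    rw [Finset.sum_range_add]
    change G x q + _ = _
    rw [hG0, zero_add]
    refine Finset.sum_congr rfl fun s _ => ?_
    rw [pow_add, κ.hσ, one_mul]
  have hGmod : ∀ x k, G x k = G x (k % q) := by
    intro x k
    induction k using Nat.strong_induction_on with
    | _ k ih =>
      rcases Nat.lt_or_ge k q with hk | hk
      · rw [Nat.mod_eq_of_lt hk]
      · obtain ⟨m, rfl⟩ := Nat.exists_eq_add_of_le hk
        rw [hGq, Nat.add_mod_left]
        exact ih m (by have := κ.hq.pos; omega)
  have hGwd : ∀ x k l, act (κ.σ ^ k) x = act (κ.σ ^ l) x → G x k = G x l := by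
    intro x k l hkl
    by_cases hx : act κ.σ x = x
    · have h0 : ∀ m, G x m = m * D x := by
        intro m
        change ∑ s ∈ Finset.range m, D (act (κ.σ ^ s) x) = _
        simp_rw [κ.act_pow_fixed hx]
        simp
      have h1 := h0 q
      rw [hG0] at h1
      have h2 : D x = 0 := by
        rcases mul_eq_zero.1 h1.symm with h3 | h3
        · exact absurd h3 (by exact_mod_cast κ.hq.ne_zero)
        · exact h3
      rw [h0, h0, h2, mul_zero, mul_zero]
    · rw [← κ.act_pow_mod x k, ← κ.act_pow_mod x l] at hkl
      have := κ.act_injOn hx (Nat.mod_lt _ κ.hq.pos) (Nat.mod_lt _ κ.hq.pos) hkl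
      rw [hGmod, this, ← hGmod]
  let E : Dv M := Finsupp.ofSupportFinite (fun w => - G (κ.sec p (κ.res p w)) (t w)) (by
    refine (Set.Finite.biUnion (D.support.finite_toSet.image (κ.res p)) (fun P _ => κ.fibre_finite p P)).subset ?_
    intro w hw
    have hw' : G (κ.sec p (κ.res p w)) (t w) ≠ 0 := by simpa using hw
    obtain ⟨s, _, hs⟩ := Finset.exists_ne_zero_of_sum_ne_zero hw'
    simp only [Set.mem_iUnion]
    exact ⟨κ.res p w, ⟨_, by simpa using hs, by rw [res_act, res_sec]⟩, rfl⟩)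
  refine ⟨E, ?_⟩
  ext w
  rw [Finsupp.sub_apply, sh_apply]
  change D w = - G (κ.sec p (κ.res p w)) (t w) - - G (κ.sec p (κ.res p (act κ.σ w))) (t (act κ.σ w))
  rw [res_act]
  have h1 : G (κ.sec p (κ.res p w)) (t (act κ.σ w)) = G (κ.sec p (κ.res p w)) (t w + 1) := by
    apply hGwd
    have h2 := htw (act κ.σ w)
    rw [res_act] at h2
    rw [← h2, pow_succ, act_mul, ← htw w]
  rw [h1]
  have h3 : G (κ.sec p (κ.res p w)) (t w + 1) = G (κ.sec p (κ.res p w)) (t w) + D (act (κ.σ ^ t w) (κ.sec p (κ.res p w))) :=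
    Finset.sum_range_succ _ _
  rw [h3, ← htw w]
  ring

theorem hilbert90 {η : M} (hη : κ.nm η = 1) : ∃ y : M, y ≠ 0 ∧ η * κ.σ y = y := by
  let c : ℕ → M := fun s => ∏ i ∈ Finset.range s, (κ.σ ^ i) η
  have hc0 : c 0 = 1 := rfl
  have hcq : c q = 1 := hη
  have hcs : ∀ s, η * κ.σ (c s) = c (s + 1) := by
    intro s
    change η * κ.σ (∏ i ∈ Finset.range s, (κ.σ ^ i) η) = ∏ i ∈ Finset.range (s+1), (κ.σ ^ i) η
    rw [Finset.prod_range_succ', map_prod, mul_comm]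
    simp_rw [← σ_succ]
    rfl
  let Y : ℕ → M := fun i => ∑ s ∈ Finset.range q, c s * (κ.σ ^ s) (κ.α⁻¹ ^ i)
  have hY : ∀ i, η * κ.σ (Y i) = Y i := by
    intro i
    change η * κ.σ (∑ s ∈ Finset.range q, c s * (κ.σ ^ s) (κ.α⁻¹ ^ i)) = _
    rw [map_sum, Finset.mul_sum]
    have h1 : ∀ s, η * κ.σ (c s * (κ.σ ^ s) (κ.α⁻¹ ^ i)) = c (s+1) * (κ.σ ^ (s+1)) (κ.α⁻¹ ^ i) := by
      intro s
      rw [map_mul, ← mul_assoc, hcs, σ_succ]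
    simp_rw [h1]
    rw [← add_right_cancel_iff (a := c 0 * (κ.σ ^ 0) (κ.α⁻¹ ^ i)),
      ← Finset.sum_range_succ' (fun s => c s * (κ.σ ^ s) (κ.α⁻¹ ^ i)), Finset.sum_range_succ, hcq, hc0, σ_pow_q]
    rfl
  have hex : ∃ i, Y i ≠ 0 := by
    by_contra hcon
    push Not at hcon
    have h1 : ∑ i ∈ Finset.range q, κ.α ^ i * Y i = q := by
      have h2 : ∀ i s, (κ.σ ^ s) (κ.α⁻¹ ^ i) = algebraMap L M (κ.ζ⁻¹ ^ (i * s)) * (κ.α ^ i)⁻¹ := by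
        intro i s
        rw [inv_pow, map_inv₀, σ_αpow, Algebra.smul_def, mul_inv, ← map_inv₀, inv_pow]
      have h3 : ∀ i, κ.α ^ i * Y i = ∑ s ∈ Finset.range q, c s * algebraMap L M (κ.ζ⁻¹ ^ (i * s)) := by
        intro i
        change κ.α ^ i * (∑ s ∈ Finset.range q, c s * (κ.σ ^ s) (κ.α⁻¹ ^ i)) = _
        rw [Finset.mul_sum]
        refine Finset.sum_congr rfl fun s _ => ?_
        rw [h2]
        have := pow_ne_zero i κ.α0
        field_simp
      simp_rw [h3]
      rw [Finset.sum_comm, Finset.sum_eq_single 0]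
      · simp [hc0]
      · intro s hs hs0
        rw [← Finset.mul_sum, ← map_sum, κ.geom, map_zero, mul_zero]
        intro hd
        have := Nat.le_of_dvd (by omega) hd
        have := Finset.mem_range.1 hs
        omega
      · intro h; exact absurd (Finset.mem_range.2 κ.hq.pos) h
    simp_rw [hcon, mul_zero, Finset.sum_const_zero] at h1
    exact κ.hq0 h1.symm
  obtain ⟨i, hi⟩ := hex
  exact ⟨Y i, hi, hY i⟩

/-- a place of `L` is split if the Galois group moves the places above it -/
def split (P : FFPrime L) : Prop := act κ.σ (κ.sec p P) ≠ κ.sec p P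

theorem N_single_split {P : FFPrime L} (h : κ.split p P) (k : ℤ) :
    κ.N p (Finsupp.single (κ.sec p P) k) = Finsupp.single P k := by
  classical
  ext R
  rw [N_sec]
  by_cases hR : R = P
  · subst hR
    rw [Finsupp.single_eq_same, Finset.sum_eq_single 0]
    · rw [pow_zero, act_one, Finsupp.single_eq_same]
    · intro s hs hs0
      rw [Finsupp.single_eq_of_ne]
      intro h1
      exact hs0 (κ.act_injOn h (Finset.mem_range.1 hs) κ.hq.pos h1)
    · intro h; exact absurd (Finset.mem_range.2 κ.hq.pos) h
  · rw [Finsupp.single_eq_of_ne hR]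
    refine Finset.sum_eq_zero fun s _ => ?_
    rw [Finsupp.single_eq_of_ne]
    intro h1
    have := congrArg (κ.res p) h1
    rw [res_act, res_sec, res_sec] at this
    exact hR this

theorem N_single_inert {P : FFPrime L} (h : ¬ κ.split p P) (k : ℤ) :
    κ.N p (Finsupp.single (κ.sec p P) k) = Finsupp.single P (q * k) := by
  classical
  unfold split at h
  push Not at h
  ext R
  rw [N_sec]
  by_cases hR : R = P
  · subst hR
    simp_rw [κ.act_pow_fixed h]
    simp
  · rw [Finsupp.single_eq_of_ne hR]
    refine Finset.sum_eq_zero fun s _ => ?_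
    rw [Finsupp.single_eq_of_ne]
    intro h1
    have := congrArg (κ.res p) h1
    rw [res_act, res_sec, res_sec] at this
    exact hR this

theorem deg_split {P : FFPrime L} (h : κ.split p P) {w : FFPrime M} (hw : κ.res p w = P) : w.deg p = P.deg p := by
  obtain ⟨t, _, ht⟩ := κ.exists_t p w
  rw [ht, deg_act, hw]
  have := κ.dg_N p (Finsupp.single (κ.sec p P) 1)
  rw [κ.N_single_split p h, dg_single, dg_single] at this
  omega

theorem deg_inert {P : FFPrime L} (h : ¬ κ.split p P) : (κ.sec p P).deg p = q * P.deg p := by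
  have := κ.dg_N p (Finsupp.single (κ.sec p P) 1)
  rw [κ.N_single_inert p h, dg_single, dg_single] at this
  push_cast at this
  have : ((κ.sec p P).deg p : ℤ) = q * P.deg p := by linarith
  exact_mod_cast this

theorem fibre_inert {P : FFPrime L} (h : ¬ κ.split p P) {w : FFPrime M} (hw : κ.res p w = P) : w = κ.sec p P := by
  obtain ⟨t, _, ht⟩ := κ.exists_t p w
  unfold split at h
  push Not at h
  rw [hw, κ.act_pow_fixed h] at ht
  exact ht

theorem fibre_split_card {P : FFPrime L} (h : κ.split p P) : (κ.fibre_finite p P).toFinset.card = q := by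
  classical
  have : (κ.fibre_finite p P).toFinset = (Finset.range q).image (fun s => act (κ.σ ^ s) (κ.sec p P)) := by
    ext w
    simp only [Set.Finite.mem_toFinset, Set.mem_setOf_eq, Finset.mem_image, Finset.mem_range]
    constructor
    · rintro rfl
      obtain ⟨t, ht, htw⟩ := κ.exists_t p w
      exact ⟨t, ht, htw.symm⟩
    · rintro ⟨s, _, rfl⟩
      rw [res_act, res_sec]
  rw [this, Finset.card_image_of_injOn, Finset.card_range]
  intro s hs t ht hst
  exact κ.act_injOn h (by simpa using hs) (by simpa using ht) hst

end Kum

set_option autoImplicit false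
set_option linter.all false

/-! periodic power series -/
namespace PerSer

theorem bdd {b : ℤ → ℂ} {m : ℕ} (hm : 0 < m) (hb : Function.Periodic b (m : ℤ)) :
    ∃ B : ℝ, 0 ≤ B ∧ ∀ k, ‖b k‖ ≤ B := by
  refine ⟨∑ i ∈ Finset.range m, ‖b i‖, by positivity, fun k => ?_⟩
  have hm' : (0 : ℤ) < m := by exact_mod_cast hm
  have h1 : b k = b ((k % m).toNat : ℕ) := by
    rw [Int.toNat_of_nonneg (Int.emod_nonneg _ hm'.ne'), Int.emod_def, mul_comm]
    exact (hb.sub_int_mul_eq (k / m)).symm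
  rw [h1]
  apply Finset.single_le_sum (f := fun i : ℕ => ‖b i‖) (fun _ _ => norm_nonneg _)
  rw [Finset.mem_range]
  have := Int.emod_lt_of_pos k hm'
  have := Int.emod_nonneg k hm'.ne'
  omega

theorem summ {b : ℤ → ℂ} {B : ℝ} (hB : ∀ k, ‖b k‖ ≤ B) {s : ℝ} (h0 : 0 ≤ s) (h1 : s < 1) :
    Summable (fun n : ℕ => (s : ℂ) ^ n * b n) := by
  refine Summable.of_norm_bounded ((summable_geometric_of_lt_one h0 h1).mul_right B) fun n => ?_
  rw [norm_mul, norm_pow, Complex.norm_real, Real.norm_of_nonneg h0]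
  exact mul_le_mul_of_nonneg_left (hB _) (by positivity)

theorem norm_le {b : ℤ → ℂ} {B : ℝ} (hB : ∀ k, ‖b k‖ ≤ B) {s : ℝ} (h0 : 0 ≤ s) (h1 : s < 1) :
    ‖∑' n : ℕ, (s : ℂ) ^ n * b n‖ ≤ B / (1 - s) := by
  have h := (summable_geometric_of_lt_one h0 h1).mul_right B
  have h2 := tsum_of_norm_bounded (h.hasSum) (f := fun n : ℕ => (s : ℂ) ^ n * b n) fun n => by
    rw [norm_mul, norm_pow, Complex.norm_real, Real.norm_of_nonneg h0]
    exact mul_le_mul_of_nonneg_left (hB _) (by positivity)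
  rw [tsum_mul_right, tsum_geometric_of_lt_one h0 h1, inv_mul_eq_div] at h2
  exact h2

theorem eq {b : ℤ → ℂ} {m : ℕ} (hb : Function.Periodic b (m : ℤ)) {B : ℝ} (hB : ∀ k, ‖b k‖ ≤ B)
    {s : ℝ} (h0 : 0 ≤ s) (h1 : s < 1) :
    (1 - (s : ℂ) ^ m) * ∑' n : ℕ, (s : ℂ) ^ n * b n = ∑ i ∈ Finset.range m, (s : ℂ) ^ i * b i := by
  have h := (summ hB h0 h1).sum_add_tsum_nat_add m
  have h2 : ∀ n : ℕ, (s : ℂ) ^ (n + m) * b ((n + m : ℕ) : ℤ) = s ^ m * (s ^ n * b n) := by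
    intro n
    push_cast
    rw [hb, pow_add]; ring
  simp_rw [h2] at h
  rw [tsum_mul_left] at h
  linear_combination -h

theorem bdd_zero {b : ℤ → ℂ} {m : ℕ} (hm : 0 < m) (hb : Function.Periodic b (m : ℤ)) {B : ℝ} (hB : ∀ k, ‖b k‖ ≤ B)
    (hz : ∑ i ∈ Finset.range m, b i = 0) {s : ℝ} (h0 : 0 ≤ s) (h1 : s < 1) :
    ‖∑' n : ℕ, (s : ℂ) ^ n * b n‖ ≤ m * B := by
  have h := eq hb hB h0 h1
  have hs : 0 < 1 - s ^ m := by
    have := pow_lt_one₀ h0 h1 hm.ne'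
    linarith
  have h2 : ‖∑ i ∈ Finset.range m, (s : ℂ) ^ i * b i‖ ≤ (1 - s ^ m) * (m * B) := by
    have h3 : ∑ i ∈ Finset.range m, (s : ℂ) ^ i * b i = ∑ i ∈ Finset.range m, ((s : ℂ) ^ i - 1) * b i := by
      simp_rw [sub_mul, one_mul]
      rw [Finset.sum_sub_distrib, hz, sub_zero]
    rw [h3]
    refine (norm_sum_le _ _).trans ?_
    calc _ ≤ ∑ i ∈ Finset.range m, (1 - s ^ m) * B := by
          refine Finset.sum_le_sum fun i hi => ?_
          rw [norm_mul]
          refine mul_le_mul ?_ (hB _) (norm_nonneg _) hs.le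
          have h4 : (s : ℂ) ^ i - 1 = ((s ^ i - 1 : ℝ) : ℂ) := by push_cast; rfl
          rw [h4, Complex.norm_real, Real.norm_eq_abs, abs_sub_comm, abs_of_nonneg]
          · have := pow_le_pow_of_le_one h0 h1.le (Finset.mem_range.1 hi).le
            linarith
          · have := pow_le_one₀ (n := i) h0 h1.le
            linarith
      _ = _ := by rw [Finset.sum_const, Finset.card_range, nsmul_eq_mul]; ring
  rw [← h, norm_mul] at h2
  have h5 : ‖1 - (s : ℂ) ^ m‖ = 1 - s ^ m := by
    have h4 : 1 - (s : ℂ) ^ m = ((1 - s ^ m : ℝ) : ℂ) := by push_cast; rfl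
    rw [h4, Complex.norm_real, Real.norm_of_nonneg hs.le]
  rw [h5] at h2
  exact le_of_mul_le_mul_left h2 hs

theorem lower {b : ℤ → ℂ} {m : ℕ} (hm : 0 < m) (hb : Function.Periodic b (m : ℤ)) {B : ℝ} (hB : ∀ k, ‖b k‖ ≤ B)
    {c : ℤ → ℕ} (hc : ∀ k, b k = c k) (hc0 : 0 < c 0) {s : ℝ} (h0 : 0 ≤ s) (h1 : s < 1) :
    1 / (m * (1 - s)) ≤ ‖∑' n : ℕ, (s : ℂ) ^ n * b n‖ := by
  have h := eq hb hB h0 h1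
  have hs : 0 < 1 - s ^ m := by
    have := pow_lt_one₀ h0 h1 hm.ne'
    linarith
  have h5 : ‖1 - (s : ℂ) ^ m‖ = 1 - s ^ m := by
    have h4 : 1 - (s : ℂ) ^ m = ((1 - s ^ m : ℝ) : ℂ) := by push_cast; rfl
    rw [h4, Complex.norm_real, Real.norm_of_nonneg hs.le]
  have h6 : 1 ≤ ‖∑ i ∈ Finset.range m, (s : ℂ) ^ i * b i‖ := by
    have h7 : ∑ i ∈ Finset.range m, (s : ℂ) ^ i * b i = ((∑ i ∈ Finset.range m, s ^ i * c i : ℝ) : ℂ) := by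
      push_cast
      exact Finset.sum_congr rfl fun i _ => by rw [hc]
    rw [h7, Complex.norm_real, Real.norm_of_nonneg (Finset.sum_nonneg fun i _ => by positivity)]
    refine le_trans ?_ (Finset.single_le_sum (f := fun i : ℕ => s ^ i * (c i : ℝ)) (fun i _ => by positivity) (Finset.mem_range.2 hm))
    simp only [pow_zero, one_mul, Nat.cast_zero]
    exact_mod_cast hc0
  rw [← h, norm_mul, h5] at h6
  have h8 : 1 - s ^ m ≤ m * (1 - s) := by
    have := one_add_mul_le_pow (a := s - 1) (by linarith) m
    rw [add_sub_cancel] at this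
    linarith
  have hm' : (0:ℝ) < m := by exact_mod_cast hm
  rw [div_le_iff₀ (mul_pos hm' (by linarith))]
  calc (1:ℝ) ≤ _ := h6
    _ ≤ m * (1 - s) * _ := mul_le_mul_of_nonneg_right h8 (norm_nonneg _)
    _ = _ := mul_comm _ _

end PerSer

namespace Zeta
open FFPrime Dv

/-- divisor classes -/
abbrev Pic (p : ℕ) [Fact p.Prime] (F : Type) [Field F] [Algebra (ZMod p) F] [FFld p F] := Dv F ⧸ (Prin p : AddSubgroup (Dv F))

variable (p : ℕ) [hp : Fact p.Prime] {F : Type} [Field F] [Algebra (ZMod p) F] [hF : FFld p F]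

/-- classes of degree `n` -/
def picF (n : ℤ) : Finset (Pic p F) := (pic_finite p n).toFinset

theorem mem_picF {n : ℤ} {c : Pic p F} : c ∈ picF p n ↔ qdg p c = n := by simp [picF]

/-- character sums over classes of given degree -/
def bs (ψ : AddChar (Pic p F) ℂ) (n : ℤ) : ℂ := ∑ c ∈ picF p n, ψ c

theorem bs_add (ψ : AddChar (Pic p F) ℂ) (c : Pic p F) (n : ℤ) : bs p ψ (n + qdg p c) = ψ c * bs p ψ n := by
  unfold bs
  rw [Finset.mul_sum]
  symm
  refine Finset.sum_equiv (Equiv.addLeft c) ?_ ?_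
  · intro d
    simp only [mem_picF, Equiv.coe_addLeft, map_add]
    omega
  · intro d _
    simp [AddChar.map_add_eq_mul]

theorem bs_per {ψ : AddChar (Pic p F) ℂ} {d : Pic p F} (hd : ψ d = 1) {m : ℕ} (hm : qdg p d = m) :
    Function.Periodic (bs p ψ) (m : ℤ) := by
  intro n
  rw [← hm, bs_add, hd, one_mul]

theorem bs_zero {ψ : AddChar (Pic p F) ℂ} {d : Pic p F} (hd : ψ d = 1) {m : ℕ} (hm : qdg p d = m)
    {c : Pic p F} (hc : ψ c ≠ 1) : ∑ i ∈ Finset.range m, bs p ψ i = 0 := by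
  have hper := bs_per p hd hm
  let W : ℤ → ℂ := fun k => ∑ i ∈ Finset.range m, bs p ψ (k + i)
  have hW : Function.Periodic W 1 := by
    intro k
    change ∑ i ∈ Finset.range m, bs p ψ (k + 1 + i) = ∑ i ∈ Finset.range m, bs p ψ (k + i)
    rw [← add_right_cancel_iff (a := bs p ψ (k + (0 : ℕ)))]
    have h1 : ∀ i : ℕ, bs p ψ (k + 1 + i) = bs p ψ (k + (i + 1 : ℕ)) := fun i => by
      congr 1; push_cast; ring
    simp_rw [h1]
    rw [← Finset.sum_range_succ' (fun i : ℕ => bs p ψ (k + i)), Finset.sum_range_succ, hper]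
    simp
  have h2 : W (0 + qdg p c) = ψ c * W 0 := by
    change ∑ i ∈ Finset.range m, bs p ψ (0 + qdg p c + i) = ψ c * ∑ i ∈ Finset.range m, bs p ψ (0 + i)
    rw [Finset.mul_sum]
    refine Finset.sum_congr rfl fun i _ => ?_
    rw [← bs_add]
    congr 1; ring
  have h3 : W (0 + qdg p c) = W 0 := by
    have := hW.int_mul (qdg p c) 0
    simpa using this
  rw [h3] at h2
  have h4 : W 0 = 0 := by
    have : (ψ c - 1) * W 0 = 0 := by linear_combination -h2
    rcases mul_eq_zero.1 this with h5 | h5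
    · exact absurd (sub_eq_zero.1 h5) hc
    · exact h5
  simpa [W] using h4

/-- effective divisors of degree `n` -/
def effF (n : ℕ) : Finset (FFPrime F →₀ ℕ) :=
  ((eff_finite p n).subset (fun (A : FFPrime F →₀ ℕ) (h : A ∈ {A : FFPrime F →₀ ℕ | ndeg p A = n}) =>
    (show ndeg p A ≤ n from le_of_eq h))).toFinset

theorem mem_effF {n : ℕ} {A : FFPrime F →₀ ℕ} : A ∈ effF p n ↔ ndeg p A = n := by simp [effF]

/-- class of an effective divisor -/
def cl (A : FFPrime F →₀ ℕ) : Pic p F := QuotientAddGroup.mk (ofNat A)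

theorem qdg_cl (A : FFPrime F →₀ ℕ) : qdg p (cl p A) = ndeg p A := by
  unfold cl; rw [qdg_mk, dg_ofNat]

theorem cl_add (A B : FFPrime F →₀ ℕ) : cl p (A + B) = cl p A + cl p B := by
  unfold cl; rw [ofNat_add]; rfl

/-- coefficient of the L-series -/
def as (ψ : AddChar (Pic p F) ℂ) (n : ℕ) : ℂ := ∑ A ∈ effF p n, ψ (cl p A)

theorem as_eq : ∃ (e : ℤ) (n0 : ℕ), ∀ (ψ : AddChar (Pic p F) ℂ) (n : ℕ), n0 ≤ n →
    as p ψ n = ((p : ℂ) ^ e * p ^ n - 1) / (wc p F) * bs p ψ n := by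
  classical
  obtain ⟨e, n0, he⟩ := riemann p (F := F)
  refine ⟨e, n0, fun ψ n hn => ?_⟩
  have hmaps : ∀ A ∈ effF p n, cl p A ∈ picF (F := F) p n := by
    intro A hA
    rw [mem_effF] at hA
    rw [mem_picF, qdg_cl, hA]
  unfold as bs
  rw [← Finset.sum_fiberwise_of_maps_to hmaps, Finset.mul_sum]
  refine Finset.sum_congr rfl fun c hc => ?_
  rw [Finset.sum_congr rfl (g := fun _ => ψ c) (fun A hA => by rw [(Finset.mem_filter.1 hA).2]), Finset.sum_const,
    nsmul_eq_mul]
  congr 1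
  obtain ⟨D, rfl⟩ := QuotientAddGroup.mk_surjective c
  rw [mem_picF, qdg_mk] at hc
  have h1 : ∀ A : FFPrime F →₀ ℕ, ofNat A - D ∈ Prin p ↔ cl p A = QuotientAddGroup.mk D := by
    intro A
    unfold cl
    rw [eq_comm, QuotientAddGroup.eq, neg_add_eq_sub]
  have h2 : (Finset.filter (fun A => cl p A = QuotientAddGroup.mk D) (effF p n)).card
      = Nat.card {A : FFPrime F →₀ ℕ // ofNat A - D ∈ Prin p} := by
    rw [Nat.subtype_card]
    intro A
    rw [Finset.mem_filter, h1]
    refine ⟨fun h => h.2, fun h => ⟨?_, h⟩⟩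
    rw [mem_effF]
    have := qdg_cl p A
    rw [h, qdg_mk, hc] at this
    exact_mod_cast this.symm
  rw [h2]
  have h3 := card_class p D
  have h4 := he D (by rw [hc]; exact_mod_cast hn)
  have hw : (wc p F : ℂ) ≠ 0 := by exact_mod_cast (wc_pos p (F := F)).ne'
  rw [eq_div_iff hw]
  have h5 : ((p : ℂ) ^ e * p ^ n) = p ^ ell p D := by
    have hp0 : (p : ℂ) ≠ 0 := by exact_mod_cast hp.out.ne_zero
    rw [← zpow_natCast, ← zpow_natCast, h4, hc, ← zpow_add₀ hp0, add_comm]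
  rw [h5]
  have h6 : ((Nat.card {A : FFPrime F →₀ ℕ // ofNat A - D ∈ Prin p} * wc p F + 1 : ℕ) : ℂ) = (p ^ ell p D : ℕ) := by
    rw [h3]
  push_cast at h6
  linear_combination h6

end Zeta

set_option autoImplicit false
set_option linter.all false

namespace Euler
open Filter Topology
variable {ι : Type} {F : (ι →₀ ℕ) → ℂ}

open Classical in
theorem tsum_step (hmul : ∀ A B, F (A + B) = F A * F B) (hs : Summable F) (B : Finset ι) :
    (∏ i ∈ B, (1 - F (Finsupp.single i 1))) * ∑' A, F A = ∑' A, (if ∀ i ∈ B, A i = 0 then F A else 0) := by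
  induction B using Finset.induction_on with
  | empty => simp
  | insert k B hk ih =>
    rw [Finset.prod_insert hk, mul_assoc, ih]
    have hsB : ∀ (C : (ι →₀ ℕ) → Prop) [DecidablePred C], Summable (fun A => if C A then F A else 0) := fun C _ =>
      (hs.indicator {A | C A}).congr fun A => by simp [Set.indicator_apply]
    have h1 : ∑' A : ι →₀ ℕ, (if (∀ i ∈ B, A i = 0) ∧ A k ≠ 0 then F A else 0)
        = F (Finsupp.single k 1) * ∑' A : ι →₀ ℕ, (if ∀ i ∈ B, A i = 0 then F A else 0) := by
      have hinj : Function.Injective (fun A : ι →₀ ℕ => A + Finsupp.single k 1) := add_left_injective _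
      rw [← hinj.tsum_eq, ← tsum_mul_left]
      · refine tsum_congr fun A => ?_
        have h2 : (∀ i ∈ B, (A + Finsupp.single k 1 : ι →₀ ℕ) i = 0) ↔ (∀ i ∈ B, A i = 0) := by
          refine forall₂_congr fun i hi => ?_
          rw [Finsupp.add_apply, Finsupp.single_eq_of_ne (by rintro rfl; exact hk hi), add_zero]
        have h3 : (A + Finsupp.single k 1 : ι →₀ ℕ) k ≠ 0 := by simp
        simp only [h2, h3, ne_eq, not_false_eq_true, and_true]
        split_ifs
        · rw [hmul, mul_comm]
        · rw [mul_zero]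
      · intro A hA
        rw [Function.mem_support] at hA
        have hAk : A k ≠ 0 := by
          by_contra h
          exact hA (if_neg (fun h' => h'.2 h))
        refine ⟨A - Finsupp.single k 1, ?_⟩
        change A - Finsupp.single k 1 + Finsupp.single k 1 = A
        refine tsub_add_cancel_of_le ?_
        rw [Finsupp.single_le_iff]
        omega
    rw [sub_mul, one_mul, ← h1, ← Summable.tsum_sub (hsB (fun A => ∀ i ∈ B, A i = 0)) (hsB (fun A => (∀ i ∈ B, A i = 0) ∧ A k ≠ 0))]
    refine tsum_congr fun A => ?_
    simp only [Finset.forall_mem_insert]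
    by_cases h2 : ∀ i ∈ B, A i = 0
    · by_cases h3 : A k = 0 <;> simp [h2, h3]
    · simp [h2]

theorem tendsto_prod (hmul : ∀ A B, F (A + B) = F A * F B) (h0 : F 0 = 1) (hs : Summable (fun A => ‖F A‖)) :
    ∑' A, F A ≠ 0 ∧
    Tendsto (fun B : Finset ι => ∏ i ∈ B, (1 - F (Finsupp.single i 1))) atTop (𝓝 (∑' A, F A)⁻¹) := by
  classical
  have hsF : Summable F := Summable.of_norm (f := F) hs
  have h1 : Tendsto (fun B : Finset ι => ∑' A, (if ∀ i ∈ B, A i = 0 then F A else 0)) atTop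
      (𝓝 (∑' A : ι →₀ ℕ, if A = 0 then (1 : ℂ) else 0)) := by
    refine tendsto_tsum_of_dominated_convergence (G := ℂ) (bound := fun A => ‖F A‖) hs ?_ ?_
    · intro A
      by_cases hA : A = 0
      · subst hA; simp [h0]
      · rw [if_neg hA]
        obtain ⟨i, hi⟩ := Finsupp.ne_iff.1 hA
        apply tendsto_const_nhds.congr'
        filter_upwards [eventually_ge_atTop {i}] with B hB
        rw [if_neg]
        intro h
        exact hi (h i (hB (Finset.mem_singleton_self i)))
    · refine Eventually.of_forall fun B A => ?_
      split_ifs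
      · exact le_rfl
      · simp
  rw [tsum_ite_eq] at h1
  have h2 : ∀ B : Finset ι, ∑' A, (if ∀ i ∈ B, A i = 0 then F A else 0)
      = (∏ i ∈ B, (1 - F (Finsupp.single i 1))) * ∑' A, F A := fun B => (by
      rw [tsum_step hmul hsF])
  simp_rw [h2] at h1
  have hne : ∑' A, F A ≠ 0 := by
    intro h
    simp_rw [h, mul_zero] at h1
    exact zero_ne_one (tendsto_nhds_unique tendsto_const_nhds h1)
  refine ⟨hne, ?_⟩
  have h3 := h1.mul_const (∑' A, F A)⁻¹
  simp_rw [mul_assoc, mul_inv_cancel₀ hne, mul_one, one_mul] at h3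
  exact h3

end Euler

namespace Zeta
open FFPrime Dv Filter Topology
variable (p : ℕ) [hp : Fact p.Prime] {F : Type} [Field F] [Algebra (ZMod p) F] [hF : FFld p F]

theorem formula {ψ : AddChar (Pic p F) ℂ} {B : ℝ} (hB0 : 0 ≤ B) (hB : ∀ k, ‖bs p ψ k‖ ≤ B) :
    ∃ c : ℝ, 0 < c ∧ ∃ C : ℝ, ∀ s : ℝ, 0 ≤ s → s < 1 → Summable (fun n : ℕ => as p ψ n * ((s / p : ℝ) : ℂ) ^ n) ∧
      ‖∑' n : ℕ, as p ψ n * ((s / p : ℝ) : ℂ) ^ n - c * ∑' n : ℕ, (s : ℂ) ^ n * bs p ψ n‖ ≤ C := by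
  obtain ⟨e, n0, h⟩ := as_eq p (F := F)
  have hw : (0 : ℝ) < wc p F := by exact_mod_cast wc_pos p (F := F)
  have hp0 : (2 : ℝ) ≤ p := by exact_mod_cast hp.out.two_le
  have hpC : (p : ℂ) ≠ 0 := by exact_mod_cast hp.out.ne_zero
  set dl : ℕ → ℂ := fun n => as p ψ n - ((p : ℂ) ^ e * p ^ n - 1) / (wc p F) * bs p ψ n
  have hdl : ∀ n, n ∉ Finset.range n0 → dl n = 0 := by
    intro n hn
    rw [Finset.mem_range] at hn
    exact sub_eq_zero.2 (h ψ n (by omega))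
  refine ⟨((p : ℝ) ^ e / wc p F : ℝ), by positivity, (wc p F : ℝ)⁻¹ * (B / (1 - 1/2)) + ∑ n ∈ Finset.range n0, ‖dl n‖, ?_⟩
  intro s hs0 hs1
  set u : ℝ := s / p
  have hu0 : 0 ≤ u := by positivity
  have hu2 : u ≤ 1 / 2 := by
    rw [div_le_iff₀ (by linarith)]; nlinarith
  have hu1 : u < 1 := by linarith
  have e1 : ∀ n, as p ψ n * (u : ℂ) ^ n = (((p : ℝ) ^ e / wc p F : ℝ) : ℂ) * ((s : ℂ) ^ n * bs p ψ n)
      - (wc p F : ℂ)⁻¹ * ((u : ℂ) ^ n * bs p ψ n) + dl n * (u : ℂ) ^ n := by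
    intro n
    have hsu : (s : ℂ) ^ n = p ^ n * (u : ℂ) ^ n := by
      rw [← mul_pow]
      congr 1
      simp only [u]
      push_cast
      field_simp
    rw [hsu]
    simp only [dl]
    push_cast
    ring
  have s1 := (PerSer.summ hB hs0 hs1).mul_left (((p : ℝ) ^ e / wc p F : ℝ) : ℂ)
  have s2 := (PerSer.summ hB hu0 hu1).mul_left (wc p F : ℂ)⁻¹
  have s3 : Summable (fun n => dl n * (u : ℂ) ^ n) := by
    apply summable_of_ne_finset_zero (s := Finset.range n0)
    intro n hn
    rw [hdl n hn, zero_mul]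
  have s4 : Summable (fun n : ℕ => as p ψ n * (u : ℂ) ^ n) := by
    simp_rw [e1]
    exact (s1.sub s2).add s3
  refine ⟨s4, ?_⟩
  simp_rw [e1]
  rw [Summable.tsum_add (s1.sub s2) s3, Summable.tsum_sub s1 s2, tsum_mul_left, tsum_mul_left]
  have e2 : ∀ x y z : ℂ, x - y + z - x = - y + z := fun x y z => by ring
  rw [e2]
  refine (norm_add_le _ _).trans (add_le_add ?_ ?_)
  · rw [norm_neg, norm_mul, norm_inv, Complex.norm_natCast]
    refine mul_le_mul_of_nonneg_left ((PerSer.norm_le hB hu0 hu1).trans ?_) (by positivity)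
    exact div_le_div_of_nonneg_left hB0 (by norm_num) (by linarith)
  · rw [tsum_eq_sum (s := Finset.range n0) (fun n hn => by rw [hdl n hn, zero_mul])]
    refine (norm_sum_le _ _).trans (Finset.sum_le_sum fun n _ => ?_)
    rw [norm_mul, norm_pow, Complex.norm_real, Real.norm_of_nonneg hu0]
    exact mul_le_of_le_one_right (norm_nonneg _) (pow_le_one₀ hu0 hu1.le)

/-- there is a class of positive degree -/
theorem exists_pos : ∃ (d : Pic p F) (m : ℕ), 0 < m ∧ qdg p d = m := by
  obtain ⟨w⟩ := exists_place p F
  exact ⟨QuotientAddGroup.mk (Finsupp.single w 1), w.deg p, w.deg_pos p, by rw [qdg_mk, dg_single]; simp⟩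

theorem summable_pow {s : ℝ} (h0 : 0 ≤ s) (h1 : s < 1) :
    Summable (fun A : FFPrime F →₀ ℕ => (s / p) ^ ndeg p A) := by
  obtain ⟨d, m, hm, hd⟩ := exists_pos p (F := F)
  have hper := bs_per p (ψ := 1) (d := d) rfl hd
  obtain ⟨B, hB0, hB⟩ := PerSer.bdd hm hper
  obtain ⟨c, hc, C, hC⟩ := formula p hB0 hB
  have h2 := (hC s h0 h1).1.norm
  have hu : 0 ≤ s / p := by positivity
  rw [← (Equiv.sigmaFiberEquiv (ndeg p (F := F))).summable_iff, summable_sigma_of_nonneg (fun x => by simp only [Function.comp]; positivity)]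
  have hfin : ∀ n, Finite {A : FFPrime F →₀ ℕ // ndeg p A = n} := fun n =>
    Set.Finite.to_subtype ((effF p n).finite_toSet.subset (fun A hA => (mem_effF p).2 hA))
  refine ⟨fun n => ?_, ?_⟩
  · have := hfin n
    exact Summable.of_finite
  · refine h2.congr fun n => ?_
    have h3 : ∀ x : {A : FFPrime F →₀ ℕ // ndeg p A = n}, ((fun A => (s / p) ^ ndeg p A) ∘ (Equiv.sigmaFiberEquiv (ndeg p (F := F)))) ⟨n, x⟩ = (s/p) ^ n := by
      intro x
      simp only [Function.comp, Equiv.sigmaFiberEquiv_apply, x.2]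
    simp_rw [h3]
    have h4 : as p (1 : AddChar (Pic p F) ℂ) n = (effF (F := F) p n).card := by simp [as]
    have h5 : Nat.card {A : FFPrime F →₀ ℕ // ndeg p A = n} = (effF (F := F) p n).card :=
      Nat.subtype_card _ (fun A => mem_effF p)
    rw [tsum_const, h5, h4, norm_mul, norm_pow, Complex.norm_natCast, Complex.norm_real, Real.norm_of_nonneg hu, nsmul_eq_mul]

/-- term of the L-series -/
def tm (ψ : AddChar (Pic p F) ℂ) (u : ℝ) (A : FFPrime F →₀ ℕ) : ℂ := ψ (cl p A) * (u : ℂ) ^ ndeg p A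

/-- L-series -/
def Ls (ψ : AddChar (Pic p F) ℂ) (u : ℝ) : ℂ := ∑' A, tm p ψ u A

theorem tm_add (ψ : AddChar (Pic p F) ℂ) (u : ℝ) (A B : FFPrime F →₀ ℕ) : tm p ψ u (A + B) = tm p ψ u A * tm p ψ u B := by
  unfold tm
  rw [cl_add, map_add (ndeg p), AddChar.map_add_eq_mul, pow_add]; ring

theorem tm_zero (ψ : AddChar (Pic p F) ℂ) (u : ℝ) : tm p ψ u 0 = 1 := by
  unfold tm
  have : cl p (0 : FFPrime F →₀ ℕ) = 0 := by unfold cl; rw [ofNat_zero]; rfl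
  rw [this, map_zero (ndeg p), AddChar.map_zero_eq_one]; simp

theorem summable_tm {ψ : AddChar (Pic p F) ℂ} (hψ : ∀ c, ‖ψ c‖ = 1) {s : ℝ} (h0 : 0 ≤ s) (h1 : s < 1) :
    Summable (fun A => ‖tm p ψ (s / p) A‖) := by
  refine (summable_pow p h0 h1).congr fun A => ?_
  unfold tm
  rw [norm_mul, hψ, one_mul, norm_pow, Complex.norm_real, Real.norm_of_nonneg (by positivity)]

theorem Ls_eq {ψ : AddChar (Pic p F) ℂ} (hψ : ∀ c, ‖ψ c‖ = 1) {s : ℝ} (h0 : 0 ≤ s) (h1 : s < 1) :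
    Ls p ψ (s / p) = ∑' n : ℕ, as p ψ n * ((s / p : ℝ) : ℂ) ^ n := by
  have h := (summable_tm p hψ h0 h1).of_norm.hasSum.tsum_fiberwise (ndeg p (F := F))
  unfold Ls
  rw [← h.tsum_eq]
  refine tsum_congr fun n => ?_
  have h2 : (ndeg p (F := F)) ⁻¹' {n} = (effF (F := F) p n : Set (FFPrime F →₀ ℕ)) := by
    ext A; simp [mem_effF]
  rw [h2, Finset.tsum_subtype' (effF p n) (tm p ψ (s/p))]
  unfold as
  rw [Finset.sum_mul]
  refine Finset.sum_congr rfl fun A hA => ?_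
  rw [mem_effF] at hA
  unfold tm
  rw [hA]

theorem Ls_bdd {ψ : AddChar (Pic p F) ℂ} (hψ : ∀ c, ‖ψ c‖ = 1) {d : Pic p F} (hd : ψ d = 1) {m : ℕ} (hm0 : 0 < m)
    (hm : qdg p d = m) {c : Pic p F} (hc : ψ c ≠ 1) : ∃ C : ℝ, ∀ s : ℝ, 0 ≤ s → s < 1 → ‖Ls p ψ (s / p)‖ ≤ C := by
  have hper := bs_per p hd hm
  obtain ⟨B, hB0, hB⟩ := PerSer.bdd hm0 hper
  obtain ⟨c', hc', C, hC⟩ := formula p hB0 hB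
  refine ⟨C + c' * (m * B), fun s h0 h1 => ?_⟩
  rw [Ls_eq p hψ h0 h1]
  have h2 := (hC s h0 h1).2
  have h3 := PerSer.bdd_zero hm0 hper hB (bs_zero p hd hm hc) h0 h1
  have h4 := norm_le_norm_sub_add (∑' n : ℕ, as p ψ n * ((s / p : ℝ) : ℂ) ^ n) (c' * ∑' n : ℕ, (s : ℂ) ^ n * bs p ψ n)
  refine h4.trans (add_le_add h2 ?_)
  rw [norm_mul, Complex.norm_real, Real.norm_of_nonneg hc'.le]
  exact mul_le_mul_of_nonneg_left h3 hc'.le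

theorem Ls_one (F : Type) [Field F] [Algebra (ZMod p) F] [FFld p F] : ∃ C C' : ℝ, ∃ c > 0, ∀ s : ℝ, 0 ≤ s → s < 1 →
    ‖Ls p (1 : AddChar (Pic p F) ℂ) (s / p)‖ ≤ C / (1 - s) ∧
    c / (1 - s) - C' ≤ ‖Ls p (1 : AddChar (Pic p F) ℂ) (s / p)‖ := by
  obtain ⟨d, m, hm, hd⟩ := exists_pos p (F := F)
  have hper := bs_per p (ψ := 1) (d := d) rfl hd
  obtain ⟨B, hB0, hB⟩ := PerSer.bdd hm hper
  obtain ⟨c, hc, C, hC⟩ := formula p hB0 hB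
  have hm' : (0:ℝ) < m := by exact_mod_cast hm
  have hC0 : 0 ≤ C := (norm_nonneg _).trans (hC 0 le_rfl one_pos).2
  refine ⟨C + c * B, C, c / m, by positivity, fun s h0 h1 => ?_⟩
  rw [Ls_eq p (fun c => by simp) h0 h1]
  have h2 := (hC s h0 h1).2
  have h3 := PerSer.norm_le hB h0 h1
  have h1s : 0 < 1 - s := by linarith
  set X := ∑' n : ℕ, as p (1 : AddChar (Pic p F) ℂ) n * ((s / p : ℝ) : ℂ) ^ n
  set S := ∑' n : ℕ, (s : ℂ) ^ n * bs p (1 : AddChar (Pic p F) ℂ) n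
  have hn : ‖(c : ℂ) * S‖ = c * ‖S‖ := by rw [norm_mul, Complex.norm_real, Real.norm_of_nonneg hc.le]
  constructor
  · have h4 := norm_le_norm_sub_add X (c * S)
    rw [hn] at h4
    have h5 : C ≤ C / (1 - s) := by
      rw [le_div_iff₀ h1s]; nlinarith
    calc _ ≤ C / (1 - s) + c * (B / (1 - s)) := h4.trans (add_le_add (h2.trans h5) (mul_le_mul_of_nonneg_left h3 hc.le))
      _ = _ := by ring
  · have h6 := PerSer.lower hm hper hB (c := fun k => (picF (F := F) p k).card) (fun k => by simp [bs])
      (Finset.card_pos.2 ⟨0, (mem_picF p).2 (map_zero _)⟩) h0 h1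
    have h4 := norm_le_norm_sub_add ((c : ℂ) * S) X
    rw [hn, norm_sub_rev] at h4
    have h7 : c / m / (1 - s) = c * (1 / (m * (1 - s))) := by field_simp
    rw [h7]
    have := mul_le_mul_of_nonneg_left h6 hc.le
    linarith

theorem Ls_euler {ψ : AddChar (Pic p F) ℂ} (hψ : ∀ c, ‖ψ c‖ = 1) {s : ℝ} (h0 : 0 ≤ s) (h1 : s < 1) :
    Ls p ψ (s / p) ≠ 0 ∧ Tendsto (fun B : Finset (FFPrime F) => ∏ w ∈ B,
      (1 - ψ (QuotientAddGroup.mk (Finsupp.single w 1)) * ((s / p : ℝ) : ℂ) ^ w.deg p)) atTop (𝓝 (Ls p ψ (s / p))⁻¹) := by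
  have h := Euler.tendsto_prod (tm_add p ψ (s / p)) (tm_zero p ψ (s / p)) (summable_tm p hψ h0 h1)
  refine ⟨h.1, ?_⟩
  have h2 : ∀ w : FFPrime F, tm p ψ (s / p) (Finsupp.single w 1) =
      ψ (QuotientAddGroup.mk (Finsupp.single w 1)) * ((s / p : ℝ) : ℂ) ^ w.deg p := by
    intro w
    unfold tm cl
    rw [ofNat_single, ndeg_single, one_mul]
    simp
  have h3 := h.2
  simp_rw [h2] at h3
  exact h3

end Zeta

set_option autoImplicit false
set_option linter.all false

namespace Kum
theorem card_chars' {G : Type} [AddCommGroup G] [Finite G] : Nat.card (AddChar G ℂ) = Nat.card G := by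
  classical
  haveI := Fintype.ofFinite G
  rw [Nat.card_eq_fintype_card, Nat.card_eq_fintype_card, AddChar.card_eq]

theorem card_chars {G : Type} [AddCommGroup G] [Finite G] [Fintype (AddChar G ℂ)] : Fintype.card (AddChar G ℂ) = Nat.card G := by
  rw [← card_chars', Nat.card_eq_fintype_card]

theorem loc_ineq {G : Type} [AddCommGroup G] [Finite G] [Fintype (AddChar G ℂ)] {q : ℕ} (hq : q.Prime) (g : G) (hg : q • g = 0) {X : ℝ} (h0 : 0 ≤ X) (h1 : X < 1) :
    (∏ χ : AddChar G ℂ, ‖1 - χ g * (X : ℂ)‖) ^ q ≤ (1 - X ^ q) ^ Nat.card G := by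
  classical
  have hcard : Fintype.card (AddChar G ℂ) = Nat.card G := card_chars
  have hX1 : X ^ q ≤ X := pow_le_of_le_one h0 h1.le hq.ne_zero
  by_cases hg0 : g = 0
  · subst hg0
    have hn : ∀ χ : AddChar G ℂ, ‖1 - χ 0 * (X : ℂ)‖ = 1 - X := by
      intro χ
      rw [AddChar.map_zero_eq_one, one_mul]
      have : (1 : ℂ) - X = ((1 - X : ℝ) : ℂ) := by push_cast; rfl
      rw [this, Complex.norm_real, Real.norm_of_nonneg (by linarith)]
    simp_rw [hn]
    rw [Finset.prod_const, Finset.card_univ, hcard, ← pow_mul, mul_comm, pow_mul]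
    refine pow_le_pow_left₀ (by apply pow_nonneg; linarith) ?_ _
    have : (1 - X) ^ q ≤ 1 - X := pow_le_of_le_one (by linarith) (by linarith) hq.ne_zero
    linarith
  · obtain ⟨χ0, hχ0⟩ := AddChar.exists_apply_ne_zero.2 hg0
    have hω : IsPrimitiveRoot (χ0 g) q := by
      have : (χ0 g) ^ q = 1 := by rw [← AddChar.map_nsmul_eq_pow, hg, AddChar.map_zero_eq_one]
      have h2 := orderOf_eq_prime (p := q) (hp := ⟨hq⟩) this hχ0
      rw [← h2]; exact IsPrimitiveRoot.orderOf _
    have hsw : ∀ ξ ∈ Polynomial.nthRootsFinset q (1 : ℂ), ∏ χ : AddChar G ℂ, (1 - ξ * (χ g * (X : ℂ))) = ∏ χ : AddChar G ℂ, (1 - χ g * (X : ℂ)) := by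
      intro ξ hξ
      rw [Polynomial.mem_nthRootsFinset hq.pos] at hξ
      haveI : NeZero q := ⟨hq.ne_zero⟩
      obtain ⟨k, hk, rfl⟩ := hω.eq_pow_of_pow_eq_one hξ
      refine Fintype.prod_equiv (Equiv.mulLeft (χ0 ^ k)) _ _ fun χ => ?_
      simp only [Equiv.coe_mulLeft, AddChar.mul_apply, AddChar.pow_apply, mul_assoc]
    have hprod : (∏ χ : AddChar G ℂ, (1 - χ g * (X : ℂ))) ^ q = (1 - (X : ℂ) ^ q) ^ Nat.card G := by
      have h2 : ∏ ξ ∈ Polynomial.nthRootsFinset q (1 : ℂ), ∏ χ : AddChar G ℂ, (1 - ξ * (χ g * (X : ℂ)))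
          = (∏ χ : AddChar G ℂ, (1 - χ g * (X : ℂ))) ^ q := by
        rw [Finset.prod_congr rfl hsw, Finset.prod_const, hω.card_nthRootsFinset]
      rw [← h2, Finset.prod_comm]
      have h3 : ∀ χ : AddChar G ℂ, ∏ ξ ∈ Polynomial.nthRootsFinset q (1 : ℂ), (1 - ξ * (χ g * (X : ℂ))) = 1 - (X : ℂ) ^ q := by
        intro χ
        rw [← hω.pow_sub_pow_eq_prod_sub_mul _ _ hq.pos, one_pow, mul_pow, ← AddChar.map_nsmul_eq_pow, hg, AddChar.map_zero_eq_one, one_mul]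
      simp_rw [h3]
      rw [Finset.prod_const, Finset.card_univ, hcard]
    rw [← norm_prod, ← norm_pow, hprod, norm_pow]
    have : (1 : ℂ) - (X : ℂ) ^ q = ((1 - X ^ q : ℝ) : ℂ) := by push_cast; rfl
    rw [this, Complex.norm_real, Real.norm_of_nonneg (by linarith)]

theorem growth {c C' K : ℝ} (hc : 0 < c) {I q : ℕ} (h : ∀ T : ℝ, 1 ≤ T → (c * T - C') ≤ 0 ∨ (c * T - C') ^ I ≤ K * T ^ q) : I ≤ q := by
  by_contra hlt
  push Not at hlt
  have hci : 0 < (c / 2) ^ I := by positivity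
  set T : ℝ := max 1 (max (2 * C' / c + 1) (K / (c / 2) ^ I + 1))
  have h1 : 1 ≤ T := le_max_left _ _
  have h2 : 2 * C' / c + 1 ≤ T := (le_max_left _ _).trans (le_max_right _ _)
  have h3 : K / (c / 2) ^ I + 1 ≤ T := (le_max_right _ _).trans (le_max_right _ _)
  have h4 : 2 * C' + c ≤ c * T := by
    have := mul_le_mul_of_nonneg_left h2 hc.le
    rwa [mul_add, mul_one, mul_div_cancel₀ _ hc.ne'] at this
  have h5 : K + (c / 2) ^ I ≤ (c / 2) ^ I * T := by
    have := mul_le_mul_of_nonneg_left h3 hci.le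
    rwa [mul_add, mul_one, mul_div_cancel₀ _ hci.ne'] at this
  have h6 : c / 2 * T ≤ c * T - C' := by linarith
  have h7 : 0 < c / 2 * T := by positivity
  rcases h T h1 with h8 | h8
  · linarith
  have h9 : (c / 2 * T) ^ I ≤ K * T ^ q := (pow_le_pow_left₀ h7.le h6 _).trans h8
  have h10 : T ^ (q + 1) ≤ T ^ I := pow_le_pow_right₀ h1 hlt
  rw [mul_pow] at h9
  have h11 : (c / 2) ^ I * T ^ (q + 1) ≤ K * T ^ q := (mul_le_mul_of_nonneg_left h10 hci.le).trans h9
  rw [pow_succ', ← mul_assoc] at h11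
  have h12 := le_of_mul_le_mul_right h11 (by positivity)
  linarith

open FFPrime Dv Zeta Filter Topology
variable {q : ℕ} {L M : Type} [Field L] [Field M] [Algebra L M] (κ : Kum q L M)
variable (p : ℕ) [Fact p.Prime] [Algebra (ZMod p) L] [Algebra (ZMod p) M] [IsScalarTower (ZMod p) L M]
variable [Algebra.IsAlgebraic L M]
variable [FFld p L] [FFld p M]

/-- principal divisors together with norms -/
def H : AddSubgroup (Dv L) := Prin p ⊔ (κ.N p).range

theorem Prin_le_H : Prin p ≤ κ.H p := (le_sup_left : Prin p ≤ Prin p ⊔ (κ.N p).range)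
theorem N_mem_H (D : Dv M) : κ.N p D ∈ κ.H p := (le_sup_right : (κ.N p).range ≤ Prin p ⊔ (κ.N p).range) ⟨D, rfl⟩
theorem q_mem_H (D : Dv L) : q • D ∈ κ.H p := by rw [← κ.N_j p]; exact κ.N_mem_H p _

/-- projection from the class group -/
def toG : Pic p L →+ Dv L ⧸ κ.H p := QuotientAddGroup.map (Prin p) (κ.H p) (AddMonoidHom.id _) (κ.Prin_le_H p)

theorem toG_mk (D : Dv L) : κ.toG p (QuotientAddGroup.mk D) = QuotientAddGroup.mk D := rfl

theorem finite_G : Finite (Dv L ⧸ κ.H p) := by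
  obtain ⟨P⟩ := exists_place p L
  have hP := P.deg_pos p
  set m : ℤ := dg p (q • Finsupp.single P 1) with hm
  have hm0 : 0 < m := by
    rw [hm, map_nsmul, dg_single, nsmul_eq_mul]
    have := κ.hq.pos
    positivity
  have hfin : (⋃ n ∈ Finset.Ico 0 m, {c : Pic p L | qdg p c = n}).Finite :=
    Set.Finite.biUnion (Finset.finite_toSet _) fun n _ => pic_finite p n
  refine Set.finite_univ_iff.1 ((hfin.image (κ.toG p)).subset ?_)
  intro g _
  obtain ⟨D, rfl⟩ := QuotientAddGroup.mk_surjective g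
  refine ⟨QuotientAddGroup.mk (D - (dg p D / m) • (q • Finsupp.single P 1)), ?_, ?_⟩
  · simp only [Set.mem_iUnion]
    refine ⟨dg p D % m, ?_, ?_⟩
    · rw [Finset.mem_Ico]; exact ⟨Int.emod_nonneg _ hm0.ne', Int.emod_lt_of_pos _ hm0⟩
    · change qdg p _ = _
      rw [qdg_mk, map_sub, map_zsmul, ← hm, smul_eq_mul, Int.emod_def, mul_comm]
  · rw [toG_mk, QuotientAddGroup.eq]
    have : -(D - (dg p D / m) • (q • Finsupp.single P 1)) + D = (dg p D / m) • (q • Finsupp.single P 1) := by abel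
    rw [this]
    exact AddSubgroup.zsmul_mem _ (κ.q_mem_H p _) _

theorem fib_prod (P : FFPrime L) {u : ℝ} :
    (κ.split p P → ∏ w ∈ (κ.fibre_finite p P).toFinset, (1 - u ^ w.deg p) = (1 - u ^ P.deg p) ^ q) ∧
    (¬ κ.split p P → ∏ w ∈ (κ.fibre_finite p P).toFinset, (1 - u ^ w.deg p) = 1 - (u ^ P.deg p) ^ q) := by
  constructor
  · intro h
    rw [Finset.prod_congr rfl (g := fun _ => 1 - u ^ P.deg p), Finset.prod_const, κ.fibre_split_card p h]
    intro w hw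
    rw [Set.Finite.mem_toFinset] at hw
    rw [κ.deg_split p h hw]
  · intro h
    have : (κ.fibre_finite p P).toFinset = {κ.sec p P} := by
      ext w
      rw [Set.Finite.mem_toFinset, Finset.mem_singleton]
      constructor
      · exact fun hw => κ.fibre_inert p h hw
      · rintro rfl; exact κ.res_sec p P
    rw [this, Finset.prod_singleton, κ.deg_inert p h, ← pow_mul, mul_comm]

theorem loc_fib [Finite (Dv L ⧸ κ.H p)] [Fintype (AddChar (Dv L ⧸ κ.H p) ℂ)] (P : FFPrime L) {u : ℝ} (h0 : 0 ≤ u) (h1 : u < 1) :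
    (∏ χ : AddChar (Dv L ⧸ κ.H p) ℂ, ‖1 - χ (QuotientAddGroup.mk (Finsupp.single P 1)) * (u : ℂ) ^ P.deg p‖) ^ q
      ≤ (∏ w ∈ (κ.fibre_finite p P).toFinset, (1 - u ^ w.deg p)) ^ Nat.card (Dv L ⧸ κ.H p) := by
  have hX0 : 0 ≤ u ^ P.deg p := by positivity
  have hX1 : u ^ P.deg p < 1 := pow_lt_one₀ h0 h1 (P.deg_pos p).ne'
  by_cases h : κ.split p P
  · rw [(κ.fib_prod p P).1 h]
    have hz : (QuotientAddGroup.mk (Finsupp.single P 1) : Dv L ⧸ κ.H p) = 0 := by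
      rw [QuotientAddGroup.eq_zero_iff, ← κ.N_single_split p h]
      exact κ.N_mem_H p _
    rw [hz]
    have hn : ∀ χ : AddChar (Dv L ⧸ κ.H p) ℂ, ‖1 - χ 0 * (u : ℂ) ^ P.deg p‖ = 1 - u ^ P.deg p := by
      intro χ
      rw [AddChar.map_zero_eq_one, one_mul]
      have : (1 : ℂ) - (u : ℂ) ^ P.deg p = ((1 - u ^ P.deg p : ℝ) : ℂ) := by push_cast; rfl
      rw [this, Complex.norm_real, Real.norm_of_nonneg (by linarith)]
    simp_rw [hn]
    rw [Finset.prod_const, Finset.card_univ, card_chars, ← pow_mul, ← pow_mul, mul_comm]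
  · rw [(κ.fib_prod p P).2 h]
    have := loc_ineq κ.hq (QuotientAddGroup.mk (Finsupp.single P 1) : Dv L ⧸ κ.H p) (by
      rw [← QuotientAddGroup.mk_nsmul, QuotientAddGroup.eq_zero_iff]
      exact κ.q_mem_H p _) hX0 hX1
    push_cast at this
    exact this

theorem zeta_ineq [Finite (Dv L ⧸ κ.H p)] [Fintype (AddChar (Dv L ⧸ κ.H p) ℂ)] {s : ℝ} (h0 : 0 ≤ s) (h1 : s < 1) :
    ‖Ls p (1 : AddChar (Pic p M) ℂ) (s / p)‖ ^ Nat.card (Dv L ⧸ κ.H p) ≤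
      ∏ χ : AddChar (Dv L ⧸ κ.H p) ℂ, ‖Ls p (χ.compAddMonoidHom (κ.toG p)) (s / p)‖ ^ q := by
  classical
  have hχn : ∀ χ : AddChar (Dv L ⧸ κ.H p) ℂ, ∀ c, ‖(χ.compAddMonoidHom (κ.toG p)) c‖ = 1 := by
    intro χ c
    rw [AddChar.compAddMonoidHom_apply]; exact AddChar.norm_apply _ _
  have hp1 : (1 : ℝ) ≤ p := by exact_mod_cast (Fact.out : p.Prime).one_le
  set u : ℝ := s / p with hu
  have hu0 : 0 ≤ u := by positivity
  have hu1 : u < 1 := by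
    rw [hu, div_lt_one (by linarith)]; linarith
  have hM := Ls_euler p (F := M) (ψ := 1) (fun c => by simp) h0 h1
  have hL := fun χ => Ls_euler p (F := L) (hχn χ) h0 h1
  let pre : Finset (FFPrime L) → Finset (FFPrime M) := fun B => B.biUnion fun P => (κ.fibre_finite p P).toFinset
  have hpre : Tendsto pre atTop atTop := by
    refine Filter.tendsto_atTop_finset_of_monotone ?_ ?_
    · intro B B' hB
      exact Finset.biUnion_subset_biUnion_of_subset_left _ hB
    · intro w
      refine ⟨{κ.res p w}, ?_⟩
      rw [Finset.mem_biUnion]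
      exact ⟨_, Finset.mem_singleton_self _, by rw [Set.Finite.mem_toFinset]; rfl⟩
  have hM2 := ((hM.2.comp hpre).norm).pow (Nat.card (Dv L ⧸ κ.H p))
  have hL2 := tendsto_finset_prod (Finset.univ : Finset (AddChar (Dv L ⧸ κ.H p) ℂ)) fun χ _ => ((hL χ).2.norm).pow q
  have hle := le_of_tendsto_of_tendsto' hL2 hM2 (by
    intro B
    simp only [Function.comp, norm_prod]
    rw [Finset.prod_biUnion]
    · simp_rw [← Finset.prod_pow]
      rw [Finset.prod_comm]
      refine Finset.prod_le_prod (fun P _ => Finset.prod_nonneg fun _ _ => by positivity) fun P _ => ?_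
      have := κ.loc_fib p P hu0 hu1
      rw [← Finset.prod_pow, ← Finset.prod_pow] at this
      refine this.trans (le_of_eq ?_)
      refine Finset.prod_congr rfl fun w _ => ?_
      have h2 : (1 : ℂ) - (1 : AddChar (Pic p M) ℂ) (QuotientAddGroup.mk (Finsupp.single w 1)) * (u : ℂ) ^ w.deg p = ((1 - u ^ w.deg p : ℝ) : ℂ) := by
        rw [AddChar.one_apply]; push_cast; ring
      rw [h2, Complex.norm_real, Real.norm_of_nonneg]
      have : u ^ w.deg p ≤ 1 := pow_le_one₀ hu0 hu1.le
      linarith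
    · intro P _ P' _ hPP
      rw [Function.onFun, Finset.disjoint_left]
      intro w hw hw'
      rw [Set.Finite.mem_toFinset] at hw hw'
      exact hPP (hw.symm.trans hw'))
  simp_rw [norm_inv, inv_pow] at hle
  rw [Finset.prod_inv_distrib] at hle
  refine (inv_le_inv₀ ?_ ?_).1 hle
  · exact Finset.prod_pos fun χ _ => pow_pos (norm_pos_iff.2 (hL χ).1) _
  · exact pow_pos (norm_pos_iff.2 hM.1) _

/-- the second inequality -/
theorem second_ineq : Nat.card (Dv L ⧸ κ.H p) ≤ q := by
  classical
  haveI := κ.finite_G p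
  letI : Fintype (AddChar (Dv L ⧸ κ.H p) ℂ) := Fintype.ofFinite _
  obtain ⟨C, C1, c1, hc1, hLone⟩ := Ls_one p L
  obtain ⟨C2, C', c, hc, hMone⟩ := Ls_one p M
  have hχn : ∀ χ : AddChar (Dv L ⧸ κ.H p) ℂ, ∀ c, ‖(χ.compAddMonoidHom (κ.toG p)) c‖ = 1 := by
    intro χ c
    rw [AddChar.compAddMonoidHom_apply]; exact AddChar.norm_apply _ _
  obtain ⟨P⟩ := exists_place p L
  have hP := P.deg_pos p
  have hbd : ∀ χ : AddChar (Dv L ⧸ κ.H p) ℂ, ∃ B : ℝ, χ ≠ 1 → ∀ s : ℝ, 0 ≤ s → s < 1 → ‖Ls p (χ.compAddMonoidHom (κ.toG p)) (s / p)‖ ≤ B := by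
    intro χ
    by_cases h : χ = 1
    · exact ⟨0, fun h' => absurd h h'⟩
    obtain ⟨g, hg⟩ := AddChar.ne_one_iff.1 h
    obtain ⟨D, rfl⟩ := QuotientAddGroup.mk_surjective g
    obtain ⟨B, hB⟩ := Ls_bdd p (hχn χ) (d := QuotientAddGroup.mk (q • Finsupp.single P 1)) (m := q * P.deg p) (by
      rw [AddChar.compAddMonoidHom_apply, toG_mk, (QuotientAddGroup.eq_zero_iff _).2 (κ.q_mem_H p _), AddChar.map_zero_eq_one])
      (Nat.mul_pos κ.hq.pos hP) (by rw [qdg_mk, map_nsmul, dg_single, nsmul_eq_mul]; push_cast; ring)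
      (c := QuotientAddGroup.mk D) (by rwa [AddChar.compAddMonoidHom_apply, toG_mk])
    exact ⟨B, fun _ => hB⟩
  choose B hB using hbd
  refine growth hc (C' := C') (K := C ^ q * ∏ χ ∈ (Finset.univ : Finset (AddChar (Dv L ⧸ κ.H p) ℂ)).erase 1, B χ ^ q) ?_
  intro T hT
  rcases le_or_gt (c * T - C') 0 with h | h
  · exact Or.inl h
  refine Or.inr ?_
  have hs0 : 0 ≤ 1 - 1 / T := by
    rw [sub_nonneg, div_le_one (by linarith)]; exact hT
  have hs1 : 1 - 1 / T < 1 := by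
    have : 0 < 1 / T := by positivity
    linarith
  have hTT : ∀ z : ℝ, z / (1 - (1 - 1 / T)) = z * T := by
    intro z; rw [sub_sub_cancel]; field_simp
  have e1 := (hMone _ hs0 hs1).2
  have e2 := (hLone _ hs0 hs1).1
  rw [hTT] at e1 e2
  have e3 := κ.zeta_ineq p hs0 hs1
  refine (pow_le_pow_left₀ h.le e1 _).trans (e3.trans ?_)
  rw [← Finset.mul_prod_erase _ _ (Finset.mem_univ (1 : AddChar (Dv L ⧸ κ.H p) ℂ))]
  have e4 : (1 : AddChar (Dv L ⧸ κ.H p) ℂ).compAddMonoidHom (κ.toG p) = 1 := by ext; rfl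
  rw [e4]
  have e5 : ‖Ls p (1 : AddChar (Pic p L) ℂ) ((1 - 1 / T) / p)‖ ^ q ≤ (C * T) ^ q := pow_le_pow_left₀ (norm_nonneg _) e2 _
  rw [mul_right_comm, ← mul_pow]
  refine mul_le_mul e5 ?_ (Finset.prod_nonneg fun _ _ => by positivity) ((pow_nonneg (norm_nonneg _) _).trans e5)
  refine Finset.prod_le_prod (fun _ _ => by positivity) fun χ hχ => ?_
  exact pow_le_pow_left₀ (norm_nonneg _) (hB χ (Finset.ne_of_mem_erase hχ) _ hs0 hs1) _

end Kum

set_option autoImplicit false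
set_option linter.all false

namespace Herb
open AddSubgroup

theorem relIndex_le {G G' : Type} [AddCommGroup G] [AddCommGroup G'] (H K : AddSubgroup G) (H' K' : AddSubgroup G')
    (ρ : G → G' → Prop) (hr : ∀ x ∈ K, ∃ y ∈ K', ρ x y)
    (hinj : ∀ x ∈ K, ∀ x' ∈ K, ∀ y ∈ K', ∀ y' ∈ K', ρ x y → ρ x' y' → y' - y ∈ H' → x' - x ∈ H)
    (hfin : H'.relIndex K' ≠ 0) :
    H.relIndex K ≤ H'.relIndex K' ∧
    (H'.relIndex K' ≤ H.relIndex K → ∀ y ∈ K', ∃ x ∈ K, ∃ y0 ∈ K', ρ x y0 ∧ y - y0 ∈ H') := by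
  have hr' : ∀ x : K, ∃ y : K', ρ x y := fun x => by
    obtain ⟨y, hy, h⟩ := hr x x.2; exact ⟨⟨y, hy⟩, h⟩
  choose f hf using hr'
  let φ : K ⧸ H.addSubgroupOf K → K' ⧸ H'.addSubgroupOf K' := fun z => QuotientAddGroup.mk (f z.out)
  haveI : Finite (K' ⧸ H'.addSubgroupOf K') := index_ne_zero_iff_finite.1 hfin
  have hφ : Function.Injective φ := by
    intro z z' hz
    have h1 := QuotientAddGroup.eq.1 hz
    rw [mem_addSubgroupOf] at h1
    have h2 := hinj _ z.out.2 _ z'.out.2 _ (f z.out).2 _ (f z'.out).2 (hf _) (hf _) (by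
      have : ((-(f z.out) + f z'.out : K') : G') = (f z'.out : G') - f z.out := by push_cast; abel
      rwa [this] at h1)
    rw [← QuotientAddGroup.out_eq' z, ← QuotientAddGroup.out_eq' z', QuotientAddGroup.eq, mem_addSubgroupOf]
    have : ((-(z.out) + z'.out : K) : G) = (z'.out : G) - z.out := by push_cast; abel
    rw [this]; exact h2
  have hle : H.relIndex K ≤ H'.relIndex K' := Nat.card_le_card_of_injective φ hφ
  refine ⟨hle, fun hge y hy => ?_⟩
  have hb : Function.Bijective φ := (Nat.bijective_iff_injective_and_card φ).2 ⟨hφ, le_antisymm hle hge⟩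
  obtain ⟨z, hz⟩ := hb.2 (QuotientAddGroup.mk ⟨y, hy⟩)
  have h1 := QuotientAddGroup.eq.1 hz
  rw [mem_addSubgroupOf] at h1
  refine ⟨z.out, z.out.2, f z.out, (f z.out).2, hf _, ?_⟩
  have : ((-(f z.out) + ⟨y, hy⟩ : K') : G') = y - f z.out := by push_cast; abel
  rwa [this] at h1

theorem card_map_ker {G G' : Type} [AddCommGroup G] [AddCommGroup G'] (f : G →+ G') (A : AddSubgroup G) :
    Nat.card (f.ker ⊓ A : AddSubgroup G) * Nat.card (A.map f) = Nat.card A := by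
  have h := relIndex_mul_relIndex (⊥ : AddSubgroup G) (f.ker ⊓ A) A bot_le inf_le_right
  rwa [relIndex_bot_left, relIndex_bot_left, inf_relIndex_right, relIndex_ker] at h

theorem sup_inf {G : Type} [AddCommGroup G] (dg : G →+ ℤ) (P V : AddSubgroup G) (A : G) (hA : 0 < dg A)
    (hP : P ≤ V) (hV : ∀ v ∈ V, dg v = 0) : (P ⊔ zmultiples A) ⊓ V = P := by
  refine le_antisymm ?_ (le_inf le_sup_left hP)
  rintro x ⟨h1, h2⟩
  obtain ⟨y, hy, z, hz, rfl⟩ := AddSubgroup.mem_sup.1 h1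
  obtain ⟨k, rfl⟩ := AddSubgroup.mem_zmultiples_iff.1 hz
  have h3 := hV _ h2
  rw [map_add, hV _ (hP hy), zero_add, map_zsmul, smul_eq_mul] at h3
  have hk : k = 0 := by
    rcases mul_eq_zero.1 h3 with h | h
    · exact h
    · omega
  rw [hk, zero_smul, add_zero]; exact hy

variable {UL UM DL DM : Type} [AddCommGroup UL] [AddCommGroup UM] [AddCommGroup DL] [AddCommGroup DM]

theorem main (q : ℕ) (hq : 0 < q) (dL : UL →+ DL) (dM : UM →+ DM) (jD : DL →+ DM) (jU : UL →+ UM) (ND : DM →+ DL) (NU : UM →+ UL)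
    (eU : UM →+ UM) (eD : DM →+ DM) (gL : DL →+ ℤ) (gM : DM →+ ℤ)
    (jU_inj : Function.Injective jU) (jD_inj : Function.Injective jD)
    (hj : ∀ z, dM (jU z) = jD (dL z)) (hN : ∀ y, ND (dM y) = dL (NU y)) (he : ∀ y, eD (dM y) = dM (eU y))
    (hU1 : ∀ y, eU y = 0 ↔ y ∈ jU.range) (hU2 : ∀ y, NU y = 0 ↔ y ∈ eU.range)
    (hD1 : ∀ D, eD D = 0 ↔ D ∈ jD.range) (hD2 : ∀ D, ND (eD D) = 0)
    (hNj : ∀ D, ND (jD D) = q • D)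
    (hgL : ∀ z, gL (dL z) = 0) (hgM : ∀ z, gM (dM z) = 0) (hgj : ∀ D, gM (jD D) = q * gL D) (hgN : ∀ D, gL (ND D) = gM D)
    (A : DL) (hA : 0 < gL A) (finL : Finite dL.ker) (finM : Finite dM.ker)
    (indL : (dL.range ⊔ zmultiples A).index ≠ 0) (indM : (dM.range ⊔ zmultiples (jD A)).index ≠ 0)
    (hI : (dL.range ⊔ ND.range).index ≤ q) (c : UL) (D : DM) (hc : dL c = ND D) : c ∈ NU.range := by
  have hqZ : (0 : ℤ) < q := by exact_mod_cast hq
  -- degree of the q-multiple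
  set PL := dL.range with hPL
  set PM := dM.range with hPM
  have gPL : ∀ v ∈ PL, gL v = 0 := by rintro _ ⟨z, rfl⟩; exact hgL z
  have gPM : ∀ v ∈ PM, gM v = 0 := by rintro _ ⟨z, rfl⟩; exact hgM z
  -- index q
  have hidxq : (PL ⊔ zmultiples (q • A)).relIndex (PL ⊔ zmultiples A) = q := by
    have h1 : PL ⊔ zmultiples A = zmultiples A ⊔ (PL ⊔ zmultiples (q • A)) := by
      have : zmultiples (q • A) ≤ zmultiples A := by
        rw [zmultiples_le]; exact ⟨q, by simp⟩
      refine le_antisymm (sup_le (le_sup_left.trans le_sup_right) le_sup_left) (sup_le le_sup_right (sup_le le_sup_left (this.trans le_sup_right)))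
    rw [h1, relIndex_sup_right]
    have h2 : (zmultiplesHom DL A).range = zmultiples A := rfl
    rw [← h2, ← index_comap]
    have h3 : (PL ⊔ zmultiples (q • A)).comap (zmultiplesHom DL A) = zmultiples (q : ℤ) := by
      ext k
      rw [mem_comap, zmultiplesHom_apply, Int.mem_zmultiples_iff]
      constructor
      · intro h
        obtain ⟨y, hy, z, hz, hyz⟩ := AddSubgroup.mem_sup.1 h
        obtain ⟨l, rfl⟩ := AddSubgroup.mem_zmultiples_iff.1 hz
        have h4 := congrArg gL hyz
        rw [map_add, gPL _ hy, zero_add, map_zsmul, map_nsmul, map_zsmul, smul_eq_mul, smul_eq_mul, nsmul_eq_mul, ← mul_assoc] at h4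
        have := mul_right_cancel₀ hA.ne' h4
        exact ⟨l, by rw [← this, mul_comm]⟩
      · rintro ⟨l, rfl⟩
        refine (le_sup_right : zmultiples (q • A) ≤ PL ⊔ zmultiples (q • A)) ⟨l, ?_⟩
        change l • (q • A) = _
        rw [mul_comm, mul_smul, natCast_zsmul]
    rw [h3, Int.index_zmultiples]; rfl
  -- names
  set x := (PM ⊔ zmultiples (jD A)).index with hx
  set y := (PL ⊔ zmultiples A).index with hy
  set I := (PL ⊔ ND.range).index with hIdef
  set i1 := (PM ⊔ jD.range).index with hi1
  set s := (PM ⊔ zmultiples (jD A)).relIndex (PM ⊔ jD.range) with hs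
  set V := (PL ⊔ zmultiples (q • A)).comap ND with hV
  set t := (PL ⊔ zmultiples (q • A)).relIndex (PL ⊔ ND.range) with ht
  set n' := (PM ⊔ zmultiples (jD A)).relIndex V with hn'
  set W := (PM ⊔ zmultiples (jD A)).comap jD with hW
  set k' := (PL ⊔ zmultiples A).relIndex W with hk'
  have jA_range : zmultiples (jD A) ≤ jD.range := by rw [zmultiples_le]; exact ⟨A, rfl⟩
  have qA_range : zmultiples (q • A) ≤ ND.range := by rw [zmultiples_le]; exact ⟨jD A, hNj A⟩
  have e1 : s * i1 = x := relIndex_mul_index (sup_le_sup_left jA_range _)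
  have e2 : k' * s = y := by
    have h1 : PL ⊔ zmultiples A ≤ W := by
      refine sup_le ?_ ?_
      · rintro _ ⟨z, rfl⟩
        rw [hW, mem_comap, ← hj]
        exact (le_sup_left : PM ≤ PM ⊔ zmultiples (jD A)) ⟨_, rfl⟩
      · rw [zmultiples_le, hW, mem_comap]
        exact (le_sup_right : zmultiples (jD A) ≤ PM ⊔ zmultiples (jD A)) (mem_zmultiples _)
    have h2 := relIndex_mul_index h1
    have h3 : W.index = s := by
      rw [hW, index_comap, hs]
      have : PM ⊔ jD.range = jD.range ⊔ (PM ⊔ zmultiples (jD A)) :=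
        le_antisymm (sup_le (le_sup_left.trans le_sup_right) le_sup_left) (sup_le le_sup_right (sup_le_sup_left jA_range _))
      rw [this, relIndex_sup_right]
    rw [h3] at h2
    exact h2
  have hVle : PM ⊔ zmultiples (jD A) ≤ V := by
    refine sup_le ?_ ?_
    · rintro _ ⟨z, rfl⟩
      rw [hV, mem_comap, hN]
      exact (le_sup_left : PL ≤ PL ⊔ zmultiples (q • A)) ⟨_, rfl⟩
    · rw [zmultiples_le, hV, mem_comap, hNj]
      exact (le_sup_right : zmultiples (q • A) ≤ PL ⊔ zmultiples (q • A)) (mem_zmultiples _)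
  have e3 : n' * t = x := by
    have h2 := relIndex_mul_index hVle
    have h3 : V.index = t := by
      rw [hV, index_comap, ht]
      have : PL ⊔ ND.range = ND.range ⊔ (PL ⊔ zmultiples (q • A)) :=
        le_antisymm (sup_le (le_sup_left.trans le_sup_right) le_sup_left) (sup_le le_sup_right (sup_le_sup_left qA_range _))
      rw [this, relIndex_sup_right]
    rw [h3] at h2
    exact h2
  have e4 : t * I = q * y := by
    have h1 : t * I = (PL ⊔ zmultiples (q • A)).index := relIndex_mul_index (sup_le_sup_left qA_range _)
    have h2 : (PL ⊔ zmultiples (q • A)).relIndex (PL ⊔ zmultiples A) * y = (PL ⊔ zmultiples (q • A)).index := by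
      refine relIndex_mul_index (sup_le_sup_left ?_ _)
      rw [zmultiples_le]; exact ⟨q, by simp⟩
    rw [h1, ← h2, hidxq]
  have hs0 : 0 < s := Nat.pos_of_ne_zero (by rintro h; rw [h, zero_mul] at e1; exact indM e1.symm)
  have hi0 : 0 < i1 := Nat.pos_of_ne_zero (by rintro h; rw [h, mul_zero] at e1; exact indM e1.symm)
  have hk0 : 0 < k' := Nat.pos_of_ne_zero (by rintro h; rw [h, zero_mul] at e2; exact indL e2.symm)
  have hn0 : 0 < n' := Nat.pos_of_ne_zero (by rintro h; rw [h, zero_mul] at e3; exact indM e3.symm)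
  have hmain : n' * k' ≤ i1 := by
    have h1 : s * (i1 * I) = s * (n' * q * k') := by
      calc s * (i1 * I) = (s * i1) * I := by ring
        _ = n' * (t * I) := by rw [e1, ← e3]; ring
        _ = n' * (q * (k' * s)) := by rw [e4, e2]
        _ = _ := by ring
    have h2 := Nat.eq_of_mul_eq_mul_left hs0 h1
    have h3 : q * (n' * k') ≤ q * i1 := by
      calc q * (n' * k') = i1 * I := by rw [h2]; ring
        _ ≤ i1 * q := Nat.mul_le_mul_left _ hI
        _ = _ := mul_comm _ _
    exact Nat.le_of_mul_le_mul_left h3 hq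
  -- constants
  set ε := (dM.ker.map NU).relIndex dL.ker with hε
  have hεle : dM.ker.map NU ≤ dL.ker := by
    rintro _ ⟨z, hz, rfl⟩
    rw [AddMonoidHom.mem_ker, ← hN, (AddMonoidHom.mem_ker).1 hz, map_zero]
  set ε' := (dM.ker.map eU).relIndex (NU.ker ⊓ dM.ker) with hε'
  have hε'le : dM.ker.map eU ≤ NU.ker ⊓ dM.ker := by
    rintro _ ⟨z, hz, rfl⟩
    refine ⟨(hU2 _).2 ⟨z, rfl⟩, ?_⟩
    change dM (eU z) = 0
    rw [← he, (AddMonoidHom.mem_ker).1 hz, map_zero]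
  have hεε : ε = ε' := by
    have c1 := card_map_ker NU dM.ker
    have c2 := card_map_ker eU dM.ker
    have c3 : Nat.card (eU.ker ⊓ dM.ker : AddSubgroup UM) = Nat.card dL.ker := by
      have h1 : eU.ker ⊓ dM.ker = dL.ker.map jU := by
        ext y
        constructor
        · rintro ⟨h1, h2⟩
          obtain ⟨z, rfl⟩ := (hU1 _).1 h1
          refine ⟨z, ?_, rfl⟩
          apply jD_inj
          rw [← hj, map_zero]; exact h2
        · rintro ⟨z, hz, rfl⟩
          refine ⟨(hU1 _).2 ⟨z, rfl⟩, ?_⟩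
          change dM (jU z) = 0
          rw [hj, (AddMonoidHom.mem_ker).1 hz, map_zero]
      rw [h1]
      exact Nat.card_congr (dL.ker.equivMapOfInjective jU jU_inj).symm.toEquiv
    have c4 : Nat.card (dM.ker.map NU) * ε = Nat.card dL.ker := by
      have h := relIndex_mul_relIndex (⊥ : AddSubgroup UL) _ _ bot_le hεle
      rwa [relIndex_bot_left, relIndex_bot_left] at h
    have c5 : Nat.card (dM.ker.map eU) * ε' = Nat.card (NU.ker ⊓ dM.ker : AddSubgroup UM) := by
      have h := relIndex_mul_relIndex (⊥ : AddSubgroup UM) _ _ bot_le hε'le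
      rwa [relIndex_bot_left, relIndex_bot_left] at h
    have hpos : 0 < Nat.card dM.ker := Nat.card_pos
    rw [c3] at c2
    have p1 : 0 < Nat.card (dM.ker.map NU) := Nat.pos_of_ne_zero (by intro h; rw [h, mul_zero] at c1; omega)
    have p2 : 0 < Nat.card (dM.ker.map eU) := Nat.pos_of_ne_zero (by intro h; rw [h, mul_zero] at c2; omega)
    have : Nat.card (dM.ker.map NU) * Nat.card (dM.ker.map eU) * ε = Nat.card (dM.ker.map NU) * Nat.card (dM.ker.map eU) * ε' := by
      calc _ = Nat.card (dM.ker.map eU) * (Nat.card (dM.ker.map NU) * ε) := by ring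
        _ = Nat.card dM.ker := by rw [c4, ← c2, mul_comm]
        _ = Nat.card (dM.ker.map NU) * (Nat.card (dM.ker.map eU) * ε') := by rw [c5, ← c1, mul_comm]
        _ = _ := by ring
    exact Nat.eq_of_mul_eq_mul_left (Nat.mul_pos p1 p2) this
  have hε0 : ε ≠ 0 := by
    haveI : Finite dL.ker := finL
    rw [hε]
    exact index_ne_zero_of_finite
  -- ε ≤ k'
  have hεk : ε ≤ k' := by
    rw [hεε]
    refine (relIndex_le _ _ _ _ (fun η B => ∃ y, eU y = η ∧ dM y = jD B) ?_ ?_ hk0.ne').1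
    · rintro η ⟨h1, h2⟩
      obtain ⟨y, rfl⟩ := (hU2 η).1 h1
      have h3 : eD (dM y) = 0 := by rw [he]; exact h2
      obtain ⟨B, hB⟩ := (hD1 _).1 h3
      refine ⟨B, ?_, y, rfl, hB.symm⟩
      rw [hW, mem_comap, hB]
      exact (le_sup_left : PM ≤ PM ⊔ zmultiples (jD A)) ⟨y, rfl⟩
    · rintro η _ η' _ B _ B' _ ⟨y, hy1, hy2⟩ ⟨y', hy1', hy2'⟩ hBB
      have hg : ∀ B y, dM y = jD B → gL B = 0 := by
        intro B y h
        have h1 := hgj B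
        rw [← h, hgM] at h1
        rcases mul_eq_zero.1 h1.symm with h2 | h2
        · omega
        · exact h2
      have h1 : B' - B ∈ (PL ⊔ zmultiples A) ⊓ gL.ker := ⟨hBB, by
        change gL (B' - B) = 0
        rw [map_sub, hg _ _ hy2, hg _ _ hy2', sub_zero]⟩
      rw [sup_inf gL PL gL.ker A hA (fun v hv => gPL v hv) (fun v hv => hv)] at h1
      obtain ⟨z, hz⟩ := h1
      refine ⟨y' - y - jU z, ?_, ?_⟩
      · rw [SetLike.mem_coe, AddMonoidHom.mem_ker, map_sub, map_sub, hy2, hy2', hj, hz, map_sub, sub_self]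
      · rw [map_sub, map_sub, hy1, hy1', (hU1 _).2 ⟨z, rfl⟩, sub_zero]
  -- n1 ≤ n'
  set V1 := PL.comap ND with hV1
  have hPMV1 : PM ≤ V1 := by
    rintro _ ⟨z, rfl⟩
    rw [hV1, mem_comap, hN]; exact ⟨_, rfl⟩
  have hn1 : PM.relIndex V1 ≤ n' := by
    have h1 : V1 ≤ V := comap_mono le_sup_left
    have h2 : (PM ⊔ zmultiples (jD A)).relIndex V1 ≤ n' := relIndex_le_of_le_right h1 hn0.ne'
    rw [← inf_relIndex_right, sup_inf gM PM V1 (jD A) (by rw [hgj]; positivity) hPMV1] at h2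
    · exact h2
    · intro v hv
      rw [← hgN]; exact gPL _ hv
  -- K1
  set K1 := PM.comap eD with hK1
  have hK1le : PM ⊔ jD.range ≤ K1 := by
    refine sup_le ?_ ?_
    · rintro _ ⟨z, rfl⟩
      rw [hK1, mem_comap, he]; exact ⟨_, rfl⟩
    · intro B hB
      rw [hK1, mem_comap, (hD1 B).2 hB]; exact zero_mem _
  have f1 : (PM ⊔ jD.range).relIndex K1 * K1.index = i1 := relIndex_mul_index hK1le
  have f2 : K1.index = PM.relIndex (PM ⊔ eD.range) := by
    rw [hK1, index_comap, relIndex_sup_left]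
  have hRle : PM ⊔ eD.range ≤ V1 := by
    refine sup_le hPMV1 ?_
    rintro _ ⟨z, rfl⟩
    rw [hV1, mem_comap, hD2]; exact zero_mem _
  have f3 : K1.index * (PM ⊔ eD.range).relIndex V1 = PM.relIndex V1 := by
    rw [f2]; exact relIndex_mul_relIndex _ _ _ le_sup_left hRle
  have hrel := relIndex_le (PM ⊔ jD.range) K1 (dM.ker.map NU) dL.ker (fun E u => ∃ y, eD E = dM y ∧ NU y = u) (by
      intro E hE
      obtain ⟨y, hy⟩ := hE
      refine ⟨NU y, ?_, y, hy.symm, rfl⟩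
      rw [AddMonoidHom.mem_ker, ← hN, hy, hD2]) (by
      rintro E _ E' _ u _ u' _ ⟨y, hy1, hy2⟩ ⟨y', hy1', hy2'⟩ ⟨k, hk, hk2⟩
      have h1 : NU (y' - y - k) = 0 := by rw [map_sub, map_sub, hy2, hy2', hk2, sub_self]
      obtain ⟨z, hz⟩ := (hU2 _).1 h1
      have h2 : eD (E' - E - dM z) = 0 := by
        rw [map_sub, map_sub, hy1, hy1', he, hz, map_sub, map_sub, (AddMonoidHom.mem_ker).1 hk, sub_zero, sub_self]
      have h3 := (hD1 _).1 h2
      have h4 : E' - E = dM z + (E' - E - dM z) := by abel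
      rw [h4]
      exact AddSubgroup.add_mem_sup ⟨z, rfl⟩ h3) hε0
  have hK1pos : 0 < K1.index := Nat.pos_of_ne_zero (by rintro h; rw [h, mul_zero] at f1; omega)
  have hm0 : 0 < (PM ⊔ eD.range).relIndex V1 := by
    refine Nat.pos_of_ne_zero ?_
    intro h
    rw [h, mul_zero] at f3
    have h2 : (PM ⊔ zmultiples (jD A)).relIndex V1 = PM.relIndex V1 := by
      rw [← inf_relIndex_right, sup_inf gM PM V1 (jD A) (by rw [hgj]; positivity) hPMV1]
      intro v hv
      rw [← hgN]; exact gPL _ hv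
    rw [← f3] at h2
    exact indM (index_eq_zero_of_relIndex_eq_zero h2)
  set m := (PM ⊔ eD.range).relIndex V1
  have hmk : m * k' ≤ (PM ⊔ jD.range).relIndex K1 := by
    have : K1.index * (m * k') ≤ K1.index * (PM ⊔ jD.range).relIndex K1 := by
      calc K1.index * (m * k') = (PM.relIndex V1) * k' := by rw [← f3]; ring
        _ ≤ n' * k' := Nat.mul_le_mul_right _ hn1
        _ ≤ i1 := hmain
        _ = _ := by rw [← f1, mul_comm]
    exact Nat.le_of_mul_le_mul_left this hK1pos
  have hm1 : m = 1 := by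
    have h1 : m * k' ≤ 1 * k' := by rw [one_mul]; exact (hmk.trans hrel.1).trans hεk
    have := Nat.le_of_mul_le_mul_right h1 hk0
    omega
  have hge : ε ≤ (PM ⊔ jD.range).relIndex K1 := by
    rw [hm1, one_mul] at hmk; exact hεk.trans hmk
  have hV1le : V1 ≤ PM ⊔ eD.range := relIndex_eq_one.1 hm1
  have hDV : D ∈ V1 := ⟨c, hc⟩
  obtain ⟨_, ⟨y, rfl⟩, _, ⟨E, rfl⟩, hyE⟩ := AddSubgroup.mem_sup.1 (hV1le hDV)
  have hu : c - NU y ∈ dL.ker := by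
    rw [AddMonoidHom.mem_ker, map_sub, hc, ← hyE, map_add, hD2, hN, add_zero, sub_self]
  obtain ⟨E', _, u0, _, ⟨y', _, hy'⟩, ⟨k, _, hk⟩⟩ := hrel.2 hge _ hu
  refine ⟨y + y' + k, ?_⟩
  rw [map_add, map_add, hk, hy']; abel

end Herb

set_option autoImplicit false
set_option linter.all false

namespace Kum
open FFPrime Dv Zeta

/-- divisor map on units -/
def dU (p : ℕ) [Fact p.Prime] (F : Type) [Field F] [Algebra (ZMod p) F] [FFld p F] : Additive Fˣ →+ Dv F where
  toFun u := dv p ((Additive.toMul u : Fˣ) : F)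
  map_zero' := dv_one p
  map_add' u v := dv_mul p (Units.ne_zero _) (Units.ne_zero _)

theorem dU_range (p : ℕ) [Fact p.Prime] (F : Type) [Field F] [Algebra (ZMod p) F] [FFld p F] : (dU p F).range = Prin p := by
  ext D
  constructor
  · rintro ⟨u, rfl⟩
    exact ⟨_, Units.ne_zero (Additive.toMul u), rfl⟩
  · rintro ⟨y, hy, rfl⟩
    exact ⟨Additive.ofMul (Units.mk0 y hy), rfl⟩

theorem dU_ker_finite (p : ℕ) [Fact p.Prime] (F : Type) [Field F] [Algebra (ZMod p) F] [FFld p F] : Finite (dU p F).ker := by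
  haveI : Finite (LL p (0 : Dv F)) := LL_finite p 0
  refine Finite.of_injective (β := LL p (0 : Dv F))
    (fun u : (dU p F).ker => ⟨((Additive.toMul u.1 : Fˣ) : F), (mem_LL_zero p (Units.ne_zero _)).2 u.2⟩) ?_
  intro u v h
  have h1 := congrArg Subtype.val h
  exact Subtype.ext (Additive.toMul.injective (Units.ext h1))

theorem fin_index (p : ℕ) [Fact p.Prime] {F : Type} [Field F] [Algebra (ZMod p) F] [FFld p F] {B : Dv F} (hB : 0 < dg p B) :
    (Prin p ⊔ AddSubgroup.zmultiples B).index ≠ 0 := by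
  rw [AddSubgroup.index_ne_zero_iff_finite]
  set m := dg p B with hm
  let f : Pic p F →+ Dv F ⧸ (Prin p ⊔ AddSubgroup.zmultiples B) :=
    QuotientAddGroup.map (Prin p) (Prin p ⊔ AddSubgroup.zmultiples B) (AddMonoidHom.id _)
      (le_sup_left : Prin p ≤ Prin p ⊔ AddSubgroup.zmultiples B)
  have hfin : (⋃ n ∈ Finset.Ico 0 m, {c : Pic p F | qdg p c = n}).Finite :=
    Set.Finite.biUnion (Finset.finite_toSet _) fun n _ => pic_finite p n
  refine Set.finite_univ_iff.1 ((hfin.image f).subset ?_)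
  intro g _
  obtain ⟨D, rfl⟩ := QuotientAddGroup.mk_surjective g
  refine ⟨QuotientAddGroup.mk (D - (dg p D / m) • B), ?_, ?_⟩
  · simp only [Set.mem_iUnion]
    refine ⟨dg p D % m, ?_, ?_⟩
    · rw [Finset.mem_Ico]; exact ⟨Int.emod_nonneg _ hB.ne', Int.emod_lt_of_pos _ hB⟩
    · change qdg p _ = _
      rw [qdg_mk, map_sub, map_zsmul, ← hm, smul_eq_mul, Int.emod_def, mul_comm]
  · change QuotientAddGroup.mk (D - (dg p D / m) • B) = QuotientAddGroup.mk D
    rw [QuotientAddGroup.eq]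
    have : -(D - (dg p D / m) • B) + D = (dg p D / m) • B := by abel
    rw [this]
    exact (le_sup_right : AddSubgroup.zmultiples B ≤ Prin p ⊔ AddSubgroup.zmultiples B) ⟨_, rfl⟩

variable {q : ℕ} {L M : Type} [Field L] [Field M] [Algebra L M] (κ : Kum q L M)

theorem nmL_one : κ.nmL 1 = 1 := by
  apply (algebraMap L M).injective
  rw [nmL_spec, map_one]; simp [nm]

theorem nmL_mul (x y : M) : κ.nmL (x * y) = κ.nmL x * κ.nmL y := by
  apply (algebraMap L M).injective
  rw [nmL_spec, map_mul, nmL_spec, nmL_spec, nm_mul]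

theorem nm_σ (y : M) (hy : y ≠ 0) : κ.nm (κ.σ y) = κ.nm y := by
  rw [← κ.nm_fix y]
  simp only [nm, map_prod]
  refine Finset.prod_congr rfl fun s _ => ?_
  rw [← AlgEquiv.mul_apply, ← AlgEquiv.mul_apply, ← pow_succ, ← pow_succ']

/-- norm as a monoid hom -/
def nmH : M →* L where
  toFun := κ.nmL
  map_one' := κ.nmL_one
  map_mul' := κ.nmL_mul

variable (p : ℕ) [Fact p.Prime] [Algebra (ZMod p) L] [Algebra (ZMod p) M] [IsScalarTower (ZMod p) L M]
variable [Algebra.IsAlgebraic L M]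
variable [FFld p L] [FFld p M]

/-- Hasse norm principle in the form needed: if the divisor of `c` is a norm, `c` is a norm. -/
theorem exists_norm {c : L} (hc : c ≠ 0) {D : Dv M} (h : dv p c = κ.N p D) : ∃ y : M, κ.nmL y = c := by
  obtain ⟨P⟩ := exists_place p L
  have hP := P.deg_pos p
  let sU : Additive Mˣ →+ Additive Mˣ := MonoidHom.toAdditive (Units.map (κ.σ : M →* M))
  have hA : 0 < dg p (Finsupp.single P (1 : ℤ)) := by
    rw [dg_single]; positivity
  have hjA : 0 < dg p (κ.j p (Finsupp.single P (1 : ℤ))) := by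
    rw [dg_j]; have := κ.hq.pos; positivity
  have hval : ∀ u v : Additive Mˣ, (((Additive.toMul u : Mˣ) : M) = ((Additive.toMul v : Mˣ) : M)) → u = v :=
    fun u v h => Additive.toMul.injective (Units.ext h)
  have hvalL : ∀ u v : Additive Lˣ, (((Additive.toMul u : Lˣ) : L) = ((Additive.toMul v : Lˣ) : L)) → u = v :=
    fun u v h => Additive.toMul.injective (Units.ext h)
  have hsU : ∀ u : Additive Mˣ, ((Additive.toMul (sU u) : Mˣ) : M) = κ.σ ((Additive.toMul u : Mˣ) : M) := fun u => rfl
  have key := Herb.main q κ.hq.pos (dU p L) (dU p M) (κ.j p) (MonoidHom.toAdditive (Units.map (algebraMap L M : L →* M)))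
    (κ.N p) (MonoidHom.toAdditive (Units.map κ.nmH)) (AddMonoidHom.id _ - sU) (AddMonoidHom.id _ - sh κ.σ) (dg p) (dg p)
    (by
      intro u v huv
      apply hvalL
      apply (algebraMap L M).injective
      exact congrArg (fun z : Additive Mˣ => ((Additive.toMul z : Mˣ) : M)) huv)
    (by
      intro D E hDE
      ext R
      obtain ⟨w, rfl⟩ := κ.res_surj p R
      rw [← j_apply, ← j_apply, hDE])
    (fun z => (κ.j_dv p _).symm)
    (fun y => κ.N_dv p (Units.ne_zero _))
    (fun y => by
      rw [AddMonoidHom.sub_apply, AddMonoidHom.sub_apply, map_sub]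
      congr 1
      exact sh_dv p κ.σ _)
    (fun y => by
      rw [AddMonoidHom.sub_apply, AddMonoidHom.id_apply, sub_eq_zero]
      constructor
      · intro h1
        have h2 : κ.σ ((Additive.toMul y : Mˣ) : M) = ((Additive.toMul y : Mˣ) : M) := by
          rw [← hsU, ← h1]
        obtain ⟨z, hz⟩ := κ.fix _ h2
        have hz0 : z ≠ 0 := by
          rintro rfl
          rw [map_zero] at hz
          exact Units.ne_zero _ hz.symm
        exact ⟨Additive.ofMul (Units.mk0 z hz0), hval _ _ hz⟩
      · rintro ⟨z, rfl⟩
        apply hval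
        rw [hsU]
        exact (κ.σ.commutes _).symm)
    (fun y => by
      constructor
      · intro h1
        have h2 : κ.nmL ((Additive.toMul y : Mˣ) : M) = 1 := congrArg (fun z : Additive Lˣ => ((Additive.toMul z : Lˣ) : L)) h1
        have h3 : κ.nm ((Additive.toMul y : Mˣ) : M) = 1 := by rw [← nmL_spec, h2, map_one]
        obtain ⟨z, hz0, hz⟩ := κ.hilbert90 h3
        refine ⟨Additive.ofMul (Units.mk0 z hz0), ?_⟩
        rw [AddMonoidHom.sub_apply, AddMonoidHom.id_apply, sub_eq_iff_eq_add]
        apply hval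
        exact hz.symm
      · rintro ⟨z, rfl⟩
        rw [AddMonoidHom.sub_apply, AddMonoidHom.id_apply, map_sub, sub_eq_zero]
        apply hvalL
        change κ.nmL _ = κ.nmL _
        apply (algebraMap L M).injective
        rw [nmL_spec, nmL_spec, hsU, κ.nm_σ _ (Units.ne_zero _)])
    (fun D => by
      rw [AddMonoidHom.sub_apply, AddMonoidHom.id_apply, sub_eq_zero]
      constructor
      · intro h1
        exact κ.exists_j p h1.symm
      · rintro ⟨E, rfl⟩
        exact (κ.sh_j p E).symm)
    (fun D => by
      rw [AddMonoidHom.sub_apply, AddMonoidHom.id_apply, map_sub, N_sh, sub_self])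
    (κ.N_j p)
    (fun z => dg_dv p _)
    (fun z => dg_dv p _)
    (κ.dg_j p)
    (κ.dg_N p)
    (Finsupp.single P 1) hA (dU_ker_finite p L) (dU_ker_finite p M)
    (by rw [dU_range]; exact fin_index p hA)
    (by rw [dU_range]; exact fin_index p hjA)
    (by rw [dU_range]; exact κ.second_ineq p)
    (Additive.ofMul (Units.mk0 c hc)) D h
  obtain ⟨y, hy⟩ := key
  exact ⟨((Additive.toMul y : Mˣ) : M), congrArg (fun z : Additive Lˣ => ((Additive.toMul z : Lˣ) : L)) hy⟩

end Kum

set_option autoImplicit false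
set_option linter.all false

namespace Kum
open FFPrime Dv
variable {q : ℕ} {L M : Type} [Field L] [Field M] [Algebra L M] (κ : Kum q L M)
variable (p : ℕ) [Fact p.Prime] [Algebra (ZMod p) L] [Algebra (ZMod p) M] [IsScalarTower (ZMod p) L M]
variable [Algebra.IsAlgebraic L M]
variable [FFld p L] [FFld p M]

theorem exists_norm_of_local {c : L} (hc : c ≠ 0)
    (h : ∀ P : FFPrime L, (q : ℤ) ∣ P.n c ∨ κ.split p P) : ∃ y : M, κ.nmL y = c := by
  classical
  refine κ.exists_norm p hc (D := ∑ P ∈ (dv p c).support, Finsupp.single (κ.sec p P)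
    (if κ.split p P then dv p c P else dv p c P / q)) ?_
  rw [map_sum]
  conv_lhs => rw [← Finsupp.sum_single (dv p c)]
  rw [Finsupp.sum]
  refine Finset.sum_congr rfl fun P _ => ?_
  by_cases hP : κ.split p P
  · rw [if_pos hP, κ.N_single_split p hP]
  · rw [if_neg hP, κ.N_single_inert p hP]
    congr 1
    exact (Int.mul_ediv_cancel' ((h P).resolve_right hP)).symm

theorem split_of_one {P : FFPrime L} (h0 : P.n κ.a = 0) (h1 : P.ge 1 (κ.a - 1)) : κ.split p P := by
  intro hfix
  set w := κ.sec p P with hw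
  have hres : κ.res p w = P := κ.res_sec p P
  have hq0 : (q : ℤ) ≠ 0 := by exact_mod_cast κ.hq.ne_zero
  have hαn : w.n κ.α = 0 := by
    have := κ.n_a w
    rw [← κ.res_n p, hres, h0] at this
    rcases mul_eq_zero.1 this.symm with h | h
    · exact absurd h hq0
    · exact h
  have hg : w.ge 1 (κ.α ^ q - 1 ^ q) := by
    rw [κ.ha, one_pow, ← map_one (algebraMap L M), ← map_sub, ← κ.res_ge p, hres]
    exact h1
  have hζM : IsPrimitiveRoot (algebraMap L M κ.ζ) q := κ.hζ.map_of_injective (algebraMap L M).injective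
  rw [hζM.pow_sub_pow_eq_prod_sub_mul _ _ κ.hq.pos] at hg
  have key : ∃ ξ ∈ Polynomial.nthRootsFinset q (1 : M), w.ge 1 (κ.α - ξ * 1) := by
    by_contra hcon
    push Not at hcon
    have : ∀ s : Finset M, s ⊆ Polynomial.nthRootsFinset q (1 : M) → ¬ w.ge 1 (∏ ξ ∈ s, (κ.α - ξ * 1)) := by
      intro s hs
      have hne : ∀ ξ ∈ s, κ.α - ξ * 1 ≠ 0 := fun ξ hξ h => hcon ξ (hs hξ) (by rw [h]; exact w.ge_zero _)
      rw [w.ge_iff (Finset.prod_ne_zero_iff.2 hne)]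
      have hle : w.n (∏ ξ ∈ s, (κ.α - ξ * 1)) ≤ 0 := by
        clear hg
        induction s using Finset.cons_induction with
        | empty => simp
        | cons ξ s hξs ih =>
          rw [Finset.prod_cons, w.n_mul (hne ξ (Finset.mem_cons_self _ _))
            (Finset.prod_ne_zero_iff.2 fun η hη => hne η (Finset.mem_cons_of_mem hη))]
          have h1 := ih (fun η hη => hs (Finset.mem_cons_of_mem hη)) (fun η hη => hne η (Finset.mem_cons_of_mem hη))
          have h2 := hcon ξ (hs (Finset.mem_cons_self _ _))
          rw [w.ge_iff (hne ξ (Finset.mem_cons_self _ _))] at h2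
          omega
      omega
    exact this _ (Finset.Subset.refl _) hg
  obtain ⟨ξ, hξ, hgξ⟩ := key
  rw [mul_one] at hgξ
  have hξq : ξ ^ q = 1 := (Polynomial.mem_nthRootsFinset κ.hq.pos _).1 hξ
  haveI : NeZero q := ⟨κ.hq.ne_zero⟩
  obtain ⟨i, _, hi⟩ := hζM.eq_pow_of_pow_eq_one hξq
  have hσξ : κ.σ ξ = ξ := by rw [← hi, map_pow, AlgEquiv.commutes]
  have hg2 : w.ge 1 (κ.σ (κ.α - ξ)) := by
    rw [← act_ge, hfix]; exact hgξ
  rw [map_sub, hσξ, κ.hα] at hg2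
  have hg3 : w.ge 1 (algebraMap L M κ.ζ - 1) := by
    have h3 := w.ge_sub hg2 hgξ
    have h4 : w.ge 0 (κ.α⁻¹) := by rw [w.ge_iff (inv_ne_zero κ.α0), n_inv, hαn]; simp
    have h5 := w.ge_mul h3 h4
    have e : (algebraMap L M κ.ζ * κ.α - ξ - (κ.α - ξ)) * κ.α⁻¹ = algebraMap L M κ.ζ - 1 := by
      have := κ.α0
      field_simp
      ring
    rw [e] at h5
    exact h5
  set z := algebraMap L M κ.ζ
  have hz0 : w.ge 0 z := by
    rw [w.ge_iff (hζM.ne_zero κ.hq.ne_zero), w.n_of_pow_eq_one κ.hq.ne_zero hζM.pow_eq_one]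
  have hall : ∀ i : ℕ, w.ge 1 (z ^ i - 1) := by
    intro i
    have e : z ^ i - 1 = (z - 1) * ∑ j ∈ Finset.range i, z ^ j := by rw [mul_geom_sum]
    rw [e]
    exact w.ge_mul hg3 (w.ge_sum _ _ fun j _ => w.ge_pow_zero hz0 j)
  have hsum := hζM.geom_sum_eq_zero κ.hq.one_lt
  have hqq : w.ge 1 (∑ i ∈ Finset.range q, (z ^ i - 1)) := w.ge_sum _ _ fun j _ => hall j
  rw [Finset.sum_sub_distrib, hsum] at hqq
  have h9 := w.ge_neg hqq
  simp only [Finset.sum_const, Finset.card_range, nsmul_eq_mul, mul_one, zero_sub, neg_neg] at h9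
  rw [w.ge_iff κ.hq0, κ.n_q p] at h9
  omega

end Kum

namespace FFPrime
variable {F : Type} [Field F] (v : FFPrime F)

theorem n_one_add {y : F} (hy : y ≠ 0) (h : v.n y < 0) : 1 + y ≠ 0 ∧ v.n (1 + y) = v.n y := by
  rw [add_comm]
  exact v.n_add_eq hy ((v.ge_iff one_ne_zero).2 (by rw [n_one]; omega))

theorem dvd_root {q : ℕ} {y α : F} (h : α ^ q = y) (hy : y ≠ 0) (hq : q ≠ 0) : (q : ℤ) ∣ v.n y := by
  have h0 : α ≠ 0 := by rintro rfl; rw [zero_pow hq] at h; exact hy h.symm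
  rw [← h, v.n_pow h0]; exact dvd_mul_right _ _

theorem n_add_inv {a : F} (ha : a ≠ 0) (h : v.n a ≠ 0) : a + a⁻¹ ≠ 0 ∧ v.n (a + a⁻¹) < 0 ∧
    (v.n (a + a⁻¹) = v.n a ∨ v.n (a + a⁻¹) = - v.n a) := by
  rcases lt_or_gt_of_ne h with h | h
  · obtain ⟨h1, h2⟩ := v.n_add_eq ha (y := a⁻¹) ((v.ge_iff (inv_ne_zero ha)).2 (by rw [n_inv]; omega))
    exact ⟨h1, by omega, Or.inl h2⟩
  · obtain ⟨h1, h2⟩ := v.n_add_eq (inv_ne_zero ha) (y := a) ((v.ge_iff ha).2 (by rw [n_inv]; omega))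
    rw [add_comm] at h1 h2
    rw [n_inv] at h2
    exact ⟨h1, by omega, Or.inr h2⟩

theorem local_dvd {q : ℕ} (hq : q.Prime) {x a b α1 α3 α4 : F} (hx : x ≠ 0) (ha : a ≠ 0) (hb : b ≠ 0)
    (hc : b * x ^ q + b ^ q ≠ 0)
    (h1 : α1 ^ q = 1 + (b * x ^ q + b ^ q)⁻¹) (h3 : α3 ^ q = 1 + x⁻¹)
    (h4 : α4 ^ q = 1 + (a + a⁻¹) * x⁻¹) (hv : 0 ≤ v.n x) :
    (q : ℤ) ∣ v.n a ∧ (q : ℤ) ∣ v.n (b * x ^ q + b ^ q) := by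
  have hq0 := hq.ne_zero
  have hxq : (q : ℤ) ∣ v.n x := by
    rcases hv.eq_or_lt with h | h
    · rw [← h]; exact dvd_zero _
    · obtain ⟨e1, e2⟩ := v.n_one_add (inv_ne_zero hx) (by rw [n_inv]; omega)
      have := v.dvd_root h3 e1 hq0
      rw [e2, n_inv] at this
      exact (dvd_neg).1 this
  constructor
  · by_cases h : v.n a = 0
    · rw [h]; exact dvd_zero _
    · obtain ⟨e1, e2, e3⟩ := v.n_add_inv ha h
      have e4 : v.n ((a + a⁻¹) * x⁻¹) = v.n (a + a⁻¹) - v.n x := by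
        rw [v.n_mul e1 (inv_ne_zero hx), n_inv]; ring
      obtain ⟨e5, e6⟩ := v.n_one_add (mul_ne_zero e1 (inv_ne_zero hx)) (by omega)
      have := v.dvd_root h4 e5 hq0
      rw [e6, e4] at this
      have h7 := (dvd_sub_left hxq).1 this
      rcases e3 with e | e
      · rwa [e] at h7
      · rw [e] at h7; exact (dvd_neg).1 h7
  · rcases lt_trichotomy (v.n (b * x ^ q + b ^ q)) 0 with h | h | h
    · have hbn : v.n b < 0 := by
        by_contra hcon
        push Not at hcon
        have g1 : v.ge 0 b := (v.ge_iff hb).2 hcon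
        have g2 : v.ge 0 x := (v.ge_iff hx).2 hv
        have := v.ge_add (v.ge_mul g1 (v.ge_pow_zero g2 q)) (v.ge_pow_zero g1 q)
        have := (v.ge_iff hc).1 this
        omega
      have hlt : v.n (b ^ q) + 1 ≤ v.n (b * x ^ q) := by
        rw [v.n_pow hb, v.n_mul hb (pow_ne_zero _ hx), v.n_pow hx]
        have h2 : (2 : ℤ) ≤ q := by exact_mod_cast hq.two_le
        have h5 : (q : ℤ) * v.n b ≤ 2 * v.n b := by nlinarith
        have h6 : (0 : ℤ) ≤ q * v.n x := by positivity
        omega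
      obtain ⟨_, e⟩ := v.n_add_eq (pow_ne_zero q hb) ((v.ge_iff (mul_ne_zero hb (pow_ne_zero q hx))).2 hlt)
      rw [add_comm, e, v.n_pow hb]
      exact dvd_mul_right _ _
    · rw [h]; exact dvd_zero _
    · obtain ⟨e1, e2⟩ := v.n_one_add (inv_ne_zero hc) (by rw [n_inv]; omega)
      have := v.dvd_root h1 e1 hq0
      rw [e2, n_inv] at this
      exact (dvd_neg).1 this

end FFPrime

set_option autoImplicit false
set_option linter.all false


theorem FFld.of_finite {p : ℕ} [Fact p.Prime] {F F' : Type} [Field F] [Field F'] [Algebra (ZMod p) F]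
    [Algebra (ZMod p) F'] [Algebra F F'] [IsScalarTower (ZMod p) F F'] [FiniteDimensional F F'] (h : FFld p F) : FFld p F' := by
  haveI := h.ess
  refine ⟨Algebra.EssFiniteType.comp (ZMod p) F F', ?_⟩
  rw [← trdeg_add_eq (ZMod p) F, h.tr, trdeg_eq_zero, add_zero]

theorem FFld.ratFunc (p : ℕ) [Fact p.Prime] : FFld p (RatFunc (ZMod p)) := by
  constructor
  · haveI : Algebra.EssFiniteType (Polynomial (ZMod p)) (RatFunc (ZMod p)) :=
      Algebra.EssFiniteType.of_isLocalization _ (nonZeroDivisors (Polynomial (ZMod p)))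
    exact Algebra.EssFiniteType.comp (ZMod p) (Polynomial (ZMod p)) (RatFunc (ZMod p))
  · haveI : Algebra.IsAlgebraic (Polynomial (ZMod p)) (RatFunc (ZMod p)) :=
      IsLocalization.isAlgebraic _ (nonZeroDivisors (Polynomial (ZMod p)))
    rw [← trdeg_add_eq (ZMod p) (Polynomial (ZMod p)), Polynomial.trdeg_of_isDomain, trdeg_eq_zero, add_zero]

theorem findim_of_adjoin {L M : Type} [Field L] [Field M] [Algebra L M] {α : M} {q : ℕ} (hq : 0 < q) {a : L}
    (ha : α ^ q = algebraMap L M a) (htop : IntermediateField.adjoin L {α} = ⊤) : FiniteDimensional L M := by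
  have hint : IsIntegral L α := IsIntegral.of_pow hq (by rw [ha]; exact isIntegral_algebraMap)
  haveI := IntermediateField.adjoin.finiteDimensional hint
  rw [htop] at this
  exact Module.Finite.equiv (IntermediateField.topEquiv (F := L) (E := M)).toLinearEquiv

theorem norm_trivial {L M : Type} [Field L] [Field M] [Algebra L M] {α : M} {q : ℕ} (hq : q.Prime) {a β ζ : L}
    (ha0 : a ≠ 0) (hζ : IsPrimitiveRoot ζ q)
    (ha : α ^ q = algebraMap L M a) (htop : IntermediateField.adjoin L {α} = ⊤) (hβ : β ^ q = a) (c : L) :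
    ∃ y : M, Algebra.norm L y = c := by
  have hβ0 : β ≠ 0 := by rintro rfl; rw [zero_pow hq.ne_zero] at hβ; exact ha0 hβ.symm
  haveI : NeZero q := ⟨hq.ne_zero⟩
  have hb0 : algebraMap L M β ≠ 0 := by simpa using hβ0
  have h1 : (α / algebraMap L M β) ^ q = 1 := by
    rw [div_pow, ha, ← map_pow, hβ, div_self]; simpa using ha0
  obtain ⟨i, _, hi⟩ := (hζ.map_of_injective (algebraMap L M).injective).eq_pow_of_pow_eq_one h1
  have hα : α = algebraMap L M (ζ ^ i * β) := by
    rw [map_mul, map_pow, hi, div_mul_cancel₀ _ hb0]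
  have hbot : (⊥ : IntermediateField L M) = ⊤ := by
    rw [← htop, eq_comm, IntermediateField.adjoin_simple_eq_bot_iff, hα]
    exact IntermediateField.algebraMap_mem _ _
  have hfr : Module.finrank L M = 1 := by
    rw [← IntermediateField.finrank_top', ← hbot, IntermediateField.finrank_bot]
  exact ⟨algebraMap L M c, by rw [Algebra.norm_algebraMap, hfr, pow_one]⟩

open Polynomial in
theorem exists_kum {L M : Type} [Field L] [Field M] [Algebra L M] {α : M} {q : ℕ} (hq : q.Prime) (hq0 : (q : M) ≠ 0)
    {a ζ : L} (ha0 : a ≠ 0) (hζ : IsPrimitiveRoot ζ q)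
    (ha : α ^ q = algebraMap L M a) (htop : IntermediateField.adjoin L {α} = ⊤) (hβ : ∀ β : L, β ^ q ≠ a)
    (hunr : ∀ v : FFPrime L, (q : ℤ) ∣ v.n a) :
    ∃ κ : Kum q L M, κ.a = a ∧ ∀ y, Algebra.norm L y = κ.nmL y := by
  classical
  haveI : NeZero q := ⟨hq.ne_zero⟩
  haveI := findim_of_adjoin hq.pos ha htop
  have H : Irreducible (X ^ q - C a) := X_pow_sub_C_irreducible_of_prime hq hβ
  have hint : IsIntegral L α := IsIntegral.of_finite L α
  have hmin : X ^ q - C a = minpoly L α := minpoly.eq_of_irreducible_of_monic H (by simp [ha]) (monic_X_pow_sub_C a hq.ne_zero)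
  have hfr : Module.finrank L M = q := by
    rw [← IntermediateField.finrank_top', ← htop, IntermediateField.adjoin.finrank hint, ← hmin,
      natDegree_X_pow_sub_C]
  have hζ' : (primitiveRoots q L).Nonempty := ⟨ζ, (mem_primitiveRoots hq.pos).2 hζ⟩
  haveI hspl : IsSplittingField L M (X ^ q - C a) := by
    have := isSplittingField_X_pow_sub_C_of_root_adjoin_eq_top (K := L) (L := M) (a := a) (α := α) (by rw [hfr]; exact hζ')
      (by rw [hfr]; exact ha) htop
    rwa [hfr] at this
  haveI hgal : IsGalois L M := isGalois_of_isSplittingField_X_pow_sub_C hζ' H M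
  let E := autEquivZmod H M hζ
  let σ : M ≃ₐ[L] M := E.symm (Multiplicative.ofAdd (1 : ZMod q))
  have hσs : ∀ s : ℕ, σ ^ s = E.symm (Multiplicative.ofAdd (s : ZMod q)) := by
    intro s
    rw [← map_pow, ← ofAdd_nsmul, nsmul_one]
  have hσα : σ α = algebraMap L M ζ * α := by
    have := autEquivZmod_symm_apply_natCast H M ha hζ 1
    rw [pow_one, Nat.cast_one] at this
    rw [← Algebra.smul_def]; exact this
  have hgen : ∀ τ : M ≃ₐ[L] M, ∃ s, s < q ∧ σ ^ s = τ := by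
    intro τ
    refine ⟨(Multiplicative.toAdd (E τ)).val, ZMod.val_lt _, ?_⟩
    rw [hσs, ZMod.natCast_zmod_val, ofAdd_toAdd, MulEquiv.symm_apply_apply]
  have hα0 : α ≠ 0 := by
    rintro rfl
    rw [zero_pow hq.ne_zero] at ha
    exact ha0 ((map_eq_zero _).1 ha.symm)
  let κ : Kum q L M :=
    { hq := hq
      hq0 := hq0
      σ := σ
      hσ := by rw [hσs, ZMod.natCast_self, ofAdd_zero, map_one]
      fix := by
        intro y hy
        have : y ∈ (⊥ : IntermediateField L M) := by
          rw [IsGalois.mem_bot_iff_fixed]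
          intro τ
          obtain ⟨s, _, rfl⟩ := hgen τ
          clear * - hy
          induction s with
          | zero => rfl
          | succ s ih => rw [pow_succ, AlgEquiv.mul_apply, hy, ih]
        exact IntermediateField.mem_bot.1 this
      ζ := ζ
      hζ := hζ
      α := α
      α0 := hα0
      hα := hσα
      a := a
      ha := ha
      hunr := hunr }
  refine ⟨κ, rfl, fun y => ?_⟩
  apply (algebraMap L M).injective
  rw [κ.nmL_spec, Algebra.norm_eq_prod_automorphisms, Kum.nm]
  symm
  refine Finset.prod_bij (fun s _ => σ ^ s) (fun _ _ => Finset.mem_univ _) ?_ ?_ (fun _ _ => rfl)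
  · intro s hs t ht h
    rw [hσs, hσs] at h
    have h2 := Multiplicative.ofAdd.injective (E.symm.injective h)
    rw [ZMod.natCast_eq_natCast_iff, Nat.ModEq, Nat.mod_eq_of_lt (Finset.mem_range.1 hs),
      Nat.mod_eq_of_lt (Finset.mem_range.1 ht)] at h2
    exact h2
  · intro τ _
    obtain ⟨s, h1, h2⟩ := hgen τ
    exact ⟨s, Finset.mem_range.2 h1, h2⟩

set_option autoImplicit false
set_option linter.all false

theorem core_norm {p q : ℕ} [Fact p.Prime] (hq : q.Prime) (hqp : q ≠ p) {L M : Type} [Field L] [Field M] [Algebra L M]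
    [Algebra (ZMod p) L] [FFld p L] {ζ x a b α1 α3 α4 : L} {α : M} (hζ : IsPrimitiveRoot ζ q)
    (hx : x ≠ 0) (ha : a ≠ 0) (hb : b ≠ 0) (hc : b * x ^ q + b ^ q ≠ 0)
    (h1 : α1 ^ q = 1 + (b * x ^ q + b ^ q)⁻¹) (h3 : α3 ^ q = 1 + x⁻¹)
    (h4 : α4 ^ q = 1 + (a + a⁻¹) * x⁻¹)
    (hpl : ∀ v : FFPrime L, 0 ≤ v.n x ∨ (v.n a = 0 ∧ v.ge 1 (a - 1)))
    (hα : α ^ q = algebraMap L M a) (htop : IntermediateField.adjoin L {α} = ⊤) :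
    ∃ y : M, Algebra.norm L y = b * x ^ q + b ^ q := by
  by_cases hβ : ∃ β : L, β ^ q = a
  · obtain ⟨β, hβ⟩ := hβ
    exact norm_trivial hq ha hζ hα htop hβ _
  push Not at hβ
  letI : Algebra (ZMod p) M := ((algebraMap L M).comp (algebraMap (ZMod p) L)).toAlgebra
  haveI : IsScalarTower (ZMod p) L M := IsScalarTower.of_algebraMap_eq fun _ => rfl
  haveI := findim_of_adjoin hq.pos hα htop
  haveI : FFld p M := FFld.of_finite (F := L) inferInstance
  have hq0 : (q : M) ≠ 0 := by
    haveI : CharP M p := charP_of_injective_algebraMap (algebraMap (ZMod p) M).injective p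
    rw [Ne, CharP.cast_eq_zero_iff M p]
    intro h
    exact hqp ((Nat.prime_dvd_prime_iff_eq Fact.out hq).1 h).symm
  obtain ⟨κ, hκa, hκn⟩ := exists_kum hq hq0 ha hζ hα htop hβ (fun v => by
    rcases hpl v with h | h
    · exact (v.local_dvd hq hx ha hb hc h1 h3 h4 h).1
    · rw [h.1]; exact dvd_zero _)
  obtain ⟨y, hy⟩ := κ.exists_norm_of_local p hc (fun v => by
    rcases hpl v with h | h
    · exact Or.inl (v.local_dvd hq hx ha hb hc h1 h3 h4 h).2
    · refine Or.inr (κ.split_of_one p ?_ ?_)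
      · rw [hκa]; exact h.1
      · rw [hκa]; exact h.2)
  exact ⟨y, by rw [hκn, hy]⟩

/-- If `S` is a nonempty finite set of primes of `K` containing all
poles of `x`, and `a, b` are units at all primes of `S` with `a ≡ 1` at all primes of
`S`, then the norm equation `N_{L₄(a^{1/q})/L₄}(y) = b x^q + b^q` has a solution. -/
theorem statement18 (p q : ℕ) [Fact p.Prime] (hq : q.Prime) (hqp : q ≠ p)
    (K : Type) [Field K] [Algebra (RatFunc (ZMod p)) K]
    [FiniteDimensional (RatFunc (ZMod p)) K]
    (ζ : K) (hζ : IsPrimitiveRoot ζ q)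
    (x : K) (hx : x ≠ 0)
    (S : Set (FFPrime K)) (hSfin : S.Finite) (hSne : S.Nonempty)
    (hpoles : ∀ v : FFPrime K, v.ord x < 0 → v ∈ S)
    (a b : K) (ha : a ≠ 0) (hb : b ≠ 0)
    (hunit : ∀ v ∈ S, v.ord a = 0 ∧ v.ord b = 0)
    (hone : ∀ v ∈ S, 0 < v.ord (a - 1))
    (hnz : b * x ^ q + b ^ q ≠ 0) :
    NormTower4Solvable q K a b x := by
  intro M1 _ _ α1 h1 t1 M3 _ _ α3 h3 t3 M4 _ _ α4 h4 t4 M5 _ _ α5 h5 t5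
  haveI := findim_of_adjoin hq.pos h1 t1
  haveI := findim_of_adjoin hq.pos h3 t3
  haveI := findim_of_adjoin hq.pos h4 t4
  letI : Algebra (ZMod p) K := ((algebraMap (RatFunc (ZMod p)) K).comp (algebraMap (ZMod p) (RatFunc (ZMod p)))).toAlgebra
  haveI : IsScalarTower (ZMod p) (RatFunc (ZMod p)) K := IsScalarTower.of_algebraMap_eq fun _ => rfl
  letI : Algebra (ZMod p) M1 := ((algebraMap K M1).comp (algebraMap (ZMod p) K)).toAlgebra
  haveI : IsScalarTower (ZMod p) K M1 := IsScalarTower.of_algebraMap_eq fun _ => rfl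
  letI : Algebra (ZMod p) M3 := ((algebraMap M1 M3).comp (algebraMap (ZMod p) M1)).toAlgebra
  haveI : IsScalarTower (ZMod p) M1 M3 := IsScalarTower.of_algebraMap_eq fun _ => rfl
  letI : Algebra (ZMod p) M4 := ((algebraMap M3 M4).comp (algebraMap (ZMod p) M3)).toAlgebra
  haveI : IsScalarTower (ZMod p) M3 M4 := IsScalarTower.of_algebraMap_eq fun _ => rfl
  have f0 : FFld p K := FFld.of_finite (F := RatFunc (ZMod p)) (FFld.ratFunc p)
  have f1 : FFld p M1 := FFld.of_finite (F := K) f0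
  have f3 : FFld p M3 := FFld.of_finite (F := M1) f1
  haveI f4 : FFld p M4 := FFld.of_finite (F := M3) f3
  let g : K →+* M4 := (algebraMap M3 M4).comp ((algebraMap M1 M3).comp (algebraMap K M1))
  have hg : ∀ z, algebraMap M3 M4 (algebraMap M1 M3 (algebraMap K M1 z)) = g z := fun _ => rfl
  have hg0 : ∀ z : K, z ≠ 0 → g z ≠ 0 := fun z hz => by simpa using hz
  have e1 : (algebraMap M3 M4 (algebraMap M1 M3 α1)) ^ q = 1 + (g b * g x ^ q + g b ^ q)⁻¹ := by
    rw [← map_pow, ← map_pow, h1, hg]; simp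
  have e3 : (algebraMap M3 M4 α3) ^ q = 1 + (g x)⁻¹ := by
    rw [← map_pow, h3, hg]; simp
  have e4 : α4 ^ q = 1 + (g a + (g a)⁻¹) * (g x)⁻¹ := by
    rw [h4, hg]; simp
  have e5 : g (b * x ^ q + b ^ q) = g b * g x ^ q + g b ^ q := by simp
  rw [hg, e5]
  rw [hg] at h5
  refine core_norm hq hqp (hζ.map_of_injective g.injective) (hg0 x hx) (hg0 a ha) (hg0 b hb)
    (by rw [← e5]; exact hg0 _ hnz) e1 e3 e4 ?_ h5 t5
  intro v
  obtain ⟨v3, n3, p3, r3⟩ := FFPrime.exists_restrict (L := M3) v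
  obtain ⟨v1, n1, p1, r1⟩ := FFPrime.exists_restrict (L := M1) v3
  obtain ⟨v0, n0, p0, r0⟩ := FFPrime.exists_restrict (L := K) v1
  have hr : ∀ z : K, z ≠ 0 → v.n (g z) = ((n3 * n1 * n0 : ℕ) : ℤ) * v0.n z := by
    intro z hz
    have z1 : algebraMap K M1 z ≠ 0 := by simpa using hz
    have z3 : algebraMap M1 M3 (algebraMap K M1 z) ≠ 0 := by simpa using hz
    rw [← hg, r3 _ z3, r1 _ z1, r0 _ hz]
    push_cast; ring
  have hpos : 0 < ((n3 * n1 * n0 : ℕ) : ℤ) := by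
    exact_mod_cast Nat.mul_pos (Nat.mul_pos p3 p1) p0
  by_cases hS : v0 ∈ S
  · right
    have ha0 : v0.n a = 0 := by
      have := (hunit v0 hS).1
      rw [v0.ord_eq ha] at this
      exact_mod_cast this
    refine ⟨by rw [hr a ha, ha0, mul_zero], ?_⟩
    have e6 : g a - 1 = g (a - 1) := by simp
    rw [e6]
    by_cases hz : a - 1 = 0
    · rw [hz, map_zero]; exact v.ge_zero _
    · rw [v.ge_iff (hg0 _ hz), hr _ hz]
      have := hone v0 hS
      rw [v0.ord_eq hz] at this
      have h7 : 0 < v0.n (a - 1) := by exact_mod_cast this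
      have := mul_pos hpos h7
      omega
  · left
    rw [hr x hx]
    refine mul_nonneg hpos.le ?_
    by_contra hcon
    push Not at hcon
    apply hS
    apply hpoles
    rw [v0.ord_eq hx]
    exact_mod_cast hcon
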